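/- arXiv:1205.4995 — 2 statements merged into one kernel-verified Lean document; each statement's English description precedes it below -/
import Mathlib

section
/- Let (τ, u, S) be a C¹ solution of the one-dimensional Lagrangian compressible Euler equations on ℝ×[0,∞) with τ > 0 everywhere, whose initial data satisfy the stated bounds (V < ∞, 0 < M_L < m < M_U, |s̃(·,0)| < M_s, |r̃(·,0)| < M_r). Then for all (x,t) ∈ ℝ×[0,∞): |u(x,t)| ≤ ((N₁+N₂)/2)·M_U^{1/(2γ)} and η(x,t) ≤ ((N₁+N₂)/2)·M_L^{1/(2γ)−1}; consequently the density satisfies ρ(x,t) = 1/τ(x,t) ≤ K_τ^{−1}·(((N₁+N₂)/2)·M_L^{1/(2γ)−1})^{2/(γ−1)}, an a priori bound depending only on the initial data. -/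
open Real MeasureTheory

/-- partial derivative in the first (space) variable -/
noncomputable def pdx (f : ℝ → ℝ → ℝ) (x t : ℝ) : ℝ := deriv (fun x' => f x' t) x
/-- partial derivative in the second (time) variable -/
noncomputable def pdt (f : ℝ → ℝ → ℝ) (x t : ℝ) : ℝ := deriv (fun t' => f x t') t

section

open Set Filter Topology
open scoped NNReal

/-- Two global solutions of a locally Lipschitz scalar equation that meet once coincide. -/
lemma ode_global_unique {f : ℝ → ℝ → ℝ}
    (hlip : ∀ R, ∃ K : ℝ≥0, ∀ t ≤ R, LipschitzOnWith K (f t) (Icc (-R) R))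
    {y z : ℝ → ℝ} (hy : ∀ t, HasDerivAt y (f t (y t)) t) (hz : ∀ t, HasDerivAt z (f t (z t)) t)
    {t₀ : ℝ} (h : y t₀ = z t₀) (t : ℝ) : y t = z t := by
  have hyc : Continuous y := continuous_iff_continuousAt.2 fun t => (hy t).continuousAt
  have hzc : Continuous z := continuous_iff_continuousAt.2 fun t => (hz t).continuousAt
  set a := min t t₀ - 1
  set b := max t t₀ + 1
  have ht : t ∈ Icc a b := ⟨by have := min_le_left t t₀; grind, by have := le_max_left t t₀; grind⟩
  have ht₀ : t₀ ∈ Ioo a b :=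
    ⟨by have := min_le_right t t₀; grind, by have := le_max_right t t₀; grind⟩
  obtain ⟨Y, hY⟩ := (isCompact_Icc (a := a) (b := b)).exists_bound_of_continuousOn hyc.continuousOn
  obtain ⟨Z, hZ⟩ := (isCompact_Icc (a := a) (b := b)).exists_bound_of_continuousOn hzc.continuousOn
  set R := max b (max Y Z)
  obtain ⟨K, hK⟩ := hlip R
  refine ODE_solution_unique_of_mem_Icc (v := f) (s := fun _ => Icc (-R) R) (K := K)
    (fun t ht => hK t (ht.2.le.trans (le_max_left _ _))) ht₀ hyc.continuousOn
    (fun t _ => hy t) (fun t ht => ?_) hzc.continuousOn (fun t _ => hz t) (fun t ht => ?_) h ht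
  · have := hY t (Ioo_subset_Icc_self ht)
    rw [Real.norm_eq_abs] at this
    exact abs_le.1 (this.trans ((le_max_left _ _).trans (le_max_right _ _)))
  · have := hZ t (Ioo_subset_Icc_self ht)
    rw [Real.norm_eq_abs] at this
    exact abs_le.1 (this.trans ((le_max_right _ _).trans (le_max_right _ _)))

/-- Global solutions of a locally Lipschitz scalar equation keep their order. -/
lemma ode_global_mono {f : ℝ → ℝ → ℝ}
    (hlip : ∀ R, ∃ K : ℝ≥0, ∀ t ≤ R, LipschitzOnWith K (f t) (Icc (-R) R))
    {y z : ℝ → ℝ} (hy : ∀ t, HasDerivAt y (f t (y t)) t) (hz : ∀ t, HasDerivAt z (f t (z t)) t)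
    {t₀ : ℝ} (h : y t₀ ≤ z t₀) (t : ℝ) : y t ≤ z t := by
  by_contra! hlt
  have hc : Continuous fun t => y t - z t :=
    (continuous_iff_continuousAt.2 fun t => (hy t).continuousAt).sub
      (continuous_iff_continuousAt.2 fun t => (hz t).continuousAt)
  obtain ⟨r, hr⟩ := mem_range_of_exists_le_of_exists_ge hc (c := 0) ⟨t₀, by linarith⟩
    ⟨t, by linarith⟩
  have := ode_global_unique hlip hy hz (t₀ := r) (by simp only at hr; linarith) t
  linarith

/-- Existence of global solutions of a scalar equation whose right-hand side is locally Lipschitz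
in space and bounded on bounded time intervals. -/
lemma ode_global_exists {f : ℝ → ℝ → ℝ} (hf : Continuous (Function.uncurry f))
    (hlip : ∀ R, ∃ K : ℝ≥0, ∀ t ≤ R, LipschitzOnWith K (f t) (Icc (-R) R))
    (hbd : ∀ R, ∃ C, ∀ t ≤ R, ∀ x, |f t x| ≤ C) (t₀ x₀ : ℝ) :
    ∃ y : ℝ → ℝ, y t₀ = x₀ ∧ ∀ t, HasDerivAt y (f t (y t)) t := by
  have key : ∀ r : ℝ, 0 < r → ∃ y : ℝ → ℝ, y t₀ = x₀ ∧
      ∀ t ∈ Icc (t₀ - r) (t₀ + r), HasDerivWithinAt y (f t (y t)) (Icc (t₀ - r) (t₀ + r)) t := by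
    intro r hr
    obtain ⟨C, hC⟩ := hbd (t₀ + r)
    have hC0 : 0 ≤ C := (abs_nonneg _).trans (hC t₀ (by linarith) 0)
    set R := max (t₀ + r) (|x₀| + C * r)
    obtain ⟨K, hK⟩ := hlip R
    have hmem : t₀ ∈ Icc (t₀ - r) (t₀ + r) := ⟨by linarith, by linarith⟩
    have hPL : IsPicardLindelof f (⟨t₀, hmem⟩ : Icc (t₀ - r) (t₀ + r)) x₀
        (⟨C * r, by positivity⟩ : ℝ≥0) 0 ⟨C, hC0⟩ K := by
      constructor
      · intro t ht
        refine (hK t (ht.2.trans (le_max_left _ _))).mono fun x hx => ?_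
        have hx' : |x - x₀| ≤ C * r := by
          have := Metric.mem_closedBall.1 hx
          rwa [Real.dist_eq] at this
        have h1 : |x| ≤ R := by
          have := abs_sub_abs_le_abs_sub x x₀
          exact le_trans (by linarith) (le_max_right _ _)
        exact abs_le.1 h1
      · intro x _
        exact (hf.comp (by fun_prop : Continuous fun t : ℝ => (t, x))).continuousOn
      · intro t ht x _
        exact hC t ht.2 x
      · simp only [add_sub_cancel_left, sub_sub_cancel, max_self, NNReal.coe_zero, sub_zero]
        exact le_refl (C * r)
    exact hPL.exists_eq_forall_mem_Icc_hasDerivWithinAt₀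
  have key' : ∀ n : ℕ, ∃ y : ℝ → ℝ, y t₀ = x₀ ∧
      ∀ t ∈ Icc (t₀ - (n + 1)) (t₀ + (n + 1)),
        HasDerivWithinAt y (f t (y t)) (Icc (t₀ - (n + 1)) (t₀ + (n + 1))) t :=
    fun n => key _ (by positivity)
  choose y hy0 hy using key'
  have hD : ∀ (n : ℕ) (t : ℝ), t ∈ Ioo (t₀ - (n + 1)) (t₀ + (n + 1)) → HasDerivAt (y n) (f t (y n t)) t :=
    fun n t ht => (hy n t (Ioo_subset_Icc_self ht)).hasDerivAt (Icc_mem_nhds ht.1 ht.2)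
  have hC : ∀ n : ℕ, ContinuousOn (y n) (Icc (t₀ - (n + 1)) (t₀ + (n + 1))) :=
    fun n t ht => (hy n t ht).continuousWithinAt
  have agree : ∀ n m : ℕ, n ≤ m → EqOn (y n) (y m) (Icc (t₀ - (n + 1)) (t₀ + (n + 1))) := by
    intro n m hnm
    have hnm' : (n : ℝ) ≤ m := by exact_mod_cast hnm
    have hsub : Icc (t₀ - ((n : ℝ) + 1)) (t₀ + (n + 1)) ⊆ Icc (t₀ - (m + 1)) (t₀ + (m + 1)) :=
      Icc_subset_Icc (by linarith) (by linarith)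
    have hsub' : Ioo (t₀ - ((n : ℝ) + 1)) (t₀ + (n + 1)) ⊆ Ioo (t₀ - (m + 1)) (t₀ + (m + 1)) :=
      Ioo_subset_Ioo (by linarith) (by linarith)
    obtain ⟨Y, hY⟩ := isCompact_Icc.exists_bound_of_continuousOn (hC n)
    obtain ⟨Z, hZ⟩ := isCompact_Icc.exists_bound_of_continuousOn ((hC m).mono hsub)
    set R := max (t₀ + (n + 1)) (max Y Z)
    obtain ⟨K, hK⟩ := hlip R
    refine ODE_solution_unique_of_mem_Icc (v := f) (s := fun _ => Icc (-R) R) (K := K)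
      (fun t ht => hK t (ht.2.le.trans (le_max_left _ _)))
      (t₀ := t₀) ⟨by linarith [n.cast_nonneg (α := ℝ)], by linarith [n.cast_nonneg (α := ℝ)]⟩ (hC n)
      (hD n) (fun t ht => ?_) ((hC m).mono hsub) (fun t ht => hD m t (hsub' ht)) (fun t ht => ?_)
      (by rw [hy0, hy0])
    · have := hY t (Ioo_subset_Icc_self ht)
      rw [Real.norm_eq_abs] at this
      exact abs_le.1 (this.trans ((le_max_left _ _).trans (le_max_right _ _)))
    · have := hZ t (Ioo_subset_Icc_self ht)
      rw [Real.norm_eq_abs] at this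
      exact abs_le.1 (this.trans ((le_max_right _ _).trans (le_max_right _ _)))
  let N : ℝ → ℕ := fun t => ⌈|t - t₀|⌉₊
  have hN : ∀ t, t ∈ Ioo (t₀ - (N t + 1)) (t₀ + (N t + 1)) := by
    intro t
    have h1 : |t - t₀| ≤ N t := Nat.le_ceil _
    have := abs_le.1 h1
    constructor <;> linarith
  refine ⟨fun t => y (N t) t, hy0 _, fun t => ?_⟩
  refine (hD (N t) t (hN t)).congr_of_eventuallyEq ?_
  filter_upwards [Ioo_mem_nhds (hN t).1 (hN t).2] with τ hτ
  rcases le_total (N t) (N τ) with h | h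
  · exact (agree _ _ h (Ioo_subset_Icc_self hτ)).symm
  · exact agree _ _ h (Ioo_subset_Icc_self (hN τ))

/-- Continuous dependence on the initial position, uniformly on bounded time intervals. -/
lemma ode_global_dependence {f : ℝ → ℝ → ℝ}
    (hlip : ∀ R, ∃ K : ℝ≥0, ∀ t ≤ R, LipschitzOnWith K (f t) (Icc (-R) R))
    (hbd : ∀ R, ∃ C, ∀ t ≤ R, ∀ x, |f t x| ≤ C)
    {y : ℝ → ℝ} (hy : ∀ t, HasDerivAt y (f t (y t)) t) (T : ℝ) {ε : ℝ} (hε : 0 < ε) :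
    ∃ δ > 0, ∀ z : ℝ → ℝ, (∀ t, HasDerivAt z (f t (z t)) t) → |z 0 - y 0| ≤ δ →
      ∀ t ∈ Icc 0 T, |z t - y t| ≤ ε := by
  obtain ⟨C, hC⟩ := hbd T
  have growth : ∀ z : ℝ → ℝ, (∀ t, HasDerivAt z (f t (z t)) t) → ∀ t ∈ Icc 0 T,
      |z t - z 0| ≤ C * T := by
    intro z hz t ht
    have hC0 : 0 ≤ C := (abs_nonneg _).trans (hC t ht.2 0)
    have h := (convex_Icc (0 : ℝ) T).norm_image_sub_le_of_norm_hasDerivWithin_le (f := z)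
      (fun t _ => (hz t).hasDerivWithinAt) (C := C) (fun t ht => hC t ht.2 _)
      (left_mem_Icc.2 (ht.1.trans ht.2)) ht
    rw [Real.norm_eq_abs, Real.norm_eq_abs, sub_zero, abs_of_nonneg ht.1] at h
    exact h.trans (mul_le_mul_of_nonneg_left ht.2 hC0)
  set R := max T (|y 0| + 1 + C * T)
  obtain ⟨K, hK⟩ := hlip R
  refine ⟨min 1 (ε * exp (-(K * T))), by positivity, fun z hz h0 t ht => ?_⟩
  have hmem : ∀ z : ℝ → ℝ, (∀ t, HasDerivAt z (f t (z t)) t) → |z 0 - y 0| ≤ 1 →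
      ∀ t ∈ Ico 0 T, z t ∈ Icc (-R) R := by
    intro z hz h0 t ht
    have h1 := growth z hz t (Ico_subset_Icc_self ht)
    have h2 := abs_sub_abs_le_abs_sub (z t) (z 0)
    have h3 := abs_sub_abs_le_abs_sub (z 0) (y 0)
    exact abs_le.1 (le_trans (by linarith) (le_max_right T _))
  have hcont : ∀ z : ℝ → ℝ, (∀ t, HasDerivAt z (f t (z t)) t) → ContinuousOn z (Icc 0 T) :=
    fun z hz t _ => (hz t).continuousAt.continuousWithinAt
  have := dist_le_of_trajectories_ODE_of_mem (v := f) (s := fun _ => Icc (-R) R) (K := K)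
    (fun t ht => hK t (ht.2.le.trans (le_max_left _ _))) (hcont z hz)
    (fun t _ => (hz t).hasDerivWithinAt) (hmem z hz (h0.trans (min_le_left _ _))) (hcont y hy)
    (fun t _ => (hy t).hasDerivWithinAt) (hmem y hy (by simp)) (δ := ε * exp (-(K * T)))
    (by rw [Real.dist_eq]; exact h0.trans (min_le_right _ _)) t ht
  rw [Real.dist_eq] at this
  refine this.trans ?_
  rw [mul_assoc, ← Real.exp_add]
  have : -(K * T) + K * (t - 0) ≤ (0 : ℝ) := by nlinarith [ht.2, K.coe_nonneg]
  nlinarith [Real.exp_le_one_iff.2 this]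

/-- Two quantities transported at the speeds `± g x * (s + v) ^ κ` and coupled through `a`,
constant for nonpositive times. -/
structure CoupledWaves (s v : ℝ → ℝ → ℝ) (g a A G : ℝ → ℝ) (κ V Ms Mv : ℝ) : Prop where
  cont_s : Continuous (Function.uncurry s)
  cont_v : Continuous (Function.uncurry v)
  past_s : ∀ x t, t ≤ 0 → s x t = s x 0
  past_v : ∀ x t, t ≤ 0 → v x t = v x 0
  pos : ∀ x t, 0 < s x t + v x t
  kappa_pos : 0 < κ
  g_cont : Continuous g
  g_pos : ∀ x, 0 < g x
  g_bdd : ∃ C, ∀ x, g x ≤ C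
  lip : ∀ R, ∃ K : ℝ≥0, ∀ t ≤ R,
    LipschitzOnWith K (fun x => g x * (s x t + v x t) ^ κ) (Icc (-R) R)
  deriv_G : ∀ x, HasDerivAt G (1 / g x) x
  deriv_A : ∀ x, HasDerivAt A |a x| x
  A_bot : Tendsto A atBot (𝓝 0)
  A_top : Tendsto A atTop (𝓝 V)
  init_s : ∀ x, |s x 0| < Ms
  init_v : ∀ x, |v x 0| < Mv
  s_eq : ∀ x t, 0 < t → ∃ L : ℝ × ℝ →L[ℝ] ℝ, HasFDerivAt (Function.uncurry s) L (x, t) ∧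
    L (g x * (s x t + v x t) ^ κ, 1) = a x * (g x * (s x t + v x t) ^ κ) * v x t
  v_eq : ∀ x t, 0 < t → ∃ L : ℝ × ℝ →L[ℝ] ℝ, HasFDerivAt (Function.uncurry v) L (x, t) ∧
    L (-(g x * (s x t + v x t) ^ κ), 1) = -(a x * (g x * (s x t + v x t) ^ κ) * s x t)

/-- A right derivative at a minimum over a right neighbourhood is nonnegative. -/
lemma HasDerivAt.nonneg_of_eventually_ge {φ : ℝ → ℝ} {φ' : ℝ} (h : HasDerivAt φ φ' 0)
    (hmin : ∀ᶠ h in 𝓝[>] (0 : ℝ), φ 0 ≤ φ h) : 0 ≤ φ' := by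
  have h1 := (hasDerivWithinAt_iff_tendsto_slope' (s := Ioi (0 : ℝ)) (by simp)).1
    (h.hasDerivWithinAt (s := Ioi 0))
  refine ge_of_tendsto h1 ?_
  filter_upwards [hmin, self_mem_nhdsWithin] with t ht ht0
  rw [slope_def_field]
  have : (0 : ℝ) < t := ht0
  exact div_nonneg (by linarith) (by linarith)

/-- First-order condition where a function touches a barrier along a backward line. -/
lemma touch_barrier {f : ℝ × ℝ → ℝ} {L : ℝ × ℝ →L[ℝ] ℝ} {x₀ t₀ k δ b' : ℝ} {b : ℝ → ℝ}
    (hf : HasFDerivAt f L (x₀, t₀)) (hb : HasDerivAt b b' x₀)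
    (heq : f (x₀, t₀) = exp (δ * t₀) * b x₀)
    (hle : ∀ᶠ h in 𝓝[>] (0 : ℝ),
      f (x₀ - k * h, t₀ - h) ≤ exp (δ * (t₀ - h)) * b (x₀ - k * h)) :
    exp (δ * t₀) * (δ * b x₀ + k * b') ≤ L (k, 1) := by
  have hx : HasDerivAt (fun h : ℝ => x₀ - k * h) (-k) 0 := by
    simpa using ((hasDerivAt_id (0 : ℝ)).const_mul k).const_sub x₀
  have ht : HasDerivAt (fun h : ℝ => t₀ - h) (-1) 0 := by
    simpa using (hasDerivAt_id (0 : ℝ)).const_sub t₀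
  have h1 : HasDerivAt (fun h : ℝ => f (x₀ - k * h, t₀ - h)) (L (-k, -1)) 0 := by
    have hf' : HasFDerivAt f L (x₀ - k * 0, t₀ - 0) := by simpa using hf
    exact hf'.comp_hasDerivAt 0 (hx.prodMk ht)
  have h2 : HasDerivAt (fun h : ℝ => b (x₀ - k * h)) (b' * -k) 0 := by
    have hb' : HasDerivAt b b' (x₀ - k * 0) := by simpa using hb
    exact hb'.comp 0 hx
  have h3 : HasDerivAt (fun h : ℝ => exp (δ * (t₀ - h))) (exp (δ * t₀) * (δ * -1)) 0 := by
    simpa using (ht.const_mul δ).exp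
  have h4 := ((h3.mul h2).sub h1).nonneg_of_eventually_ge (by
    filter_upwards [hle] with h hh
    simp only [Pi.sub_apply, Pi.mul_apply, mul_zero, sub_zero, heq, sub_self]
    linarith)
  have h5 : L (-k, -1) = - L (k, 1) := by rw [← map_neg]; simp
  simp only [mul_zero, sub_zero, h5] at h4
  nlinarith

namespace CoupledWaves

variable {s v : ℝ → ℝ → ℝ} {g a A G : ℝ → ℝ} {κ V Ms Mv : ℝ}

lemma cont_A (H : CoupledWaves s v g a A G κ V Ms Mv) : Continuous A :=
  continuous_iff_continuousAt.2 fun x => (H.deriv_A x).continuousAt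

lemma cont_G (H : CoupledWaves s v g a A G κ V Ms Mv) : Continuous G :=
  continuous_iff_continuousAt.2 fun x => (H.deriv_G x).continuousAt

lemma mono_A (H : CoupledWaves s v g a A G κ V Ms Mv) : Monotone A :=
  monotone_of_hasDerivAt_nonneg H.deriv_A fun _ => abs_nonneg _

lemma A_nonneg (H : CoupledWaves s v g a A G κ V Ms Mv) (x : ℝ) : 0 ≤ A x :=
  H.mono_A.le_of_tendsto H.A_bot x

lemma A_le (H : CoupledWaves s v g a A G κ V Ms Mv) (x : ℝ) : A x ≤ V :=
  H.mono_A.ge_of_tendsto H.A_top x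

lemma V_nonneg (H : CoupledWaves s v g a A G κ V Ms Mv) : 0 ≤ V :=
  (H.A_nonneg 0).trans (H.A_le 0)

lemma strictMono_G (H : CoupledWaves s v g a A G κ V Ms Mv) : StrictMono G :=
  strictMono_of_hasDerivAt_pos H.deriv_G fun x => one_div_pos.2 (H.g_pos x)

lemma Ms_pos (H : CoupledWaves s v g a A G κ V Ms Mv) : 0 < Ms :=
  (abs_nonneg _).trans_lt (H.init_s 0)

lemma Mv_pos (H : CoupledWaves s v g a A G κ V Ms Mv) : 0 < Mv :=
  (abs_nonneg _).trans_lt (H.init_v 0)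

/-- The reflection `x ↦ -x` exchanges the two families. -/
lemma reflect (H : CoupledWaves s v g a A G κ V Ms Mv) :
    CoupledWaves (fun x t => v (-x) t) (fun x t => s (-x) t) (fun x => g (-x)) (fun x => -a (-x))
      (fun x => V - A (-x)) (fun x => -G (-x)) κ V Mv Ms where
  cont_s := H.cont_v.comp (by fun_prop : Continuous fun q : ℝ × ℝ => (-q.1, q.2))
  cont_v := H.cont_s.comp (by fun_prop : Continuous fun q : ℝ × ℝ => (-q.1, q.2))
  past_s x t ht := H.past_v _ t ht
  past_v x t ht := H.past_s _ t ht
  pos x t := by rw [add_comm]; exact H.pos _ t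
  kappa_pos := H.kappa_pos
  g_cont := H.g_cont.comp continuous_neg
  g_pos x := H.g_pos _
  g_bdd := let ⟨C, hC⟩ := H.g_bdd; ⟨C, fun x => hC _⟩
  lip R := by
    obtain ⟨K, hK⟩ := H.lip R
    refine ⟨K, fun t ht => ?_⟩
    rw [lipschitzOnWith_iff_dist_le_mul]
    intro x hx y hy
    have := (hK t ht).dist_le_mul (-x) ⟨by linarith [hx.2], by linarith [hx.1]⟩ (-y)
      ⟨by linarith [hy.2], by linarith [hy.1]⟩
    simpa only [dist_neg_neg, add_comm (v _ _)] using this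
  deriv_G x := by
    exact ((H.deriv_G (-x)).scomp x (hasDerivAt_neg x)).neg.congr_deriv (by simp)
  deriv_A x := by
    simpa using ((H.deriv_A (-x)).scomp x (hasDerivAt_neg x)).const_sub V
  A_bot := by
    simpa using (H.A_top.comp tendsto_neg_atBot_atTop).const_sub V
  A_top := by
    simpa using (H.A_bot.comp tendsto_neg_atTop_atBot).const_sub V
  init_s x := H.init_v _
  init_v x := H.init_s _
  s_eq x t ht := by
    obtain ⟨L, hL, h⟩ := H.v_eq (-x) t ht
    have hφ : HasFDerivAt (fun q : ℝ × ℝ => (-q.1, q.2))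
        ((-ContinuousLinearMap.fst ℝ ℝ ℝ).prod (ContinuousLinearMap.snd ℝ ℝ ℝ)) (x, t) :=
      hasFDerivAt_fst.neg.prodMk hasFDerivAt_snd
    refine ⟨_, HasFDerivAt.comp (x, t) (f := fun q : ℝ × ℝ => (-q.1, q.2)) hL hφ, ?_⟩
    simp only [ContinuousLinearMap.comp_apply, ContinuousLinearMap.prod_apply,
      _root_.neg_apply, ContinuousLinearMap.coe_fst', ContinuousLinearMap.coe_snd']
    rw [add_comm (v _ _), h]; ring
  v_eq x t ht := by
    obtain ⟨L, hL, h⟩ := H.s_eq (-x) t ht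
    have hφ : HasFDerivAt (fun q : ℝ × ℝ => (-q.1, q.2))
        ((-ContinuousLinearMap.fst ℝ ℝ ℝ).prod (ContinuousLinearMap.snd ℝ ℝ ℝ)) (x, t) :=
      hasFDerivAt_fst.neg.prodMk hasFDerivAt_snd
    refine ⟨_, HasFDerivAt.comp (x, t) (f := fun q : ℝ × ℝ => (-q.1, q.2)) hL hφ, ?_⟩
    simp only [ContinuousLinearMap.comp_apply, ContinuousLinearMap.prod_apply,
      _root_.neg_apply, ContinuousLinearMap.coe_fst', ContinuousLinearMap.coe_snd']
    rw [add_comm (v _ _), neg_neg, h]; ring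

lemma G_top (H : CoupledWaves s v g a A G κ V Ms Mv) : Tendsto G atTop atTop := by
  obtain ⟨C, hC⟩ := H.g_bdd
  have hC0 : 0 < C := (H.g_pos 0).trans_le (hC 0)
  have hm : Monotone fun x => G x - x / C :=
    monotone_of_hasDerivAt_nonneg (f' := fun x => 1 / g x - 1 / C)
      (fun x => (H.deriv_G x).sub ((hasDerivAt_id x).div_const C))
      fun x => sub_nonneg.2 (one_div_le_one_div_of_le (H.g_pos x) (hC x))
  refine tendsto_atTop_mono' atTop ?_
    (tendsto_atTop_add_const_left atTop (G 0) (tendsto_id.atTop_div_const hC0))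
  filter_upwards [eventually_ge_atTop 0] with x hx
  have := hm hx
  simp only [zero_div, sub_zero] at this
  simp only [id]; linarith

lemma G_bot (H : CoupledWaves s v g a A G κ V Ms Mv) : Tendsto G atBot atBot := by
  have := tendsto_neg_atTop_atBot.comp (H.reflect.G_top.comp tendsto_neg_atBot_atTop)
  refine this.congr fun x => ?_
  simp

lemma isCompact_slab (H : CoupledWaves s v g a A G κ V Ms Mv) (l r : ℝ) :
    IsCompact {x | l ≤ G x ∧ G x ≤ r} := by
  obtain ⟨y, hy⟩ := (H.G_bot.eventually_lt_atBot l).exists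
  obtain ⟨z, hz⟩ := (H.G_top.eventually_gt_atTop r).exists
  refine isCompact_Icc.of_isClosed_subset
    ((isClosed_le continuous_const H.cont_G).inter (isClosed_le H.cont_G continuous_const))
    (fun x hx => (⟨?_, ?_⟩ : x ∈ Icc y z))
  · exact (H.strictMono_G.lt_iff_lt.1 (hy.trans_le hx.1)).le
  · exact (H.strictMono_G.lt_iff_lt.1 (hx.2.trans_lt hz)).le

end CoupledWaves

/-- A function with positive derivative exceeds its value on a right neighbourhood. -/
lemma HasDerivAt.eventually_lt_of_pos {φ : ℝ → ℝ} {φ' x : ℝ} (h : HasDerivAt φ φ' x)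
    (hpos : 0 < φ') : ∀ᶠ y in 𝓝[>] x, φ x < φ y := by
  have h1 := (hasDerivWithinAt_iff_tendsto_slope' (s := Ioi x) (by simp)).1
    (h.hasDerivWithinAt (s := Ioi x))
  filter_upwards [h1.eventually_const_lt hpos, self_mem_nhdsWithin] with y hy hxy
  rw [slope_def_field] at hy
  have : (0 : ℝ) < y - x := sub_pos.2 hxy
  exact sub_pos.1 ((div_pos_iff_of_pos_right this).1 hy)

namespace CoupledWaves

variable {s v : ℝ → ℝ → ℝ} {g a A G : ℝ → ℝ} {κ V Ms Mv : ℝ}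

lemma eventually_mem_trapezoid (H : CoupledWaves s v g a A G κ V Ms Mv) {x₀ t₀ k q l r : ℝ}
    (hq : |q| < k * g x₀) (hl : l + k * t₀ ≤ G x₀) (hr : G x₀ ≤ r - k * t₀) :
    ∀ᶠ h in 𝓝[>] (0 : ℝ), l + k * (t₀ - h) ≤ G (x₀ - q * h) ∧
      G (x₀ - q * h) ≤ r - k * (t₀ - h) := by
  have hg := H.g_pos x₀
  have hx : HasDerivAt (fun h : ℝ => x₀ - q * h) (-q) 0 := by
    simpa using ((hasDerivAt_id (0 : ℝ)).const_mul q).const_sub x₀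
  have hG : HasDerivAt (fun h : ℝ => G (x₀ - q * h)) (1 / g x₀ * -q) 0 := by
    have hb' : HasDerivAt G (1 / g x₀) (x₀ - q * 0) := by simpa using H.deriv_G x₀
    exact hb'.comp 0 hx
  have hk : HasDerivAt (fun h : ℝ => k * h) k 0 := by
    simpa using (hasDerivAt_id (0 : ℝ)).const_mul k
  have hq' := abs_lt.1 hq
  have e1 := (hk.add hG).eventually_lt_of_pos (by
    have : k + 1 / g x₀ * -q = (k * g x₀ - q) / g x₀ := by field_simp; ring
    rw [this]; exact div_pos (by linarith) hg)
  have e2 := (hk.sub hG).eventually_lt_of_pos (by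
    have : k - 1 / g x₀ * -q = (k * g x₀ + q) / g x₀ := by field_simp; ring
    rw [this]; exact div_pos (by linarith) hg)
  filter_upwards [e1, e2] with h h1 h2
  simp only [Pi.add_apply, Pi.sub_apply, mul_zero, sub_zero, zero_add, zero_sub] at h1 h2
  constructor <;> linarith

lemma barrier_strict (H : CoupledWaves s v g a A G κ V Ms Mv) {σ ρ σ' ρ' : ℝ → ℝ}
    {l r k D T δ : ℝ} (hσ : ∀ x, HasDerivAt σ (σ' x) x) (hρ : ∀ x, HasDerivAt ρ (ρ' x) x)
    (hδ : 0 < δ) (hk0 : 0 ≤ k)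
    (hreg : ∀ x, l ≤ G x → G x ≤ r → 0 < σ x ∧ 0 < ρ x ∧ σ x + ρ x ≤ D ∧
      |a x| * ρ x ≤ σ' x ∧ |a x| * σ x ≤ -ρ' x ∧ |s x 0| < σ x ∧ |v x 0| < ρ x)
    (hk : (exp (δ * T) * D) ^ κ < k) :
    ∀ x t, 0 ≤ t → t ≤ T → l + k * t ≤ G x → G x ≤ r - k * t →
      |s x t| < exp (δ * t) * σ x ∧ |v x t| < exp (δ * t) * ρ x := by
  by_contra! hcon
  obtain ⟨x₁, t₁, ht₁, ht₁T, hl₁, hr₁, hbad₁⟩ := hcon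
  have hσc : Continuous σ := continuous_iff_continuousAt.2 fun x => (hσ x).continuousAt
  have hρc : Continuous ρ := continuous_iff_continuousAt.2 fun x => (hρ x).continuousAt
  have hsc : Continuous fun q : ℝ × ℝ => s q.1 q.2 := H.cont_s
  have hvc : Continuous fun q : ℝ × ℝ => v q.1 q.2 := H.cont_v
  have hGc := H.cont_G
  set B : Set (ℝ × ℝ) := {q | (0 ≤ q.2 ∧ q.2 ≤ T ∧ l + k * q.2 ≤ G q.1 ∧ G q.1 ≤ r - k * q.2) ∧
    (exp (δ * q.2) * σ q.1 ≤ |s q.1 q.2| ∨ exp (δ * q.2) * ρ q.1 ≤ |v q.1 q.2|)} with hB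
  have hne : (x₁, t₁) ∈ B := by
    refine ⟨⟨ht₁, ht₁T, hl₁, hr₁⟩, ?_⟩
    by_cases h : |s x₁ t₁| < exp (δ * t₁) * σ x₁
    · exact Or.inr (hbad₁ h)
    · exact Or.inl (not_lt.1 h)
  have hσ₁ := hreg x₁
  have hclosed : IsClosed B := by
    simp only [hB, ofPred_and, ofPred_or]
    refine IsClosed.inter (IsClosed.inter ?_ (IsClosed.inter ?_ (IsClosed.inter ?_ ?_)))
      (IsClosed.union ?_ ?_) <;> exact isClosed_le (by fun_prop) (by fun_prop)
  have hT : 0 ≤ T := ht₁.trans ht₁T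
  have hcomp : IsCompact B := by
    refine ((H.isCompact_slab l r).prod (isCompact_Icc (a := 0) (b := T))).of_isClosed_subset
      hclosed ?_
    rintro ⟨x, t⟩ ⟨⟨h0, hT, hl, hr⟩, -⟩
    simp only at h0 hT hl hr
    have : 0 ≤ k * t := by positivity
    exact ⟨⟨by linarith, by linarith⟩, h0, hT⟩
  obtain ⟨⟨x₀, t₀⟩, ⟨⟨h0, hT0, hl, hr⟩, hbad⟩, hmin⟩ :=
    hcomp.exists_isMinOn ⟨_, hne⟩ continuous_snd.continuousOn
  simp only at h0 hT0 hl hr hbad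
  have hkt : 0 ≤ k * t₀ := by positivity
  obtain ⟨hσ0, hρ0, hD, hσ', hρ', hsi, hvi⟩ := hreg x₀ (by linarith) (by linarith)
  have hgood : ∀ x t, 0 ≤ t → t < t₀ → l + k * t ≤ G x → G x ≤ r - k * t →
      |s x t| ≤ exp (δ * t) * σ x ∧ |v x t| ≤ exp (δ * t) * ρ x := by
    intro x t ht htt h1 h2
    by_contra hc
    have : (x, t) ∈ B := by
      refine ⟨⟨ht, (htt.trans_le hT0).le, h1, h2⟩, ?_⟩
      by_contra! h
      exact hc ⟨h.1.le, h.2.le⟩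
    exact absurd (hmin this) (not_le.2 htt)
  have ht0 : 0 < t₀ := by
    rcases h0.eq_or_lt with h | h
    · subst h
      simp only [mul_zero, exp_zero, one_mul] at hbad
      rcases hbad with hb | hb <;> linarith
    · exact h
  have hnear : ∀ᶠ h in 𝓝[>] (0 : ℝ), 0 ≤ t₀ - h ∧ t₀ - h < t₀ := by
    filter_upwards [self_mem_nhdsWithin,
      mem_nhdsWithin_of_mem_nhds (Iio_mem_nhds ht0)] with h h1 h2
    simp only [mem_Ioi, mem_Iio] at h1 h2
    constructor <;> linarith
  -- the bounds hold up to time `t₀` by continuity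
  have hle : |s x₀ t₀| ≤ exp (δ * t₀) * σ x₀ ∧ |v x₀ t₀| ≤ exp (δ * t₀) * ρ x₀ := by
    have hev : ∀ᶠ h in 𝓝[>] (0 : ℝ), |s x₀ (t₀ - h)| ≤ exp (δ * (t₀ - h)) * σ x₀ ∧
        |v x₀ (t₀ - h)| ≤ exp (δ * (t₀ - h)) * ρ x₀ := by
      filter_upwards [hnear] with h ⟨h1, h2⟩
      exact hgood _ _ h1 h2 (by nlinarith) (by nlinarith)
    have hlim : ∀ f : ℝ → ℝ, Continuous f → Tendsto (fun h => f (t₀ - h)) (𝓝[>] 0) (𝓝 (f t₀)) := by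
      intro f hf
      have : Continuous fun h => f (t₀ - h) := by fun_prop
      have h0 := this.tendsto 0
      rw [sub_zero] at h0
      exact h0.mono_left nhdsWithin_le_nhds
    constructor
    · exact le_of_tendsto_of_tendsto (hlim (fun t => |s x₀ t|) (by fun_prop))
        (hlim (fun t => exp (δ * t) * σ x₀) (by fun_prop)) (hev.mono fun _ h => h.1)
    · exact le_of_tendsto_of_tendsto (hlim (fun t => |v x₀ t|) (by fun_prop))
        (hlim (fun t => exp (δ * t) * ρ x₀) (by fun_prop)) (hev.mono fun _ h => h.2)
  set c := g x₀ * (s x₀ t₀ + v x₀ t₀) ^ κ with hc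
  have hsv := H.pos x₀ t₀
  have hc0 : 0 < c := mul_pos (H.g_pos _) (rpow_pos_of_pos hsv _)
  have hE : 0 < exp (δ * t₀) := exp_pos _
  have hck : c < k * g x₀ := by
    have h1 : s x₀ t₀ + v x₀ t₀ ≤ exp (δ * T) * D := by
      have h2 : exp (δ * t₀) ≤ exp (δ * T) := exp_le_exp.2 (by gcongr)
      calc s x₀ t₀ + v x₀ t₀ ≤ exp (δ * t₀) * (σ x₀ + ρ x₀) := by
            linarith [le_abs_self (s x₀ t₀), le_abs_self (v x₀ t₀), hle.1, hle.2]
        _ ≤ exp (δ * T) * D := by gcongr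
    have h2 := (rpow_le_rpow hsv.le h1 H.kappa_pos.le).trans_lt hk
    rw [hc, mul_comm]
    exact mul_lt_mul_of_pos_right h2 (H.g_pos _)
  have hpath : ∀ q, |q| = c → ∀ᶠ h in 𝓝[>] (0 : ℝ),
      |s (x₀ - q * h) (t₀ - h)| ≤ exp (δ * (t₀ - h)) * σ (x₀ - q * h) ∧
      |v (x₀ - q * h) (t₀ - h)| ≤ exp (δ * (t₀ - h)) * ρ (x₀ - q * h) := by
    intro q hq
    filter_upwards [hnear, H.eventually_mem_trapezoid (hq ▸ hck) hl hr] with h ⟨h1, h2⟩ ⟨h3, h4⟩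
    exact hgood _ _ h1 h2 h3 h4
  have hp1 := hpath c (abs_of_pos hc0)
  have hp2 := hpath (-c) (by rw [abs_neg, abs_of_pos hc0])
  obtain ⟨Ls, hLs, hLse⟩ := H.s_eq x₀ t₀ ht0
  obtain ⟨Lv, hLv, hLve⟩ := H.v_eq x₀ t₀ ht0
  rw [← hc] at hLse hLve
  have hav : |a x₀ * c * v x₀ t₀| ≤ exp (δ * t₀) * (c * σ' x₀) := by
    rw [abs_mul, abs_mul, abs_of_pos hc0]
    calc |a x₀| * c * |v x₀ t₀| ≤ |a x₀| * c * (exp (δ * t₀) * ρ x₀) := by gcongr; exact hle.2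
      _ = exp (δ * t₀) * (c * (|a x₀| * ρ x₀)) := by ring
      _ ≤ _ := by gcongr
  have has : |a x₀ * c * s x₀ t₀| ≤ exp (δ * t₀) * (c * -ρ' x₀) := by
    rw [abs_mul, abs_mul, abs_of_pos hc0]
    calc |a x₀| * c * |s x₀ t₀| ≤ |a x₀| * c * (exp (δ * t₀) * σ x₀) := by gcongr; exact hle.1
      _ = exp (δ * t₀) * (c * (|a x₀| * σ x₀)) := by ring
      _ ≤ _ := by gcongr
  have hp3 : 0 < exp (δ * t₀) * (δ * σ x₀) := by positivity
  have hp4 : 0 < exp (δ * t₀) * (δ * ρ x₀) := by positivity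
  have hav' := abs_le.1 hav
  have has' := abs_le.1 has
  rcases hbad with hb | hb
  · rcases abs_choice (s x₀ t₀) with h | h
    · have := touch_barrier (δ := δ) hLs (hσ x₀) (by simp only [Function.uncurry]; linarith [hle.1])
        (hp1.mono fun h hh => (le_abs_self _).trans hh.1)
      rw [hLse] at this
      linarith
    · have := touch_barrier (δ := δ) hLs.neg (hσ x₀)
        (by simp only [Function.uncurry, Pi.neg_apply]; linarith [hle.1])
        (hp1.mono fun h hh => (neg_le_abs _).trans hh.1)
      rw [_root_.neg_apply, hLse] at this
      linarith
  · rcases abs_choice (v x₀ t₀) with h | h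
    · have := touch_barrier (δ := δ) hLv (hρ x₀) (by simp only [Function.uncurry]; linarith [hle.2])
        (hp2.mono fun h hh => (le_abs_self _).trans hh.2)
      rw [hLve] at this
      linarith
    · have := touch_barrier (δ := δ) hLv.neg (hρ x₀)
        (by simp only [Function.uncurry, Pi.neg_apply]; linarith [hle.2])
        (hp2.mono fun h hh => (neg_le_abs _).trans hh.2)
      rw [_root_.neg_apply, hLve] at this
      linarith

end CoupledWaves

namespace CoupledWaves

variable {s v : ℝ → ℝ → ℝ} {g a A G : ℝ → ℝ} {κ V Ms Mv : ℝ}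

/-- Comparison with stationary barriers on a trapezoid shrinking at a speed exceeding all
characteristic speeds compatible with the barriers. -/
lemma barrier (H : CoupledWaves s v g a A G κ V Ms Mv) {σ ρ σ' ρ' : ℝ → ℝ}
    {l r k D T : ℝ} (hσ : ∀ x, HasDerivAt σ (σ' x) x) (hρ : ∀ x, HasDerivAt ρ (ρ' x) x)
    (hk0 : 0 ≤ k)
    (hreg : ∀ x, l ≤ G x → G x ≤ r → 0 < σ x ∧ 0 < ρ x ∧ σ x + ρ x ≤ D ∧
      |a x| * ρ x ≤ σ' x ∧ |a x| * σ x ≤ -ρ' x ∧ |s x 0| < σ x ∧ |v x 0| < ρ x)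
    (hk : D ^ κ < k) {x t : ℝ} (ht : 0 ≤ t) (htT : t ≤ T) (hl : l + k * t ≤ G x)
    (hr : G x ≤ r - k * t) : |s x t| ≤ σ x ∧ |v x t| ≤ ρ x := by
  have hlim : Tendsto (fun δ : ℝ => (exp (δ * T) * D) ^ κ) (𝓝[>] 0) (𝓝 (D ^ κ)) := by
    have h1 : Continuous fun δ : ℝ => (exp (δ * T) * D) ^ κ :=
      Continuous.rpow_const (by fun_prop) fun _ => Or.inr H.kappa_pos.le
    have h0 := h1.tendsto 0
    simp only [zero_mul, exp_zero, one_mul] at h0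
    exact h0.mono_left nhdsWithin_le_nhds
  have hev : ∀ᶠ δ in 𝓝[>] (0 : ℝ), |s x t| < exp (δ * t) * σ x ∧ |v x t| < exp (δ * t) * ρ x := by
    filter_upwards [hlim.eventually_lt_const hk, self_mem_nhdsWithin] with δ h1 h2
    exact H.barrier_strict hσ hρ h2 hk0 hreg h1 x t ht htT hl hr
  have hlim' : ∀ z : ℝ, Tendsto (fun δ : ℝ => exp (δ * t) * z) (𝓝[>] 0) (𝓝 z) := by
    intro z
    have h1 : Continuous fun δ : ℝ => exp (δ * t) * z := by fun_prop
    have h0 := h1.tendsto 0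
    simp only [zero_mul, exp_zero, one_mul] at h0
    exact h0.mono_left nhdsWithin_le_nhds
  exact ⟨ge_of_tendsto (hlim' _) (hev.mono fun _ h => h.1.le),
    ge_of_tendsto (hlim' _) (hev.mono fun _ h => h.2.le)⟩

/-- Far to the left the data bounds are almost preserved. -/
lemma tail_left (H : CoupledWaves s v g a A G κ V Ms Mv) {θ k : ℝ} (hθ : 0 < θ)
    (hk : (Ms + Mv + θ) ^ κ < k) :
    ∃ B, ∀ x t, 0 ≤ t → G x ≤ B - k * t → |s x t| ≤ Ms + θ ∧ |v x t| ≤ Mv + θ := by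
  have hMs := H.Ms_pos
  have hMv := H.Mv_pos
  have hk0 : 0 ≤ k := (rpow_nonneg (by positivity) _).trans hk.le
  set N := Ms + Mv + 1 with hN
  have hN0 : 0 < N := by positivity
  set ε := min θ 1 / N with hε
  have hε0 : 0 < ε := by positivity
  have hNε : N * ε = min θ 1 := by rw [hε]; field_simp
  have h1 : N * ε ≤ θ := hNε ▸ min_le_left _ _
  have h2 : N * ε ≤ 1 := hNε ▸ min_le_right _ _
  obtain ⟨x₀, hx₀⟩ := (H.A_bot.eventually_lt_const hε0).exists
  refine ⟨G x₀, fun x t ht hx => ?_⟩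
  have key : ∀ y, G y ≤ G x₀ → 0 ≤ N * A y ∧ N * A y ≤ N * ε := fun y hy =>
    ⟨mul_nonneg hN0.le (H.A_nonneg y), mul_le_mul_of_nonneg_left
      ((H.mono_A (H.strictMono_G.le_iff_le.1 hy)).trans hx₀.le) hN0.le⟩
  have := H.barrier (σ := fun x => Ms + N * A x) (ρ := fun x => Mv + N * (ε - A x))
    (σ' := fun x => N * |a x|) (ρ' := fun x => N * -|a x|) (l := G x - k * t) (r := G x₀) (k := k)
    (D := Ms + Mv + θ) (T := t) (fun x => ((H.deriv_A x).const_mul N).const_add Ms)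
    (fun x => (((H.deriv_A x).const_sub ε).const_mul N).const_add Mv) hk0
    (fun y _ hy => by
      obtain ⟨h3, h4⟩ := key y hy
      have := abs_nonneg (a y)
      refine ⟨by linarith, by linarith, by linarith, ?_, ?_, by linarith [H.init_s y],
        by linarith [H.init_v y]⟩
      · rw [mul_comm]; gcongr; linarith
      · rw [mul_neg, neg_neg, mul_comm]; gcongr; linarith) hk ht le_rfl (by linarith) hx
  have hkt : 0 ≤ k * t := by positivity
  obtain ⟨h3, h4⟩ := key x (by linarith)
  exact ⟨by linarith [this.1], by linarith [this.2]⟩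

lemma tail_right (H : CoupledWaves s v g a A G κ V Ms Mv) {θ k : ℝ} (hθ : 0 < θ)
    (hk : (Ms + Mv + θ) ^ κ < k) :
    ∃ B, ∀ x t, 0 ≤ t → B + k * t ≤ G x → |s x t| ≤ Ms + θ ∧ |v x t| ≤ Mv + θ := by
  obtain ⟨B, hB⟩ := H.reflect.tail_left hθ (add_comm Ms Mv ▸ hk)
  refine ⟨-B, fun x t ht hx => ?_⟩
  have := hB (-x) t ht (by simp only [neg_neg]; linarith)
  simp only [neg_neg] at this
  exact this.symm

lemma bounded (H : CoupledWaves s v g a A G κ V Ms Mv) (R : ℝ) :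
    ∃ C, ∀ t ≤ R, ∀ x, |s x t| ≤ C ∧ |v x t| ≤ C := by
  set R' := max R 0
  set k := (Ms + Mv + 1) ^ κ + 1 with hk
  have hMs := H.Ms_pos
  have hMv := H.Mv_pos
  have hk0 : 0 ≤ k := by positivity
  obtain ⟨B₁, hB₁⟩ := H.tail_left one_pos (lt_add_one ((Ms + Mv + 1) ^ κ))
  obtain ⟨B₂, hB₂⟩ := H.tail_right one_pos (lt_add_one ((Ms + Mv + 1) ^ κ))
  have hcomp := (H.isCompact_slab (B₁ - k * R') (B₂ + k * R')).prod
    (isCompact_Icc (a := 0) (b := R'))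
  obtain ⟨C₁, hC₁⟩ := hcomp.exists_bound_of_continuousOn H.cont_s.continuousOn
  obtain ⟨C₂, hC₂⟩ := hcomp.exists_bound_of_continuousOn H.cont_v.continuousOn
  have main : ∀ t, 0 ≤ t → t ≤ R' → ∀ x, |s x t| ≤ max (max C₁ C₂) (Ms + Mv + 1) ∧
      |v x t| ≤ max (max C₁ C₂) (Ms + Mv + 1) := by
    intro t ht htR x
    have hkt : k * t ≤ k * R' := by gcongr
    have tail : |s x t| ≤ Ms + 1 ∧ |v x t| ≤ Mv + 1 → |s x t| ≤ max (max C₁ C₂) (Ms + Mv + 1) ∧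
        |v x t| ≤ max (max C₁ C₂) (Ms + Mv + 1) := fun h =>
      ⟨le_max_of_le_right (by linarith [h.1]), le_max_of_le_right (by linarith [h.2])⟩
    by_cases h1 : G x ≤ B₁ - k * t
    · exact tail (hB₁ x t ht h1)
    by_cases h2 : B₂ + k * t ≤ G x
    · exact tail (hB₂ x t ht h2)
    have hmem : (x, t) ∈ {x | B₁ - k * R' ≤ G x ∧ G x ≤ B₂ + k * R'} ×ˢ Icc 0 R' :=
      ⟨⟨by linarith, by linarith⟩, ht, htR⟩
    exact ⟨le_max_of_le_left (le_max_of_le_left (hC₁ _ hmem)),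
      le_max_of_le_left (le_max_of_le_right (hC₂ _ hmem))⟩
  refine ⟨max (max C₁ C₂) (Ms + Mv + 1), fun t ht x => ?_⟩
  rcases le_total 0 t with h | h
  · exact main t h (ht.trans (le_max_left _ _)) x
  · rw [H.past_s x t h, H.past_v x t h]
    exact main 0 le_rfl (le_max_right _ _) x

/-- The characteristic speed in the form of an ODE right-hand side. -/
lemma speed_cont (H : CoupledWaves s v g a A G κ V Ms Mv) :
    Continuous (Function.uncurry fun t x => g x * (s x t + v x t) ^ κ) := by
  have hsc : Continuous fun q : ℝ × ℝ => s q.2 q.1 := H.cont_s.comp continuous_swap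
  have hvc : Continuous fun q : ℝ × ℝ => v q.2 q.1 := H.cont_v.comp continuous_swap
  exact (H.g_cont.comp continuous_snd).mul
    ((hsc.add hvc).rpow_const fun _ => Or.inr H.kappa_pos.le)

lemma speed_bdd (H : CoupledWaves s v g a A G κ V Ms Mv) (R : ℝ) :
    ∃ C, ∀ t ≤ R, ∀ x, |g x * (s x t + v x t) ^ κ| ≤ C := by
  obtain ⟨C, hC⟩ := H.bounded R
  obtain ⟨D, hD⟩ := H.g_bdd
  refine ⟨D * (C + C) ^ κ, fun t ht x => ?_⟩
  have h0 := H.pos x t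
  have hg := H.g_pos x
  have := H.kappa_pos
  rw [abs_of_nonneg (by positivity)]
  have h1 : s x t + v x t ≤ C + C := by
    linarith [le_abs_self (s x t), le_abs_self (v x t), (hC t ht x).1, (hC t ht x).2]
  have := hD x
  gcongr
  linarith

lemma speed_neg_cont (H : CoupledWaves s v g a A G κ V Ms Mv) :
    Continuous (Function.uncurry fun t x => -(g x * (s x t + v x t) ^ κ)) :=
  H.speed_cont.neg

lemma speed_neg_bdd (H : CoupledWaves s v g a A G κ V Ms Mv) (R : ℝ) :
    ∃ C, ∀ t ≤ R, ∀ x, |-(g x * (s x t + v x t) ^ κ)| ≤ C := by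
  simpa only [abs_neg] using H.speed_bdd R

lemma speed_neg_lip (H : CoupledWaves s v g a A G κ V Ms Mv) (R : ℝ) : ∃ K : ℝ≥0, ∀ t ≤ R,
    LipschitzOnWith K (fun x => -(g x * (s x t + v x t) ^ κ)) (Icc (-R) R) := by
  obtain ⟨K, hK⟩ := H.lip R
  exact ⟨K, fun t ht => (hK t ht).neg⟩

end CoupledWaves

namespace CoupledWaves

variable {s v : ℝ → ℝ → ℝ} {g a A G : ℝ → ℝ} {κ V Ms Mv : ℝ}

/-- Trigonometric barriers for small total variation. -/
lemma sum_le_of_sq_le (H : CoupledWaves s v g a A G κ V Ms Mv) (hV : V ^ 2 ≤ 3 / 2) {x t : ℝ}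
    (ht : 0 ≤ t) :
    |s x t| + |v x t| ≤ (Ms + Mv) * (1 + V) * (1 + V ^ 2 * exp (V ^ 2)) := by
  have hMs := H.Ms_pos
  have hMv := H.Mv_pos
  have hV0 := H.V_nonneg
  have hVpi : V < Real.pi / 2 := by nlinarith [Real.pi_gt_three]
  have hcos : 0 < cos V := cos_pos_of_mem_Ioo ⟨by linarith, hVpi⟩
  have hA0 := H.A_nonneg
  have hA1 := H.A_le
  have c1 : ∀ x, cos V ≤ cos (V - A x) := fun x =>
    cos_le_cos_of_nonneg_of_le_pi (by linarith [hA1 x]) (by linarith) (by linarith [hA0 x])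
  have c2 : ∀ x, cos V ≤ cos (A x) := fun x =>
    cos_le_cos_of_nonneg_of_le_pi (hA0 x) (by linarith) (hA1 x)
  have s1 : ∀ x, 0 ≤ sin (A x) := fun x =>
    sin_nonneg_of_nonneg_of_le_pi (hA0 x) (by linarith [hA1 x])
  have s2 : ∀ x, 0 ≤ sin (V - A x) := fun x =>
    sin_nonneg_of_nonneg_of_le_pi (by linarith [hA1 x]) (by linarith [hA0 x])
  have s3 : ∀ x, sin (A x) ≤ sin V := fun x =>
    sin_le_sin_of_le_of_le_pi_div_two (by linarith [hA0 x]) hVpi.le (hA1 x)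
  have s4 : ∀ x, sin (V - A x) ≤ sin V := fun x =>
    sin_le_sin_of_le_of_le_pi_div_two (by linarith [hA1 x]) hVpi.le (by linarith [hA0 x])
  set σ : ℝ → ℝ := fun x => (Ms * cos (V - A x) + Mv * sin (A x)) / cos V with hσ
  set ρ : ℝ → ℝ := fun x => (Mv * cos (A x) + Ms * sin (V - A x)) / cos V with hρ
  have hσd : ∀ x, HasDerivAt σ (|a x| * ρ x) x := fun x => by
    have := ((((H.deriv_A x).const_sub V).cos.const_mul Ms).add
      ((H.deriv_A x).sin.const_mul Mv)).div_const (cos V)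
    exact this.congr_deriv (by simp only [hρ]; ring)
  have hρd : ∀ x, HasDerivAt ρ (-(|a x| * σ x)) x := fun x => by
    have := (((H.deriv_A x).cos.const_mul Mv).add
      (((H.deriv_A x).const_sub V).sin.const_mul Ms)).div_const (cos V)
    exact this.congr_deriv (by simp only [hσ]; ring)
  have hσM : ∀ x, Ms ≤ σ x := fun x => by
    rw [hσ, le_div_iff₀ hcos]
    nlinarith [mul_le_mul_of_nonneg_left (c1 x) hMs.le, mul_nonneg hMv.le (s1 x)]
  have hρM : ∀ x, Mv ≤ ρ x := fun x => by
    rw [hρ, le_div_iff₀ hcos]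
    nlinarith [mul_le_mul_of_nonneg_left (c2 x) hMv.le, mul_nonneg hMs.le (s2 x)]
  have hsum : ∀ x, σ x + ρ x ≤ (Ms + Mv) * ((1 + sin V) / cos V) := fun x => by
    simp only [hσ, hρ]
    rw [← add_div, ← mul_div_assoc]
    gcongr
    nlinarith [mul_le_mul_of_nonneg_left (s3 x) hMv.le, mul_le_mul_of_nonneg_left (s4 x) hMs.le,
      mul_le_mul_of_nonneg_left (cos_le_one (A x)) hMv.le,
      mul_le_mul_of_nonneg_left (cos_le_one (V - A x)) hMs.le]
  set D := (Ms + Mv) * ((1 + sin V) / cos V)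
  have hD : 0 ≤ D := by linarith [hσM 0, hρM 0, hsum 0]
  have hb := H.barrier (l := G x - (D ^ κ + 1) * t) (r := G x + (D ^ κ + 1) * t) (D := D) (T := t)
    hσd hρd (k := D ^ κ + 1) (by positivity)
    (fun y _ _ => ⟨by linarith [hσM y], by linarith [hρM y], hsum y, le_rfl, by rw [neg_neg],
      (H.init_s y).trans_le (hσM y), (H.init_v y).trans_le (hρM y)⟩)
    (lt_add_one _) ht le_rfl (by linarith) (by linarith)
  have hfac : (1 + sin V) / cos V ≤ (1 + V) * (1 + V ^ 2 * exp (V ^ 2)) := by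
    have h1 := one_sub_sq_div_two_le_cos (x := V)
    have h2 := sin_le hV0
    have h3 := add_one_le_exp (V ^ 2)
    have h5 : 1 ≤ (1 + V ^ 2 * exp (V ^ 2)) * cos V := by
      have h4 : (1 + V ^ 2 * (V ^ 2 + 1)) * (1 - V ^ 2 / 2) ≤
          (1 + V ^ 2 * exp (V ^ 2)) * cos V := by
        have : 0 ≤ 1 - V ^ 2 / 2 := by linarith
        gcongr
      nlinarith [sq_nonneg V, mul_nonneg (sq_nonneg V) (sub_nonneg.2 hV)]
    rw [div_le_iff₀ hcos]
    nlinarith [mul_le_mul_of_nonneg_left h5 (by linarith : 0 ≤ 1 + V)]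
  calc |s x t| + |v x t| ≤ D := (add_le_add hb.1 hb.2).trans (hsum x)
    _ ≤ (Ms + Mv) * ((1 + V) * (1 + V ^ 2 * exp (V ^ 2))) :=
      mul_le_mul_of_nonneg_left hfac (by linarith)
    _ = _ := by ring

end CoupledWaves

lemma le_of_hasDerivAt_nonpos {f f' : ℝ → ℝ} {a b : ℝ} (hab : a ≤ b) (hc : Continuous f)
    (hd : ∀ t ∈ Ioo a b, HasDerivAt f (f' t) t) (h : ∀ t ∈ Ioo a b, f' t ≤ 0) : f b ≤ f a := by
  refine antitoneOn_of_deriv_nonpos (convex_Icc a b) hc.continuousOn ?_ ?_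
    (left_mem_Icc.2 hab) (right_mem_Icc.2 hab) hab <;> rw [interior_Icc]
  · exact fun t ht => (hd t ht).differentiableAt.differentiableWithinAt
  · exact fun t ht => (hd t ht).deriv ▸ h t ht

namespace CoupledWaves

variable {s v : ℝ → ℝ → ℝ} {g a A G : ℝ → ℝ} {κ V Ms Mv : ℝ}

lemma speed_pos (H : CoupledWaves s v g a A G κ V Ms Mv) (x t : ℝ) :
    0 < g x * (s x t + v x t) ^ κ :=
  mul_pos (H.g_pos x) (rpow_pos_of_pos (H.pos x t) κ)

lemma hasDerivAt_s_along (H : CoupledWaves s v g a A G κ V Ms Mv) {y : ℝ → ℝ} {t : ℝ} (ht : 0 < t)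
    (hy : HasDerivAt y (g (y t) * (s (y t) t + v (y t) t) ^ κ) t) :
    HasDerivAt (fun t => s (y t) t)
      (a (y t) * (g (y t) * (s (y t) t + v (y t) t) ^ κ) * v (y t) t) t := by
  obtain ⟨L, hL, h⟩ := H.s_eq (y t) t ht
  rw [← h]
  exact HasFDerivAt.comp_hasDerivAt (f := fun t => (y t, t)) t hL (hy.prodMk (hasDerivAt_id t))

lemma hasDerivAt_v_along (H : CoupledWaves s v g a A G κ V Ms Mv) {y : ℝ → ℝ} {t : ℝ} (ht : 0 < t)
    (hy : HasDerivAt y (-(g (y t) * (s (y t) t + v (y t) t) ^ κ)) t) :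
    HasDerivAt (fun t => v (y t) t)
      (-(a (y t) * (g (y t) * (s (y t) t + v (y t) t) ^ κ) * s (y t) t)) t := by
  obtain ⟨L, hL, h⟩ := H.v_eq (y t) t ht
  rw [← h]
  exact HasFDerivAt.comp_hasDerivAt (f := fun t => (y t, t)) t hL (hy.prodMk (hasDerivAt_id t))

lemma cont_s_along (H : CoupledWaves s v g a A G κ V Ms Mv) {y : ℝ → ℝ} (hy : Continuous y) :
    Continuous fun t => s (y t) t :=
  H.cont_s.comp (hy.prodMk continuous_id)

lemma cont_v_along (H : CoupledWaves s v g a A G κ V Ms Mv) {y : ℝ → ℝ} (hy : Continuous y) :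
    Continuous fun t => v (y t) t :=
  H.cont_v.comp (hy.prodMk continuous_id)

/-- Estimate of `s` by integrating along a backward characteristic. -/
lemma abs_s_le (H : CoupledWaves s v g a A G κ V Ms Mv) {M P ε x t : ℝ} (hM : 0 ≤ M) (hP : 0 ≤ P)
    (hε : 0 < ε) (ht : 0 ≤ t)
    (hv : ∀ x' t', x' ≤ x → 0 ≤ t' → t' ≤ t →
      |v x' t'| ≤ M * exp (A x') + 3 * P * exp ((A x' - A x) / ε)) :
    |s x t| ≤ M * exp (A x) - (M - Ms) + 3 * P * ε := by
  obtain ⟨y, hyt, hy⟩ := ode_global_exists H.speed_cont H.lip H.speed_bdd t x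
  have hyc : Continuous y := continuous_iff_continuousAt.2 fun t => (hy t).continuousAt
  have hmono : Monotone y := monotone_of_hasDerivAt_nonneg hy fun t => (H.speed_pos _ _).le
  set F : ℝ → ℝ := fun z => M * exp (A z) + 3 * P * ε * exp ((A z - A x) / ε) with hF
  have hFc : Continuous fun t => F (y t) := by have := H.cont_A; fun_prop
  have hFd : ∀ τ, HasDerivAt (fun τ => F (y τ)) (|a (y τ)| * (M * exp (A (y τ)) +
      3 * P * exp ((A (y τ) - A x) / ε)) * (g (y τ) * (s (y τ) τ + v (y τ) τ) ^ κ)) τ := by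
    intro τ
    have hA := (H.deriv_A (y τ)).comp τ (hy τ)
    refine ((hA.exp.const_mul M).add
      (((hA.sub_const (A x)).div_const ε).exp.const_mul (3 * P * ε))).congr_deriv ?_
    simp only [Function.comp_apply]
    field_simp
  have hbound : ∀ τ ∈ Ioo 0 t,
      |a (y τ) * (g (y τ) * (s (y τ) τ + v (y τ) τ) ^ κ) * v (y τ) τ| ≤
      |a (y τ)| * (M * exp (A (y τ)) + 3 * P * exp ((A (y τ) - A x) / ε)) *
        (g (y τ) * (s (y τ) τ + v (y τ) τ) ^ κ) := by
    intro τ hτ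
    have hc := H.speed_pos (y τ) τ
    rw [abs_mul, abs_mul, abs_of_pos hc, mul_right_comm]
    have := hv (y τ) τ (hyt ▸ hmono hτ.2.le) hτ.1.le hτ.2.le
    gcongr
  have h1 := le_of_hasDerivAt_nonpos ht ((H.cont_s_along hyc).sub hFc)
    (fun τ hτ => (H.hasDerivAt_s_along hτ.1 (hy τ)).sub (hFd τ))
    (fun τ hτ => by linarith [(abs_le.1 (hbound τ hτ)).2])
  have h2 := le_of_hasDerivAt_nonpos ht ((H.cont_s_along hyc).neg.sub hFc)
    (fun τ hτ => (H.hasDerivAt_s_along hτ.1 (hy τ)).neg.sub (hFd τ))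
    (fun τ hτ => by linarith [(abs_le.1 (hbound τ hτ)).1])
  simp only [Pi.sub_apply, Pi.neg_apply, hyt] at h1 h2
  have hFx : F x = M * exp (A x) + 3 * P * ε := by simp [hF]
  have hF0 : M ≤ F (y 0) := by
    have h3 : (1 : ℝ) ≤ exp (A (y 0)) := one_le_exp (H.A_nonneg _)
    have h4 : 0 ≤ 3 * P * ε * exp ((A (y 0) - A x) / ε) := by positivity
    simp only [hF]
    nlinarith
  have h0 := abs_lt.1 (H.init_s (y 0))
  rw [abs_le]
  constructor <;> linarith

lemma abs_v_le (H : CoupledWaves s v g a A G κ V Ms Mv) {C x t : ℝ} (ht : 0 ≤ t) {y : ℝ → ℝ}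
    (hy : ∀ t, HasDerivAt y (-(g (y t) * (s (y t) t + v (y t) t) ^ κ)) t) (hyt : y t = x)
    (hC : 0 ≤ C) (hs : ∀ t' ∈ Ioo 0 t, |s (y t') t'| ≤ C) : |v x t| ≤ Mv + V * C := by
  have hyc : Continuous y := continuous_iff_continuousAt.2 fun t => (hy t).continuousAt
  have hFc : Continuous fun t => C * A (y t) := by have := H.cont_A; fun_prop
  have hFd : ∀ τ, HasDerivAt (fun τ => C * A (y τ))
      (C * (|a (y τ)| * -(g (y τ) * (s (y τ) τ + v (y τ) τ) ^ κ))) τ := fun τ =>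
    ((H.deriv_A (y τ)).comp τ (hy τ)).const_mul C
  have hbound : ∀ τ ∈ Ioo 0 t,
      |a (y τ) * (g (y τ) * (s (y τ) τ + v (y τ) τ) ^ κ) * s (y τ) τ| ≤
      C * (|a (y τ)| * (g (y τ) * (s (y τ) τ + v (y τ) τ) ^ κ)) := by
    intro τ hτ
    have hc := H.speed_pos (y τ) τ
    rw [abs_mul, abs_mul, abs_of_pos hc, mul_comm]
    have := hs τ hτ
    gcongr
  have h1 := le_of_hasDerivAt_nonpos ht ((H.cont_v_along hyc).add hFc)
    (fun τ hτ => (H.hasDerivAt_v_along hτ.1 (hy τ)).add (hFd τ))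
    (fun τ hτ => by linarith [(abs_le.1 (hbound τ hτ)).1])
  have h2 := le_of_hasDerivAt_nonpos ht ((H.cont_v_along hyc).neg.add hFc)
    (fun τ hτ => (H.hasDerivAt_v_along hτ.1 (hy τ)).neg.add (hFd τ))
    (fun τ hτ => by linarith [(abs_le.1 (hbound τ hτ)).2])
  simp only [Pi.add_apply, Pi.neg_apply, hyt] at h1 h2
  have h0 := abs_lt.1 (H.init_v (y 0))
  have h3 := mul_le_mul_of_nonneg_left (H.A_le (y 0)) hC
  have h4 := mul_nonneg hC (H.A_nonneg x)
  rw [abs_le]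
  constructor <;> linarith

end CoupledWaves

namespace CoupledWaves

variable {s v : ℝ → ℝ → ℝ} {g a A G : ℝ → ℝ} {κ V Ms Mv : ℝ}

/-- A bound of `|s|` below the exponential barrier by a fixed margin propagates the barrier
for `|v|` along characteristics that run into the left tail. -/
lemma abs_v_le_of_abs_s_le (H : CoupledWaves s v g a A G κ V Ms Mv) {M : ℝ}
    (hM : 2 * Ms + Mv < M) {Γ : ℝ → ℝ}
    (hΓ : ∀ t, HasDerivAt Γ (-(g (Γ t) * (s (Γ t) t + v (Γ t) t) ^ κ)) t)
    (hs : ∀ x t, 0 ≤ t → x ≤ Γ t →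
      |s x t| ≤ M * exp (A x) - (M - Ms) + (M - 2 * Ms - Mv) / 4)
    {x t : ℝ} (ht : 0 ≤ t) (hx : x ≤ Γ t) : |v x t| ≤ M * exp (A x) := by
  have hMs := H.Ms_pos
  have hMv := H.Mv_pos
  have hM0 : 0 < M := by linarith
  by_contra! hlt
  have hv : M * exp (A x) < v x t := by
    rcases abs_choice (v x t) with h | h
    · rwa [h] at hlt
    · rw [h] at hlt
      linarith [hs x t ht hx, le_abs_self (s x t), H.pos x t]
  obtain ⟨y, hyt, hy⟩ := ode_global_exists H.speed_neg_cont H.speed_neg_lip H.speed_neg_bdd t x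
  have hyc : Continuous y := continuous_iff_continuousAt.2 fun t => (hy t).continuousAt
  have hyΓ : ∀ τ, y τ ≤ Γ τ := ode_global_mono H.speed_neg_lip hy hΓ (t₀ := t) (hyt ▸ hx)
  set D := M - Ms - (M - 2 * Ms - Mv) / 4 with hD
  have hsy : ∀ τ, 0 ≤ τ → |s (y τ) τ| ≤ M * exp (A (y τ)) - D := fun τ hτ => by
    linarith [hs (y τ) τ hτ (hyΓ τ)]
  have hvy : ∀ τ, t ≤ τ → M * exp (A (y τ)) < v (y τ) τ := by
    intro τ hτ
    have hFc : Continuous fun t => M * exp (A (y t)) := by have := H.cont_A; fun_prop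
    have h1 := le_of_hasDerivAt_nonpos hτ (hFc.sub (H.cont_v_along hyc))
      (fun z hz => ((((H.deriv_A (y z)).comp z (hy z)).exp.const_mul M).sub
        (H.hasDerivAt_v_along (ht.trans_lt hz.1) (hy z))))
      (fun z hz => by
        have hc := H.speed_pos (y z) z
        set c := g (y z) * (s (y z) z + v (y z) z) ^ κ
        have h2 : a (y z) * c * s (y z) z ≤ |a (y z)| * c * (M * exp (A (y z))) := by
          refine (le_abs_self _).trans ?_
          rw [abs_mul, abs_mul, abs_of_pos hc]
          have := hsy z (ht.trans hz.1.le)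
          gcongr
          linarith
        simp only [Function.comp_apply]
        nlinarith)
    simp only [Pi.sub_apply, hyt] at h1
    linarith
  have hGy : ∀ τ, t ≤ τ → G (y τ) + D ^ κ * τ ≤ G x + D ^ κ * t := by
    intro τ hτ
    have hG := H.cont_G
    have h1 := le_of_hasDerivAt_nonpos hτ (f := fun z => G (y z) + D ^ κ * z) (by fun_prop)
      (fun z hz => ((H.deriv_G (y z)).comp z (hy z)).add
        ((hasDerivAt_id z).const_mul (D ^ κ)))
      (fun z hz => by
        have hg := H.g_pos (y z)
        have h2 : D ^ κ ≤ (s (y z) z + v (y z) z) ^ κ := by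
          refine rpow_le_rpow (by linarith) ?_ H.kappa_pos.le
          linarith [hvy z hz.1.le, (abs_le.1 (hsy z (ht.trans hz.1.le))).1]
        have h3 : 1 / g (y z) * -(g (y z) * (s (y z) z + v (y z) z) ^ κ) =
            -(s (y z) z + v (y z) z) ^ κ := by field_simp
        rw [h3]
        linarith)
    simpa only [hyt] using h1
  set θ := (M - 2 * Ms - Mv) / 4 with hθ
  have hθ0 : 0 < θ := by linarith
  have hκ := H.kappa_pos
  have hk1 : (Ms + Mv + θ) ^ κ < (Ms + Mv + 2 * θ) ^ κ :=
    rpow_lt_rpow (by linarith) (by linarith) hκ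
  have hk2 : (Ms + Mv + 2 * θ) ^ κ < D ^ κ := rpow_lt_rpow (by linarith) (by linarith) hκ
  obtain ⟨B, hB⟩ := H.tail_left hθ0 hk1
  set k := (Ms + Mv + 2 * θ) ^ κ
  set q := D ^ κ
  obtain ⟨τ, hτt, hτ⟩ := ((eventually_ge_atTop t).and
    ((tendsto_id.const_mul_atTop (sub_pos.2 hk2)).eventually_ge_atTop (G x + q * t - B))).exists
  simp only [id] at hτ
  have h1 := hB (y τ) τ (ht.trans hτt) (by linarith [hGy τ hτt])
  have h2 := hvy τ hτt
  have h3 : (1 : ℝ) ≤ exp (A (y τ)) := one_le_exp (H.A_nonneg _)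
  nlinarith [le_abs_self (v (y τ) τ), h1.2]

/-- If the exponential barrier is known outside thin layers, it holds left of a characteristic. -/
lemma abs_v_le_of_thin (H : CoupledWaves s v g a A G κ V Ms Mv) {M ε : ℝ}
    (hM : 2 * Ms + Mv < M) (hε : 0 < ε) (hε1 : 3 * V * ε ≤ 1 / 2)
    (hε2 : 3 * (2 * (Mv + V * (M * exp V))) * ε ≤ (M - 2 * Ms - Mv) / 4) {Γ : ℝ → ℝ}
    (hΓ : ∀ t, HasDerivAt Γ (-(g (Γ t) * (s (Γ t) t + v (Γ t) t) ^ κ)) t)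
    (hcov : ∀ x t, 0 ≤ t → x ≤ Γ t → ∀ x' t', x' ≤ x → 0 ≤ t' → t' ≤ t →
      |v x' t'| ≤ M * exp (A x') ∨ A x - ε ≤ A x')
    {x t : ℝ} (ht : 0 ≤ t) (hx : x ≤ Γ t) : |v x t| ≤ M * exp (A x) := by
  have hMs := H.Ms_pos
  have hMv := H.Mv_pos
  have hV := H.V_nonneg
  have hM0 : 0 < M := by linarith
  have hΓanti : Antitone Γ :=
    antitone_of_hasDerivAt_nonpos hΓ fun t => (neg_neg_of_pos (H.speed_pos _ _)).le
  -- a bound of `v` turns into a bound of `s`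
  have hsP : ∀ P T, 0 ≤ P → (∀ x t, 0 ≤ t → t ≤ T → x ≤ Γ t → |v x t| ≤ P) →
      ∀ x t, 0 ≤ t → t ≤ T → x ≤ Γ t → |s x t| ≤ M * exp (A x) - (M - Ms) + 3 * P * ε := by
    intro P T hP hvP x t ht htT hx
    refine H.abs_s_le hM0.le hP hε ht fun x' t' hx' ht0 ht' => ?_
    rcases hcov x t ht hx x' t' hx' ht0 ht' with h | h
    · have : 0 ≤ 3 * P * exp ((A x' - A x) / ε) := by positivity
      linarith
    · have h1 : -1 ≤ (A x' - A x) / ε := by rw [le_div_iff₀ hε]; linarith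
      have h2 : 1 / 3 ≤ exp ((A x' - A x) / ε) := by
        refine le_trans ?_ (exp_le_exp.2 h1)
        rw [exp_neg, ← one_div]
        exact one_div_le_one_div_of_le (exp_pos 1) (by linarith [exp_one_lt_d9])
      have h3 := hvP x' t' ht0 (ht'.trans htT) (hx'.trans (hx.trans (hΓanti ht')))
      have h4 : 0 ≤ M * exp (A x') := by positivity
      nlinarith [mul_le_mul_of_nonneg_left h2 hP]
  set C := 2 * (Mv + V * (M * exp V)) with hC
  have hC0 : 0 ≤ C := by positivity
  have hvC : ∀ x t, 0 ≤ t → x ≤ Γ t → |v x t| ≤ C := by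
    intro x₁ t₁ ht₁ hx₁
    set Q : Set ℝ := {p | ∃ x t, 0 ≤ t ∧ t ≤ t₁ ∧ x ≤ Γ t ∧ |v x t| = p} with hQ
    obtain ⟨C', hC'⟩ := H.bounded t₁
    have hbdd : BddAbove Q := by
      refine ⟨C', ?_⟩
      rintro p ⟨x, t, -, h1, -, rfl⟩
      exact (hC' t h1 x).2
    have hmem : |v x₁ t₁| ∈ Q := ⟨x₁, t₁, ht₁, le_rfl, hx₁, rfl⟩
    have hP0 : 0 ≤ sSup Q := (abs_nonneg _).trans (le_csSup hbdd hmem)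
    have hsb := hsP (sSup Q) t₁ hP0 fun x t h0 h1 h2 => le_csSup hbdd ⟨x, t, h0, h1, h2, rfl⟩
    have hsup : sSup Q ≤ Mv + V * (M * exp V + 3 * sSup Q * ε) := by
      refine csSup_le ⟨_, hmem⟩ ?_
      rintro p ⟨x, t, h0, h1, h2, rfl⟩
      obtain ⟨y, hyt, hy⟩ :=
        ode_global_exists H.speed_neg_cont H.speed_neg_lip H.speed_neg_bdd t x
      have hyΓ : ∀ τ, y τ ≤ Γ τ := ode_global_mono H.speed_neg_lip hy hΓ (t₀ := t) (hyt ▸ h2)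
      refine H.abs_v_le h0 hy hyt (by positivity) fun t' ht' => ?_
      refine (hsb (y t') t' ht'.1.le (ht'.2.le.trans h1) (hyΓ t')).trans ?_
      have h3 : M * exp (A (y t')) ≤ M * exp V := by gcongr; exact H.A_le _
      linarith
    refine (le_csSup hbdd hmem).trans ?_
    nlinarith [mul_le_mul_of_nonneg_left hε1 hP0]
  refine H.abs_v_le_of_abs_s_le hM hΓ (fun x t ht hx => ?_) ht hx
  refine (hsP C t hC0 (fun x t h0 _ h => hvC x t h0 h) x t ht le_rfl hx).trans ?_
  linarith

end CoupledWaves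

namespace CoupledWaves

variable {s v : ℝ → ℝ → ℝ} {g a A G : ℝ → ℝ} {κ V Ms Mv : ℝ}

/-- Just right of a characteristic the cumulative variation is, uniformly in time, almost the same
as on it. -/
lemma exists_thin_layer (H : CoupledWaves s v g a A G κ V Ms Mv) {Γ : ℝ → ℝ → ℝ} {ε : ℝ}
    (hε : 0 < ε) (hΓ0 : ∀ b, Γ b 0 = b)
    (hΓ : ∀ b t, HasDerivAt (Γ b) (-(g (Γ b t) * (s (Γ b t) t + v (Γ b t) t) ^ κ)) t) (b : ℝ) :
    ∃ b' > b, ∀ t, 0 ≤ t → A (Γ b' t) ≤ A (Γ b t) + ε := by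
  have hanti : ∀ b, Antitone (Γ b) := fun b =>
    antitone_of_hasDerivAt_nonpos (hΓ b) fun t => (neg_neg_of_pos (H.speed_pos _ _)).le
  have hAanti : ∀ b, Antitone fun t => A (Γ b t) := fun b => H.mono_A.comp_antitone (hanti b)
  have hbdd : BddBelow (range fun t => A (Γ b t)) := ⟨0, by rintro _ ⟨t, rfl⟩; exact H.A_nonneg _⟩
  obtain ⟨T₀, hT₀⟩ := exists_lt_of_ciInf_lt (lt_add_of_pos_right (⨅ t, A (Γ b t)) (half_pos hε))
  set T := max T₀ 0
  have hT : ∀ t, A (Γ b T) ≤ A (Γ b t) + ε / 2 := fun t => by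
    have h1 := hAanti b (le_max_left T₀ 0)
    have h2 := ciInf_le hbdd t
    simp only at h1 h2
    linarith
  have hunif := (isCompact_Icc (a := Γ b T - 1) (b := b + 1)).uniformContinuousOn_of_continuous
    H.cont_A.continuousOn
  obtain ⟨δ, hδ, hδA⟩ := Metric.uniformContinuousOn_iff.1 hunif (ε / 2) (half_pos hε)
  obtain ⟨r, hr, hdep⟩ := ode_global_dependence H.speed_neg_lip H.speed_neg_bdd (hΓ b) T
    (ε := min (δ / 2) 1) (by positivity)
  have hshort : ∀ t, 0 ≤ t → t ≤ T → A (Γ (b + r) t) ≤ A (Γ b t) + ε / 2 := by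
    intro t h0 h1
    have h2 := hdep (Γ (b + r)) (hΓ _) (by simp [hΓ0, abs_of_pos hr]) t ⟨h0, h1⟩
    have h3 := abs_le.1 (h2.trans (min_le_right _ _))
    have h4 := hanti b h0
    rw [hΓ0] at h4
    have h5 := hanti b h1
    have h6 := hδA (Γ (b + r) t) ⟨by linarith, by linarith⟩ (Γ b t) ⟨by linarith, by linarith⟩
      (by rw [Real.dist_eq]; exact (h2.trans (min_le_left _ _)).trans_lt (half_lt_self hδ))
    rw [Real.dist_eq] at h6
    linarith [(abs_lt.1 h6).2]
  refine ⟨b + r, by linarith, fun t ht => ?_⟩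
  rcases le_total t T with h | h
  · linarith [hshort t ht h]
  · have h1 := hAanti (b + r) h
    have h2 := hshort T (le_max_right _ _) le_rfl
    simp only at h1
    linarith [hT t]

/-- Exponential barrier for `v`. -/
lemma abs_v_le_exp (H : CoupledWaves s v g a A G κ V Ms Mv) {M : ℝ} (hM : 2 * Ms + Mv < M)
    {x t : ℝ} (ht : 0 ≤ t) : |v x t| ≤ M * exp (A x) := by
  have hMs := H.Ms_pos
  have hMv := H.Mv_pos
  have hV := H.V_nonneg
  have hM0 : 0 < M := by linarith
  have hθ : 0 < (M - 2 * Ms - Mv) / 4 := by linarith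
  set θ := (M - 2 * Ms - Mv) / 4 with hθ'
  set C := 2 * (Mv + V * (M * exp V)) with hC
  have hC0 : 0 ≤ C := by positivity
  set ε := min (1 / 2 / (3 * V + 1)) (θ / (3 * C + 1))
  have hε : 0 < ε := by positivity
  have hε1 : 3 * V * ε ≤ 1 / 2 := by
    have h1 : ε * (3 * V + 1) ≤ 1 / 2 := (le_div_iff₀ (by positivity)).1 (min_le_left _ _)
    linarith
  have hε2 : 3 * C * ε ≤ θ := by
    have h1 : ε * (3 * C + 1) ≤ θ := (le_div_iff₀ (by positivity)).1 (min_le_right _ _)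
    linarith
  choose Γ hΓ0 hΓ using fun b =>
    ode_global_exists H.speed_neg_cont H.speed_neg_lip H.speed_neg_bdd 0 b
  have hanti : ∀ b, Antitone (Γ b) := fun b =>
    antitone_of_hasDerivAt_nonpos (hΓ b) fun t => (neg_neg_of_pos (H.speed_pos _ _)).le
  have horder : ∀ {b b'}, b ≤ b' → ∀ t, Γ b t ≤ Γ b' t := fun h =>
    ode_global_mono H.speed_neg_lip (hΓ _) (hΓ _) (t₀ := 0) (by rwa [hΓ0, hΓ0])
  have hthrough : ∀ x t, ∃ b, Γ b t = x := fun x t => by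
    obtain ⟨y, hyt, hy⟩ := ode_global_exists H.speed_neg_cont H.speed_neg_lip H.speed_neg_bdd t x
    exact ⟨y 0, by rw [← hyt]; exact ode_global_unique H.speed_neg_lip (hΓ _) hy (hΓ0 _) t⟩
  set good : Set ℝ := {b | ∀ x t, 0 ≤ t → x ≤ Γ b t → |v x t| ≤ M * exp (A x)} with hgood
  obtain ⟨b₂, hb₂⟩ := hthrough x t
  by_contra hbad
  have hb₂bad : b₂ ∉ good := fun h => hbad (h x t ht hb₂.ge)
  have hbdd : BddAbove good := by
    refine ⟨b₂, fun b hb => ?_⟩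
    by_contra! hlt
    exact hb₂bad fun x t h0 h => hb x t h0 (h.trans (horder hlt.le t))
  have hne : good.Nonempty := by
    obtain ⟨b, hb⟩ := (H.A_bot.eventually_lt_const hε).exists
    refine ⟨b, fun x t h0 hx => H.abs_v_le_of_thin hM hε hε1 hε2 (hΓ b)
      (fun x t h0 hx x' t' _ _ _ => Or.inr ?_) h0 hx⟩
    have h1 := hanti b h0
    rw [hΓ0] at h1
    linarith [H.mono_A (hx.trans h1), H.A_nonneg x']
  have hsup : sSup good ∈ good := by
    have hlt : ∀ x t, 0 ≤ t → x < Γ (sSup good) t → |v x t| ≤ M * exp (A x) := by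
      intro x t h0 hx
      obtain ⟨b, hb⟩ := hthrough x t
      have hbs : b < sSup good := by
        by_contra! h
        exact absurd (horder h t) (not_le.2 (hb ▸ hx))
      obtain ⟨b', hb', hbb'⟩ := exists_lt_of_lt_csSup hne hbs
      exact hb' x t h0 (hb ▸ horder hbb'.le t)
    intro x t h0 hx
    rcases hx.lt_or_eq with h | h
    · exact hlt x t h0 h
    · have hvc : Continuous fun x => |v x t| :=
        (H.cont_v.comp (by fun_prop : Continuous fun x : ℝ => (x, t))).abs
      have hAc : Continuous fun x => M * exp (A x) := by have := H.cont_A; fun_prop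
      refine le_of_tendsto_of_tendsto (hvc.continuousWithinAt (s := Iio x) (x := x))
        (hAc.continuousWithinAt (s := Iio x) (x := x)) ?_
      filter_upwards [self_mem_nhdsWithin] with z hz
      exact hlt z t h0 (lt_of_lt_of_eq hz h)
  obtain ⟨b', hb', hthin⟩ := H.exists_thin_layer hε hΓ0 hΓ (sSup good)
  refine absurd (le_csSup hbdd (a := b') fun x t h0 hx => ?_) (not_le.2 hb')
  refine H.abs_v_le_of_thin hM hε hε1 hε2 (hΓ b') (fun x t h0 hx x' t' _ ht0 ht' => ?_) h0 hx
  by_cases h : x' ≤ Γ (sSup good) t'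
  · exact Or.inl (hsup x' t' ht0 h)
  · have h1 := H.mono_A ((hanti (sSup good) ht').trans (not_le.1 h).le)
    exact Or.inr (by linarith [hthin t h0, H.mono_A hx])

lemma sum_le_of_le (H : CoupledWaves s v g a A G κ V Ms Mv) (hle : Ms ≤ Mv) {x t : ℝ}
    (ht : 0 ≤ t) : |s x t| + |v x t| ≤ 3 * (Ms + Mv) * exp V := by
  have hMs := H.Ms_pos
  have hMv := H.Mv_pos
  have hexp := exp_pos V
  have key : ∀ M, 2 * Ms + Mv < M → (|s x t| + |v x t|) / (2 * exp V) ≤ M := by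
    intro M hM
    have h1 := H.abs_v_le_exp hM (x := x) ht
    have h2 := H.abs_s_le (M := M) (P := 0) (ε := 1) (x := x) (by linarith) le_rfl one_pos ht
      fun x' t' _ h0 _ => by simpa using H.abs_v_le_exp hM (x := x') h0
    have h3 : M * exp (A x) ≤ M * exp V :=
      mul_le_mul_of_nonneg_left (exp_le_exp.2 (H.A_le x)) (by linarith)
    rw [div_le_iff₀ (by positivity)]
    linarith
  have h := le_of_forall_gt_imp_ge_of_dense key
  rw [div_le_iff₀ (by positivity)] at h
  nlinarith

/-- Global bound of the two families by data and total variation. -/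
theorem sum_le (H : CoupledWaves s v g a A G κ V Ms Mv) {x t : ℝ} (ht : 0 ≤ t) :
    |s x t| + |v x t| ≤ (Ms + Mv) * (1 + V) * (1 + V ^ 2 * exp (V ^ 2)) := by
  rcases le_total (V ^ 2) (3 / 2) with hV | hV
  · exact H.sum_le_of_sq_le hV ht
  have hMs := H.Ms_pos
  have hMv := H.Mv_pos
  have hV0 := H.V_nonneg
  have hsum : |s x t| + |v x t| ≤ 3 * (Ms + Mv) * exp V := by
    rcases le_total Ms Mv with h | h
    · exact H.sum_le_of_le h ht
    · have := H.reflect.sum_le_of_le h (x := -x) ht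
      simp only [neg_neg] at this
      linarith
  have hV1 : 1 ≤ V := by nlinarith
  have h1 : exp V ≤ exp (V ^ 2) := exp_le_exp.2 (by nlinarith)
  have h2 : 3 ≤ (1 + V) * V ^ 2 := by nlinarith
  have h3 : 3 * exp V ≤ (1 + V) * (1 + V ^ 2 * exp (V ^ 2)) := by
    calc 3 * exp V ≤ (1 + V) * V ^ 2 * exp (V ^ 2) := by gcongr
      _ ≤ _ := by nlinarith
  nlinarith [mul_le_mul_of_nonneg_left h3 (by linarith : 0 ≤ Ms + Mv)]

end CoupledWaves

lemma differentiableAt_of_halfPlane {f : ℝ → ℝ → ℝ}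
    (hf : ContDiffOn ℝ 1 (fun q : ℝ × ℝ => f q.1 q.2) (univ ×ˢ Ici (0 : ℝ))) {x t : ℝ}
    (ht : 0 < t) : DifferentiableAt ℝ (fun q : ℝ × ℝ => f q.1 q.2) (x, t) :=
  (hf.contDiffAt (prod_mem_nhds univ_mem (Ici_mem_nhds ht))).differentiableAt (by simp)

lemma hasDerivAt_pdx {f : ℝ → ℝ → ℝ} {x t : ℝ}
    (hf : DifferentiableAt ℝ (fun q : ℝ × ℝ => f q.1 q.2) (x, t)) :
    HasDerivAt (fun x' => f x' t) (pdx f x t) x :=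
  (DifferentiableAt.comp x (f := fun x' : ℝ => (x', t)) hf (by fun_prop)).hasDerivAt

lemma hasDerivAt_pdt {f : ℝ → ℝ → ℝ} {x t : ℝ}
    (hf : DifferentiableAt ℝ (fun q : ℝ × ℝ => f q.1 q.2) (x, t)) :
    HasDerivAt (fun t' => f x t') (pdt f x t) t :=
  (DifferentiableAt.comp t (f := fun t' : ℝ => (x, t')) hf (by fun_prop)).hasDerivAt

/-- Directional derivatives in the plane from the partial derivatives. -/
lemma exists_hasFDerivAt_apply_eq {f : ℝ → ℝ → ℝ} {x t fx ft : ℝ}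
    (hf : DifferentiableAt ℝ (Function.uncurry f) (x, t))
    (hx : HasDerivAt (fun x' => f x' t) fx x) (ht : HasDerivAt (fun t' => f x t') ft t) (c : ℝ) :
    ∃ L : ℝ × ℝ →L[ℝ] ℝ, HasFDerivAt (Function.uncurry f) L (x, t) ∧ L (c, 1) = c * fx + ft := by
  refine ⟨_, hf.hasFDerivAt, ?_⟩
  set L := fderiv ℝ (Function.uncurry f) (x, t)
  have h1 : L (1, 0) = fx :=
    (HasFDerivAt.comp_hasDerivAt (f := fun x' : ℝ => (x', t)) x hf.hasFDerivAt
      ((hasDerivAt_id x).prodMk (hasDerivAt_const x t))).unique hx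
  have h2 : L (0, 1) = ft :=
    (HasFDerivAt.comp_hasDerivAt (f := fun t' : ℝ => (x, t')) t hf.hasFDerivAt
      ((hasDerivAt_const t x).prodMk (hasDerivAt_id t))).unique ht
  have : ((c, 1) : ℝ × ℝ) = c • (1, 0) + (0, 1) := by simp
  rw [this, map_add, map_smul, h1, h2, smul_eq_mul]

/-- A derivative of the pressure law along a curve of states. -/
lemma hasDerivAt_pressure {K ctau γ : ℝ} {S τ : ℝ → ℝ} {S' τ' z : ℝ} (hτ : 0 < τ z)
    (hS : HasDerivAt S S' z) (hτ' : HasDerivAt τ τ' z) :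
    HasDerivAt (fun y => K * exp (S y / ctau) * τ y ^ (-γ))
      (K * exp (S z / ctau) * τ z ^ (-γ) * (S' / ctau - γ * τ' / τ z)) z := by
  refine (((hS.div_const ctau).exp.const_mul K).mul
    (hτ'.rpow_const (p := -γ) (Or.inl hτ.ne'))).congr_deriv ?_
  rw [rpow_sub_one hτ.ne']
  field_simp
  ring

/-- The entropy of a smooth solution is stationary. -/
lemma pdt_entropy_eq_zero {K ctau γ : ℝ} (hK : 0 < K) (hctau : 0 < ctau) (hγ : 1 < γ)
    {τ u S p e : ℝ → ℝ → ℝ} {x t : ℝ}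
    (hτ : DifferentiableAt ℝ (fun q : ℝ × ℝ => τ q.1 q.2) (x, t))
    (hu : DifferentiableAt ℝ (fun q : ℝ × ℝ => u q.1 q.2) (x, t))
    (hS : DifferentiableAt ℝ (fun q : ℝ × ℝ => S q.1 q.2) (x, t)) (hpos : 0 < τ x t)
    (hp : ∀ x t, p x t = K * exp (S x t / ctau) * τ x t ^ (-γ))
    (he : ∀ x t, e x t = p x t * τ x t / (γ - 1))
    (hmass : pdt τ x t - pdx u x t = 0) (hmom : pdt u x t + pdx p x t = 0)
    (hen : pdt (fun x' t' => u x' t' ^ 2 / 2 + e x' t') x t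
      + pdx (fun x' t' => u x' t' * p x' t') x t = 0) : pdt S x t = 0 := by
  have hpx := hasDerivAt_pressure (K := K) (ctau := ctau) (γ := γ) (z := x)
    (τ := fun x' => τ x' t) hpos (hasDerivAt_pdx hS)
    (hasDerivAt_pdx hτ)
  have hpt := hasDerivAt_pressure (K := K) (ctau := ctau) (γ := γ) (z := t)
    (τ := fun t' => τ x t') hpos (hasDerivAt_pdt hS)
    (hasDerivAt_pdt hτ)
  simp only [← hp] at hpx hpt
  have hP : 0 < p x t := by rw [hp]; positivity
  have h1 : pdx p x t = p x t * (pdx S x t / ctau - γ * pdx τ x t / τ x t) := hpx.deriv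
  have h2 := (((hasDerivAt_pdt hu).pow 2).div_const 2).add
    ((hpt.mul (hasDerivAt_pdt hτ)).div_const (γ - 1))
  have h3 := ((hasDerivAt_pdx hu).mul hpx).deriv
  have h4 : pdt (fun x' t' => u x' t' ^ 2 / 2 + e x' t') x t = _ :=
    (h2.congr_of_eventuallyEq (Eventually.of_forall fun t' => by simp [he])).deriv
  have h5 : pdx (fun x' t' => u x' t' * p x' t') x t = _ := h3
  rw [h4, h5] at hen
  rw [h1] at hmom
  have hγ' : γ - 1 ≠ 0 := by linarith
  have hut : pdt u x t = -(p x t * (pdx S x t / ctau - γ * pdx τ x t / τ x t)) := by linarith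
  have hux : pdx u x t = pdt τ x t := by linarith
  rw [hut, hux] at hen
  have hz : p x t * τ x t / (ctau * (γ - 1)) * pdt S x t = 0 := by
    rw [← hen]
    field_simp
    ring
  have : p x t * τ x t / (ctau * (γ - 1)) ≠ 0 := by
    have : 0 < γ - 1 := by linarith
    positivity
  exact (mul_eq_zero.1 hz).resolve_left this

lemma continuous_max_time {f : ℝ → ℝ → ℝ}
    (hf : ContDiffOn ℝ 1 (fun q : ℝ × ℝ => f q.1 q.2) (univ ×ˢ Ici (0 : ℝ))) :
    Continuous (fun q : ℝ × ℝ => f q.1 (max q.2 0)) :=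
  hf.continuousOn.comp_continuous (f := fun q : ℝ × ℝ => (q.1, max q.2 0)) (by fun_prop)
    (fun q => ⟨mem_univ _, le_max_right q.2 0⟩)

/-- A function whose time derivative vanishes is determined by its initial values. -/
lemma eq_initial_of_pdt_eq_zero {f : ℝ → ℝ → ℝ}
    (hf : ContDiffOn ℝ 1 (fun q : ℝ × ℝ => f q.1 q.2) (univ ×ˢ Ici (0 : ℝ)))
    (h0 : ∀ x t, 0 < t → pdt f x t = 0) (x : ℝ) {t : ℝ} (ht : 0 ≤ t) : f x t = f x 0 := by
  have hc : Continuous (fun t => f x (max t 0)) :=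
    (continuous_max_time hf).comp (f := fun t : ℝ => (x, t)) (by fun_prop)
  have hd : ∀ s ∈ Ioo 0 t, HasDerivAt (fun t => f x (max t 0)) 0 s := by
    intro s hs
    have h := hasDerivAt_pdt (differentiableAt_of_halfPlane hf (x := x) hs.1)
    rw [h0 x s hs.1] at h
    refine h.congr_of_eventuallyEq ?_
    filter_upwards [lt_mem_nhds hs.1] with r hr
    rw [max_eq_left hr.le]
  have h1 := le_of_hasDerivAt_nonpos ht hc hd (fun _ _ => le_rfl)
  have h2 := le_of_hasDerivAt_nonpos ht hc.neg (fun s hs => (hd s hs).neg) (fun _ _ => by simp)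
  simp only [Pi.neg_apply, max_self, max_eq_left ht] at h1 h2
  linarith

/-- Evolution of the normalized Riemann invariants of the Euler equations. -/
lemma riemann_directional {K γ a σ : ℝ} (hK : 0 < K) (hγ : 1 < γ) (hσ : σ ^ 2 = 1)
    {w m : ℝ → ℝ} {τ u : ℝ → ℝ → ℝ} {x t τx τt ux ut : ℝ} (hpos : 0 < τ x t)
    (hm : HasDerivAt m (2 * γ * a * m x) x) (hw : HasDerivAt w (-(a * w x)) x)
    (hτ : DifferentiableAt ℝ (fun q : ℝ × ℝ => τ q.1 q.2) (x, t))
    (hu : DifferentiableAt ℝ (fun q : ℝ × ℝ => u q.1 q.2) (x, t))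
    (hτx : HasDerivAt (fun x' => τ x' t) τx x) (hτt : HasDerivAt (fun t' => τ x t') τt t)
    (hux : HasDerivAt (fun x' => u x' t) ux x) (hut : HasDerivAt (fun t' => u x t') ut t)
    (hmass : τt = ux)
    (hmom : ut = -(K * m x ^ 2 * τ x t ^ (-γ) * (4 * γ * a - γ * τx / τ x t))) :
    ∃ L : ℝ × ℝ →L[ℝ] ℝ, HasFDerivAt (fun q : ℝ × ℝ => w q.1 * (m q.1 *
        (2 * √(K * γ) / (γ - 1) * τ q.1 q.2 ^ (-((γ - 1) / 2))) + σ * u q.1 q.2)) L (x, t) ∧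
      L (σ * (m x * √(K * γ) * τ x t ^ (-((γ + 1) / 2))), 1) =
        σ * (a * (m x * √(K * γ) * τ x t ^ (-((γ + 1) / 2))) * (w x * (m x *
        (2 * √(K * γ) / (γ - 1) * τ x t ^ (-((γ - 1) / 2))) - σ * u x t))) := by
  have hfx := hw.mul ((hm.mul ((hτx.rpow_const (p := -((γ - 1) / 2)) (Or.inl hpos.ne')).const_mul
    (2 * √(K * γ) / (γ - 1)))).add (hux.const_mul σ))
  have hft := ((((hτt.rpow_const (p := -((γ - 1) / 2)) (Or.inl hpos.ne')).const_mul
    (2 * √(K * γ) / (γ - 1))).const_mul (m x)).add (hut.const_mul σ)).const_mul (w x)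
  have hdw : DifferentiableAt ℝ (fun q : ℝ × ℝ => w q.1) (x, t) :=
    DifferentiableAt.comp (x, t) (f := fun q : ℝ × ℝ => q.1) hw.differentiableAt (by fun_prop)
  have hdm : DifferentiableAt ℝ (fun q : ℝ × ℝ => m q.1) (x, t) :=
    DifferentiableAt.comp (x, t) (f := fun q : ℝ × ℝ => q.1) hm.differentiableAt (by fun_prop)
  have hd := hdw.mul ((hdm.mul ((hτ.rpow_const (p := -((γ - 1) / 2)) (Or.inl hpos.ne')).const_mul
    (2 * √(K * γ) / (γ - 1)))).add (hu.const_mul σ))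
  obtain ⟨L, hL, hLc⟩ := exists_hasFDerivAt_apply_eq
    (f := fun x t => w x * (m x * (2 * √(K * γ) / (γ - 1) * τ x t ^ (-((γ - 1) / 2))) + σ * u x t))
    hd hfx hft (σ * (m x * √(K * γ) * τ x t ^ (-((γ + 1) / 2))))
  refine ⟨L, hL, ?_⟩
  rw [hLc]
  set q := √(K * γ) with hq
  have hq2 : q ^ 2 = K * γ := Real.sq_sqrt (by nlinarith)
  set Y := τ x t ^ (-((γ + 1) / 2)) with hY
  have hX : τ x t ^ (-((γ - 1) / 2)) = τ x t * Y := by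
    rw [hY, ← rpow_one_add' hpos.le (by linarith)]
    congr 1
    ring
  have hX' : τ x t ^ (-((γ - 1) / 2) - 1) = Y := by
    rw [hY]
    congr 1
    ring
  have hZ : τ x t ^ (-γ) = τ x t * Y ^ 2 := by
    rw [hY, ← rpow_natCast, ← rpow_mul hpos.le, ← rpow_one_add' hpos.le (by push_cast; linarith)]
    congr 1
    push_cast
    ring
  have hγ' : γ - 1 ≠ 0 := by linarith
  have hτ0 := hpos.ne'
  simp only [Pi.add_apply, Pi.mul_apply, hX, hX']
  rw [hmom, hmass, hZ]
  have hKq : K = q ^ 2 / γ := by rw [hq2]; field_simp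
  rw [hKq]
  rcases eq_or_eq_neg_of_sq_eq_sq σ 1 (by rw [hσ, one_pow]) with rfl | rfl <;> (field_simp; ring)

lemma exists_lipschitzOnWith_slices {F : ℝ → ℝ → ℝ}
    (hF : ContDiffOn ℝ 1 (fun q : ℝ × ℝ => F q.1 q.2) (univ ×ˢ Ici (0 : ℝ))) (R : ℝ) :
    ∃ K : ℝ≥0, ∀ t ≤ R, LipschitzOnWith K (fun x => F x (max t 0)) (Icc (-R) R) := by
  have hsub : Icc (-R) R ×ˢ Icc (0 : ℝ) (max R 0) ⊆ univ ×ˢ Ici (0 : ℝ) :=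
    prod_mono (subset_univ _) Icc_subset_Ici_self
  have hloc : LocallyLipschitzOn (Icc (-R) R ×ˢ Icc (0 : ℝ) (max R 0))
      (fun q : ℝ × ℝ => F q.1 q.2) := by
    intro q hq
    obtain ⟨K, t, ht, hL⟩ := ((hF.mono hsub) q hq).exists_lipschitzOnWith
      ((convex_Icc _ _).prod (convex_Icc _ _))
    exact ⟨K, t, ht, hL⟩
  obtain ⟨K, hK⟩ := hloc.exists_lipschitzOnWith_of_compact (isCompact_Icc.prod isCompact_Icc)
  refine ⟨K, fun t ht => LipschitzOnWith.of_dist_le_mul fun x hx y hy => ?_⟩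
  have hmem : max t 0 ∈ Icc (0 : ℝ) (max R 0) := ⟨le_max_right _ _, max_le_max_right 0 ht⟩
  have := hK.dist_le_mul (x, max t 0) ⟨hx, hmem⟩ (y, max t 0) ⟨hy, hmem⟩
  simpa [Prod.dist_eq] using this

lemma exists_hasDerivAt_tendsto_integral {f : ℝ → ℝ} (hf : Continuous f) (hi : Integrable f) :
    ∃ A : ℝ → ℝ, (∀ x, HasDerivAt A (f x) x) ∧ Tendsto A atBot (𝓝 0) ∧
      Tendsto A atTop (𝓝 (∫ x, f x)) := by
  refine ⟨fun x => (∫ y in Iic 0, f y) + ∫ y in (0 : ℝ)..x, f y, fun x =>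
    ((hf.integral_hasStrictDerivAt 0 x).hasDerivAt).const_add _, ?_, ?_⟩
  · have h := (intervalIntegral_tendsto_integral_Iic (0 : ℝ) hi.integrableOn
      (tendsto_id (α := ℝ) (x := atBot))).const_sub (∫ y in Iic 0, f y)
    rw [sub_self] at h
    refine h.congr fun x => ?_
    rw [intervalIntegral.integral_symm x 0]
    exact sub_eq_add_neg _ _
  · have h := (intervalIntegral_tendsto_integral_Ioi (0 : ℝ) hi.integrableOn
      (tendsto_id (α := ℝ) (x := atTop))).const_add (∫ y in Iic 0, f y)
    rw [intervalIntegral.integral_Iic_add_Ioi hi.integrableOn hi.integrableOn] at h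
    exact h

/-- The normalized Riemann invariant `w (m η + σ u)`, frozen for negative times. -/
noncomputable def riemannWave (K γ σ : ℝ) (m : ℝ → ℝ) (τ u : ℝ → ℝ → ℝ) (x t : ℝ) : ℝ :=
  m x ^ (-(1 / (2 * γ))) * (m x * (2 * √(K * γ) / (γ - 1) *
    τ x (max t 0) ^ (-((γ - 1) / 2))) + σ * u x (max t 0))

lemma continuous_riemannWave {K γ σ : ℝ} {m : ℝ → ℝ} {τ u : ℝ → ℝ → ℝ}
    (hτ : ContDiffOn ℝ 1 (fun q : ℝ × ℝ => τ q.1 q.2) (univ ×ˢ Ici (0 : ℝ)))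
    (hu : ContDiffOn ℝ 1 (fun q : ℝ × ℝ => u q.1 q.2) (univ ×ˢ Ici (0 : ℝ)))
    (hpos : ∀ x t, 0 ≤ t → 0 < τ x t) (hm : Continuous m) (hm0 : ∀ x, 0 < m x) :
    Continuous (Function.uncurry (riemannWave K γ σ m τ u)) := by
  have h1 : Continuous fun q : ℝ × ℝ => m q.1 ^ (-(1 / (2 * γ))) :=
    (hm.comp continuous_fst).rpow_const fun q => Or.inl (hm0 q.1).ne'
  have h2 : Continuous fun q : ℝ × ℝ => τ q.1 (max q.2 0) ^ (-((γ - 1) / 2)) :=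
    (continuous_max_time hτ).rpow_const fun q => Or.inl (hpos _ _ (le_max_right _ _)).ne'
  exact h1.mul (((hm.comp continuous_fst).mul (h2.const_mul _)).add
    ((continuous_max_time hu).const_mul σ))

lemma riemannWave_directional {K γ a σ : ℝ} (hK : 0 < K) (hγ : 1 < γ) (hσ : σ ^ 2 = 1)
    {m : ℝ → ℝ} {τ u : ℝ → ℝ → ℝ} {x t τx τt ux ut : ℝ} (ht : 0 < t) (hpos : 0 < τ x t)
    (hmpos : 0 < m x) (hm : HasDerivAt m (2 * γ * a * m x) x)
    (hτ : DifferentiableAt ℝ (fun q : ℝ × ℝ => τ q.1 q.2) (x, t))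
    (hu : DifferentiableAt ℝ (fun q : ℝ × ℝ => u q.1 q.2) (x, t))
    (hτx : HasDerivAt (fun x' => τ x' t) τx x) (hτt : HasDerivAt (fun t' => τ x t') τt t)
    (hux : HasDerivAt (fun x' => u x' t) ux x) (hut : HasDerivAt (fun t' => u x t') ut t)
    (hmass : τt = ux)
    (hmom : ut = -(K * m x ^ 2 * τ x t ^ (-γ) * (4 * γ * a - γ * τx / τ x t))) :
    ∃ L : ℝ × ℝ →L[ℝ] ℝ, HasFDerivAt (Function.uncurry (riemannWave K γ σ m τ u)) L (x, t) ∧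
      L (σ * (m x * √(K * γ) * τ x t ^ (-((γ + 1) / 2))), 1) =
        σ * (a * (m x * √(K * γ) * τ x t ^ (-((γ + 1) / 2))) *
          riemannWave K γ (-σ) m τ u x t) := by
  have hw : HasDerivAt (fun x => m x ^ (-(1 / (2 * γ)))) (-(a * m x ^ (-(1 / (2 * γ))))) x := by
    refine (hm.rpow_const (p := -(1 / (2 * γ))) (Or.inl hmpos.ne')).congr_deriv ?_
    rw [rpow_sub_one hmpos.ne']
    have : γ ≠ 0 := by linarith
    have := hmpos.ne'
    field_simp
  obtain ⟨L, hL, h⟩ := riemann_directional hK hγ hσ hpos hm hw hτ hu hτx hτt hux hut hmass hmom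
  refine ⟨L, hL.congr_of_eventuallyEq ?_, ?_⟩
  · filter_upwards [(isOpen_lt continuous_const continuous_snd).mem_nhds
      (show (0 : ℝ) < ((x, t) : ℝ × ℝ).2 from ht)] with q hq
    have hq' : (0 : ℝ) < q.2 := hq
    simp only [Function.uncurry, riemannWave, max_eq_left hq'.le]
  · rw [h]
    simp only [riemannWave, max_eq_left ht.le]
    ring

lemma riemannWave_add_neg (K γ : ℝ) {m : ℝ → ℝ} (τ u : ℝ → ℝ → ℝ) (x t : ℝ) :
    riemannWave K γ 1 m τ u x t + riemannWave K γ (-1) m τ u x t =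
      2 * m x ^ (-(1 / (2 * γ))) * m x * (2 * √(K * γ) / (γ - 1)) *
        τ x (max t 0) ^ (-((γ - 1) / 2)) := by
  simp only [riemannWave]
  ring

/-- The wave speed factor of a polytropic gas as a function of the entropy variable `y`. -/
noncomputable def speedFactor (K γ y : ℝ) : ℝ :=
  y * √(K * γ) * (2 * y ^ (-(1 / (2 * γ))) * y * (2 * √(K * γ) / (γ - 1))) ^
    (-((γ + 1) / (γ - 1)))

lemma speedFactor_pos {K γ y : ℝ} (hK : 0 < K) (hγ : 1 < γ) (hy : 0 < y) :
    0 < speedFactor K γ y := by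
  have : 0 < γ - 1 := by linarith
  have : 0 < γ := by linarith
  unfold speedFactor
  positivity

lemma continuousOn_speedFactor {K γ : ℝ} (hK : 0 < K) (hγ : 1 < γ) :
    ContinuousOn (speedFactor K γ) (Ioi 0) := by
  have : 0 < γ - 1 := by linarith
  have : 0 < γ := by linarith
  have h1 : ContinuousOn (fun y : ℝ => 2 * y ^ (-(1 / (2 * γ))) * y * (2 * √(K * γ) / (γ - 1)))
      (Ioi 0) :=
    ((continuousOn_const.mul (continuousOn_id.rpow_const
      fun y hy => Or.inl (ne_of_gt hy))).mul continuousOn_id).mul continuousOn_const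
  refine (continuousOn_id.mul continuousOn_const).mul (h1.rpow_const fun y hy => Or.inl ?_)
  have : (0 : ℝ) < y := hy
  positivity

lemma speedFactor_mul {K γ y z : ℝ} (hK : 0 < K) (hγ : 1 < γ) (hy : 0 < y) (hz : 0 < z) :
    speedFactor K γ y * (2 * y ^ (-(1 / (2 * γ))) * y * (2 * √(K * γ) / (γ - 1)) *
        z ^ (-((γ - 1) / 2))) ^ ((γ + 1) / (γ - 1)) = y * √(K * γ) * z ^ (-((γ + 1) / 2)) := by
  have h1 : 0 < γ - 1 := by linarith
  have : 0 < γ := by linarith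
  have hB : 0 < 2 * y ^ (-(1 / (2 * γ))) * y * (2 * √(K * γ) / (γ - 1)) := by positivity
  rw [mul_rpow hB.le (by positivity), ← rpow_mul hz.le, speedFactor, rpow_neg hB.le]
  have h2 : -((γ - 1) / 2) * ((γ + 1) / (γ - 1)) = -((γ + 1) / 2) := by field_simp
  have h3 := (rpow_pos_of_pos hB ((γ + 1) / (γ - 1))).ne'
  rw [h2]
  field_simp

/-- The Riemann invariants of a smooth solution of the Euler equations form a pair of
coupled waves. -/
lemma exists_coupledWaves_of_euler {K ctau γ ML MU Ms Mr : ℝ} {τ u S p e : ℝ → ℝ → ℝ} {m : ℝ → ℝ}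
    (hK : 0 < K) (hctau : 0 < ctau) (hγ : 1 < γ)
    (hτreg : ContDiffOn ℝ 1 (fun q : ℝ × ℝ => τ q.1 q.2) (univ ×ˢ Ici (0 : ℝ)))
    (hureg : ContDiffOn ℝ 1 (fun q : ℝ × ℝ => u q.1 q.2) (univ ×ˢ Ici (0 : ℝ)))
    (hSreg : ContDiffOn ℝ 1 (fun q : ℝ × ℝ => S q.1 q.2) (univ ×ˢ Ici (0 : ℝ)))
    (hτpos : ∀ x t, 0 ≤ t → 0 < τ x t)
    (hp : ∀ x t, p x t = K * exp (S x t / ctau) * τ x t ^ (-γ))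
    (he : ∀ x t, e x t = p x t * τ x t / (γ - 1))
    (hmass : ∀ x : ℝ, ∀ t > (0 : ℝ), pdt τ x t - pdx u x t = 0)
    (hmom : ∀ x : ℝ, ∀ t > (0 : ℝ), pdt u x t + pdx p x t = 0)
    (hen : ∀ x : ℝ, ∀ t > (0 : ℝ), pdt (fun x' t' => u x' t' ^ 2 / 2 + e x' t') x t
        + pdx (fun x' t' => u x' t' * p x' t') x t = 0)
    (hm : ∀ x, m x = exp (S x 0 / (2 * ctau)))
    (hmint : Integrable fun x => |deriv m x| / m x)
    (hML : 0 < ML) (hmbd : ∀ x, ML < m x ∧ m x < MU)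
    (hs : ∀ x, |riemannWave K γ 1 m τ u x 0| < Ms)
    (hr : ∀ x, |riemannWave K γ (-1) m τ u x 0| < Mr) :
    ∃ g a A G : ℝ → ℝ, CoupledWaves (riemannWave K γ 1 m τ u) (riemannWave K γ (-1) m τ u)
      g a A G ((γ + 1) / (γ - 1)) ((∫ x, |deriv m x| / m x) / (2 * γ)) Ms Mr := by
  have h1 : 0 < γ - 1 := by linarith
  have hγ0 : 0 < γ := by linarith
  have hmpos : ∀ x, 0 < m x := fun x => hML.trans (hmbd x).1
  have hS0 : ContDiff ℝ 1 (fun x => S x 0) := by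
    rw [← contDiffOn_univ]
    exact hSreg.comp (f := fun x : ℝ => (x, (0 : ℝ))) (by fun_prop)
      fun x _ => ⟨mem_univ _, self_mem_Ici⟩
  have hmC : ContDiff ℝ 1 m := by
    rw [funext hm]
    fun_prop
  have hmd : ∀ x, HasDerivAt m (deriv m x) x := fun x =>
    (hmC.differentiable (by simp) x).hasDerivAt
  have hm'c : Continuous (deriv m) := hmC.continuous_deriv le_rfl
  have hmcont := hmC.continuous
  have hSt : ∀ x t, 0 ≤ t → S x t = S x 0 := fun x t ht =>
    eq_initial_of_pdt_eq_zero hSreg (fun x t ht =>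
      pdt_entropy_eq_zero hK hctau hγ (differentiableAt_of_halfPlane hτreg ht)
        (differentiableAt_of_halfPlane hureg ht) (differentiableAt_of_halfPlane hSreg ht)
        (hτpos x t ht.le) hp he (hmass x t ht) (hmom x t ht) (hen x t ht)) x ht
  set a : ℝ → ℝ := fun x => deriv m x / m x / (2 * γ) with ha
  have hac : Continuous a := (hm'c.div hmcont fun x => (hmpos x).ne').div_const _
  have habs : (fun x => |a x|) = fun x => |deriv m x| / m x / (2 * γ) := by
    ext x
    rw [ha, abs_div, abs_div, abs_of_pos (hmpos x), abs_of_pos (by positivity : 0 < 2 * γ)]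
  obtain ⟨A, hA, hAb, hAt⟩ := exists_hasDerivAt_tendsto_integral hac.abs
    (by rw [habs]; exact hmint.div_const _)
  rw [habs, integral_div] at hAt
  have hmda : ∀ x, HasDerivAt m (2 * γ * a x * m x) x := fun x => by
    refine (hmd x).congr_deriv ?_
    have := (hmpos x).ne'
    simp only [ha]
    field_simp
  set g : ℝ → ℝ := fun x => speedFactor K γ (m x) with hg
  have hgc : Continuous g := (continuousOn_speedFactor hK hγ).comp_continuous hmcont hmpos
  have hgpos : ∀ x, 0 < g x := fun x => speedFactor_pos hK hγ (hmpos x)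
  have hspeed : ∀ x t, g x * (riemannWave K γ 1 m τ u x t + riemannWave K γ (-1) m τ u x t) ^
      ((γ + 1) / (γ - 1)) = m x * √(K * γ) * τ x (max t 0) ^ (-((γ + 1) / 2)) := fun x t => by
    rw [riemannWave_add_neg]
    exact speedFactor_mul hK hγ (hmpos x) (hτpos _ _ (le_max_right _ _))
  have hSx : ∀ x t, 0 < t → pdx S x t / ctau = 4 * γ * a x := fun x t ht => by
    have hd := ((hS0.differentiable (by simp) x).hasDerivAt.div_const (2 * ctau)).exp
    have h2 : HasDerivAt m (m x * (deriv (fun x => S x 0) x / (2 * ctau))) x := by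
      rw [hm x]
      refine hd.congr_of_eventuallyEq (Eventually.of_forall hm)
    have h3 : pdx S x t = deriv (fun x => S x 0) x := by
      simp only [pdx, hSt _ t ht.le]
    rw [h3]
    simp only [ha]
    rw [h2.deriv]
    have := (hmpos x).ne'
    field_simp
    ring
  have hmom' : ∀ x t, 0 < t → pdt u x t = -(K * m x ^ 2 * τ x t ^ (-γ) *
      (4 * γ * a x - γ * pdx τ x t / τ x t)) := fun x t ht => by
    have hpx := hasDerivAt_pressure (K := K) (ctau := ctau) (γ := γ) (z := x)
      (τ := fun x' => τ x' t) (hτpos x t ht.le)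
      (hasDerivAt_pdx (differentiableAt_of_halfPlane hSreg ht))
      (hasDerivAt_pdx (differentiableAt_of_halfPlane hτreg ht))
    simp only [← hp] at hpx
    have hm2 : m x ^ 2 = exp (S x t / ctau) := by
      rw [hm, hSt x t ht.le, ← exp_nat_mul]
      congr 1
      push_cast
      field_simp
    have h4 : pdx p x t = p x t * (pdx S x t / ctau - γ * pdx τ x t / τ x t) := hpx.deriv
    rw [hm2, ← hSx x t ht, ← hp, ← h4]
    linarith [hmom x t ht]
  have heq : ∀ σ : ℝ, σ ^ 2 = 1 → ∀ x t, 0 < t → ∃ L : ℝ × ℝ →L[ℝ] ℝ,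
      HasFDerivAt (Function.uncurry (riemannWave K γ σ m τ u)) L (x, t) ∧
      L (σ * (m x * √(K * γ) * τ x t ^ (-((γ + 1) / 2))), 1) =
        σ * (a x * (m x * √(K * γ) * τ x t ^ (-((γ + 1) / 2))) *
          riemannWave K γ (-σ) m τ u x t) := fun σ hσ x t ht => by
    have hτd := differentiableAt_of_halfPlane hτreg (x := x) ht
    have hud := differentiableAt_of_halfPlane hureg (x := x) ht
    exact riemannWave_directional hK hγ hσ ht (hτpos x t ht.le) (hmpos x) (hmda x) hτd hud
      (hasDerivAt_pdx hτd) (hasDerivAt_pdt hτd) (hasDerivAt_pdx hud) (hasDerivAt_pdt hud)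
      (by linarith [hmass x t ht]) (hmom' x t ht)
  have hGc : Continuous fun x => 1 / g x := continuous_const.div hgc fun x => (hgpos x).ne'
  refine ⟨g, a, A, fun x => ∫ y in (0 : ℝ)..x, 1 / g y, ?_⟩
  exact
    { cont_s := continuous_riemannWave hτreg hureg hτpos hmcont hmpos
      cont_v := continuous_riemannWave hτreg hureg hτpos hmcont hmpos
      past_s := fun x t ht => by simp only [riemannWave, max_eq_right ht, max_self]
      past_v := fun x t ht => by simp only [riemannWave, max_eq_right ht, max_self]
      pos := fun x t => by
        rw [riemannWave_add_neg]
        have := hmpos x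
        have := hτpos x (max t 0) (le_max_right _ _)
        positivity
      kappa_pos := by positivity
      g_cont := hgc
      g_pos := hgpos
      g_bdd := by
        obtain ⟨C, hC⟩ := (isCompact_Icc (a := ML) (b := MU)).exists_bound_of_continuousOn
          ((continuousOn_speedFactor hK hγ).mono fun y hy => hML.trans_le hy.1)
        exact ⟨C, fun x => (le_abs_self _).trans (hC (m x) ⟨(hmbd x).1.le, (hmbd x).2.le⟩)⟩
      lip := fun R => by
        simp only [hspeed]
        have hF : ContDiffOn ℝ 1 (fun q : ℝ × ℝ =>
            m q.1 * √(K * γ) * τ q.1 q.2 ^ (-((γ + 1) / 2))) (univ ×ˢ Ici (0 : ℝ)) :=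
          ((hmC.comp contDiff_fst).contDiffOn.mul contDiffOn_const).mul
            (hτreg.rpow_const_of_ne fun q hq => (hτpos q.1 q.2 hq.2).ne')
        exact exists_lipschitzOnWith_slices
          (F := fun x t => m x * √(K * γ) * τ x t ^ (-((γ + 1) / 2))) hF R
      deriv_G := fun x => (hGc.integral_hasStrictDerivAt 0 x).hasDerivAt
      deriv_A := hA
      A_bot := hAb
      A_top := hAt
      init_s := hs
      init_v := hr
      s_eq := fun x t ht => by
        rw [hspeed, max_eq_left ht.le]
        simpa using heq 1 (by norm_num) x t ht
      v_eq := fun x t ht => by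
        rw [hspeed, max_eq_left ht.le]
        simpa using heq (-1) (by norm_num) x t ht }

end

/-- a priori `L^∞` bounds for velocity, `η` and density, for C¹
solutions of the one-dimensional Lagrangian compressible Euler equations,
depending only on the initial data. -/
theorem stmt0
    (K ctau γ : ℝ) (hK : 0 < K) (hctau : 0 < ctau) (hγ : 1 < γ)
    (ML MU Ms Mr V Vb N1 N2 Ktau : ℝ)
    (τ u S : ℝ → ℝ → ℝ)
    (hτreg : ContDiffOn ℝ 1 (fun q : ℝ × ℝ => τ q.1 q.2) (Set.univ ×ˢ Set.Ici (0:ℝ)))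
    (hureg : ContDiffOn ℝ 1 (fun q : ℝ × ℝ => u q.1 q.2) (Set.univ ×ˢ Set.Ici (0:ℝ)))
    (hSreg : ContDiffOn ℝ 1 (fun q : ℝ × ℝ => S q.1 q.2) (Set.univ ×ˢ Set.Ici (0:ℝ)))
    (hτpos : ∀ x t, 0 ≤ t → 0 < τ x t)
    (p e : ℝ → ℝ → ℝ)
    (hp : ∀ x t, p x t = K * Real.exp (S x t / ctau) * τ x t ^ (-γ))
    (he : ∀ x t, e x t = p x t * τ x t / (γ - 1))
    (hmass : ∀ x : ℝ, ∀ t > (0:ℝ), pdt τ x t - pdx u x t = 0)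
    (hmom : ∀ x : ℝ, ∀ t > (0:ℝ), pdt u x t + pdx p x t = 0)
    (hen : ∀ x : ℝ, ∀ t > (0:ℝ),
      pdt (fun x' t' => u x' t' ^ 2 / 2 + e x' t') x t
        + pdx (fun x' t' => u x' t' * p x' t') x t = 0)
    (η : ℝ → ℝ → ℝ)
    (hη : ∀ x t, η x t = 2 * Real.sqrt (K * γ) / (γ - 1) * τ x t ^ (-((γ - 1) / 2)))
    (m0 : ℝ → ℝ) (hm0 : ∀ x, m0 x = Real.exp (S x 0 / (2 * ctau)))
    (hVint : Integrable (fun x => |deriv m0 x| / m0 x))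
    (hV : V = ∫ x, |deriv m0 x| / m0 x)
    (hML : 0 < ML) (hmbd : ∀ x, ML < m0 x ∧ m0 x < MU)
    (hMs : ∀ x, |m0 x ^ (-(1 / (2 * γ))) * (u x 0 + m0 x * η x 0)| < Ms)
    (hMr : ∀ x, |m0 x ^ (-(1 / (2 * γ))) * (u x 0 - m0 x * η x 0)| < Mr)
    (hVb : Vb = V / (2 * γ))
    (hN1 : N1 = Ms + Vb * Mr + Vb * (Vb * Ms + Vb ^ 2 * Mr) * Real.exp (Vb ^ 2))
    (hN2 : N2 = Mr + Vb * Ms + Vb * (Vb * Mr + Vb ^ 2 * Ms) * Real.exp (Vb ^ 2))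
    (hKtau : Ktau = (2 * Real.sqrt (K * γ) / (γ - 1)) ^ ((2:ℝ) / (γ - 1))) :
    ∀ x t, 0 ≤ t →
      |u x t| ≤ (N1 + N2) / 2 * MU ^ (1 / (2 * γ)) ∧
      η x t ≤ (N1 + N2) / 2 * ML ^ (1 / (2 * γ) - 1) ∧
      1 / τ x t
        ≤ Ktau⁻¹ * ((N1 + N2) / 2 * ML ^ (1 / (2 * γ) - 1)) ^ ((2:ℝ) / (γ - 1)) := by
  intro x t ht
  have h1 : 0 < γ - 1 := by linarith
  have hγ0 : 0 < γ := by linarith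
  have hm : 0 < m0 x := hML.trans (hmbd x).1
  have hz := hτpos x t ht
  obtain ⟨g, a, A, G, H⟩ := exists_coupledWaves_of_euler (ML := ML) (MU := MU) (Ms := Ms)
    (Mr := Mr) hK hctau hγ hτreg hureg hSreg hτpos hp he hmass hmom hen hm0 hVint hML hmbd
    (fun x => by
      have := hMs x
      rw [hη] at this
      simpa [riemannWave, add_comm] using this)
    (fun x => by
      have := hMr x
      rw [hη, abs_mul, abs_sub_comm, ← abs_mul] at this
      simpa [riemannWave, sub_eq_add_neg] using this)
  have hN : |riemannWave K γ 1 m0 τ u x t| + |riemannWave K γ (-1) m0 τ u x t| ≤ N1 + N2 := by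
    refine (H.sum_le ht).trans_eq ?_
    rw [← hV, ← hVb, hN1, hN2]
    ring
  have hN0 : 0 ≤ (N1 + N2) / 2 := by
    have := abs_nonneg (riemannWave K γ 1 m0 τ u x t)
    have := abs_nonneg (riemannWave K γ (-1) m0 τ u x t)
    linarith
  have hsum : |m0 x ^ (-(1 / (2 * γ))) * (m0 x * η x t + u x t)| +
      |m0 x ^ (-(1 / (2 * γ))) * (m0 x * η x t - u x t)| ≤ N1 + N2 := by
    refine le_of_eq_of_le ?_ hN
    simp only [riemannWave, max_eq_left ht, hη]
    congr 3 <;> ring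
  have hw : 0 < m0 x ^ (1 / (2 * γ)) := rpow_pos_of_pos hm _
  rw [rpow_neg hm.le, abs_mul, abs_mul, abs_of_pos (inv_pos.2 hw), ← mul_add,
    inv_mul_le_iff₀ hw] at hsum
  have hηpos : 0 < η x t := by
    rw [hη]
    positivity
  have hηm : m0 x * η x t ≤ (N1 + N2) / 2 * m0 x ^ (1 / (2 * γ)) := by
    have := le_abs_self (m0 x * η x t + u x t)
    have := le_abs_self (m0 x * η x t - u x t)
    linarith
  have hηle : η x t ≤ (N1 + N2) / 2 * ML ^ (1 / (2 * γ) - 1) := by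
    calc η x t ≤ (N1 + N2) / 2 * m0 x ^ (1 / (2 * γ) - 1) := by
          rw [rpow_sub_one hm.ne', ← mul_div_assoc, le_div_iff₀ hm]
          linarith
      _ ≤ _ := by
          refine mul_le_mul_of_nonneg_left
            (rpow_le_rpow_of_nonpos hML (hmbd x).1.le ?_) hN0
          rw [sub_nonpos, div_le_one (by positivity)]
          linarith
  refine ⟨?_, hηle, ?_⟩
  · calc |u x t| ≤ (N1 + N2) / 2 * m0 x ^ (1 / (2 * γ)) := by
          have := le_abs_self (m0 x * η x t + u x t)
          have := neg_abs_le (m0 x * η x t + u x t)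
          have := le_abs_self (m0 x * η x t - u x t)
          have := neg_abs_le (m0 x * η x t - u x t)
          rw [abs_le]
          constructor <;> linarith
      _ ≤ _ := by
          have := rpow_le_rpow hm.le (hmbd x).2.le (by positivity : 0 ≤ 1 / (2 * γ))
          gcongr
  · have hK0 : 0 < Ktau := by
      rw [hKtau]
      positivity
    have hτ : 1 / τ x t = Ktau⁻¹ * η x t ^ ((2 : ℝ) / (γ - 1)) := by
      have h2 : -((γ - 1) / 2) * (2 / (γ - 1)) = -1 := by field_simp
      rw [hη, mul_rpow (by positivity) (by positivity), ← hKtau, ← rpow_mul hz.le, h2,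
        rpow_neg_one, inv_mul_cancel_left₀ hK0.ne', one_div]
    rw [hτ]
    gcongr
end

section
/- Consider Lagrangian compressible flow of a polytropic ideal gas in a duct. Assume there exist positive constants M₁,…,M₁₁ such that the duct and initial entropy satisfy M₁ < a(x′) < M₂, |ȧ(x′)| < M₃, |ä(x′)| < M₄ for all x′, and M₅ < m(x) < M₆, |m_x(x)| < M₇, |m_{xx}(x)| < M₈ for all x, while a C² solution on ℝ×[0,∞) satisfies the a priori bounds |u(x,t)| < M₉ and ρ(x,t) < M₁₀ for all (x,t), and additionally ρ(x,t) > M₁₁ > 0 if 1 < γ ≤ 3. Then there exists a positive constant N̄, depending only on γ and M₁,…,M₁₁, such that: if Y < −N̄ or Q < −N̄ somewhere in the initial data, then a singularity forms in finite time (no such global C² solution exists). -/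
open Real

/-- A function satisfying `y' ≤ -ε y²` below the level `-N` cannot start below `-N` and exist
for a time `1 / (ε N)`. -/
theorem false_of_riccati_le {ε N t₀ T : ℝ} {y y' : ℝ → ℝ} (hε : 0 < ε) (hN : 0 < N) (hT : 0 < T)
    (hTN : 1 / N ≤ ε * T) (hy : ∀ t ∈ Set.Icc t₀ (t₀ + T), HasDerivAt y (y' t) t)
    (hle : ∀ t ∈ Set.Icc t₀ (t₀ + T), y t ≤ -N → y' t ≤ -ε * y t ^ 2) (h0 : y t₀ < -N) : False := by
  have hcont : ContinuousOn y (Set.Icc t₀ (t₀ + T)) := fun t ht =>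
    (hy t ht).continuousAt.continuousWithinAt
  have hstay : ∀ ⦃t⦄, t ∈ Set.Icc t₀ (t₀ + T) → y t ≤ -N := by
    refine image_le_of_deriv_right_lt_deriv_boundary' (B := fun _ => -N) (B' := fun _ => 0) hcont
      (fun t ht => (hy t (Set.Ico_subset_Icc_self ht)).hasDerivWithinAt) h0.le
      continuousOn_const (fun t _ => hasDerivWithinAt_const _ _ _) ?_
    intro t ht hyt
    have := hle t (Set.Ico_subset_Icc_self ht) hyt.le
    have h2 : 0 < ε * y t ^ 2 := by rw [hyt, neg_sq]; positivity
    linarith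
  have hinv : ∀ t ∈ Set.Icc t₀ (t₀ + T),
      HasDerivAt (fun τ => (y τ)⁻¹ - ε * τ) (-y' t / y t ^ 2 - ε * 1) t := fun t ht =>
    ((hy t ht).fun_inv (by have := hstay ht; linarith)).sub ((hasDerivAt_id t).const_mul ε)
  have hmono : MonotoneOn (fun τ => (y τ)⁻¹ - ε * τ) (Set.Icc t₀ (t₀ + T)) := by
    refine monotoneOn_of_deriv_nonneg (convex_Icc _ _)
      (fun t ht => (hinv t ht).continuousAt.continuousWithinAt)
      (fun t ht => (hinv t (interior_subset ht)).differentiableAt.differentiableWithinAt) ?_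
    intro t ht
    have ht' := interior_subset ht
    rw [(hinv t ht').deriv]
    have hneg : y t < 0 := by have := hstay ht'; linarith
    have hsq : 0 < y t ^ 2 := sq_pos_of_neg hneg
    have := hle t ht' (hstay ht')
    rw [sub_nonneg, le_div_iff₀ hsq]
    linarith
  have hl : t₀ ∈ Set.Icc t₀ (t₀ + T) := ⟨le_rfl, by linarith⟩
  have hr : t₀ + T ∈ Set.Icc t₀ (t₀ + T) := ⟨by linarith, le_rfl⟩
  have h1 := hmono hl hr (by linarith)
  have h2 : (y (t₀ + T))⁻¹ < 0 := inv_lt_zero.2 (by have := hstay hr; linarith)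
  have h3 : -(1 / N) < (y t₀)⁻¹ := by
    have := one_div_lt_one_div_of_lt hN (show N < -y t₀ by linarith)
    rw [one_div, one_div, inv_neg] at this
    rw [one_div]
    linarith
  simp only [mul_add] at h1
  linarith

/-- The value of a space derivative as a total derivative within the closed half-plane. -/
theorem hasDerivAt_slice_of_contDiffOn {f : ℝ → ℝ → ℝ} {n : WithTop ℕ∞} (hn : 1 ≤ n)
    (hf : ContDiffOn ℝ n (fun w : ℝ × ℝ => f w.1 w.2) (Set.univ ×ˢ Set.Ici (0 : ℝ)))
    {x t : ℝ} (ht : 0 ≤ t) :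
    HasDerivAt (fun x' => f x' t)
      (fderivWithin ℝ (fun w : ℝ × ℝ => f w.1 w.2) (Set.univ ×ˢ Set.Ici (0 : ℝ)) (x, t) (1, 0))
      x := by
  have hF := ((hf.differentiableOn (by positivity)) (x, t) ⟨trivial, ht⟩).hasFDerivWithinAt
  have hline : HasDerivWithinAt (fun x' : ℝ => (x', t)) ((1 : ℝ), (0 : ℝ)) Set.univ x :=
    ((hasDerivAt_id x).prodMk (hasDerivAt_const x t)).hasDerivWithinAt
  have hmaps : Set.MapsTo (fun x' : ℝ => (x', t)) Set.univ (Set.univ ×ˢ Set.Ici (0 : ℝ)) :=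
    fun x' _ => ⟨trivial, ht⟩
  have h := hF.comp_hasDerivWithinAt x hline hmaps
  exact hasDerivWithinAt_univ.1 h

theorem hasDerivAt_pdx_s3 {f : ℝ → ℝ → ℝ} {n : WithTop ℕ∞} (hn : 1 ≤ n)
    (hf : ContDiffOn ℝ n (fun w : ℝ × ℝ => f w.1 w.2) (Set.univ ×ˢ Set.Ici (0 : ℝ)))
    {x t : ℝ} (ht : 0 ≤ t) : HasDerivAt (fun x' => f x' t) (pdx f x t) x :=
  (hasDerivAt_slice_of_contDiffOn hn hf ht).differentiableAt.hasDerivAt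

theorem contDiffOn_pdx {f : ℝ → ℝ → ℝ}
    (hf : ContDiffOn ℝ 2 (fun w : ℝ × ℝ => f w.1 w.2) (Set.univ ×ˢ Set.Ici (0 : ℝ))) :
    ContDiffOn ℝ 1 (fun w : ℝ × ℝ => pdx f w.1 w.2) (Set.univ ×ˢ Set.Ici (0 : ℝ)) := by
  have hfd := hf.fderivWithin (m := 1) (uniqueDiffOn_univ.prod (uniqueDiffOn_Ici 0))
    (by norm_num)
  refine (hfd.clm_apply (contDiffOn_const (c := ((1 : ℝ), (0 : ℝ))))).congr ?_
  rintro ⟨x, t⟩ ⟨-, ht⟩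
  exact (hasDerivAt_slice_of_contDiffOn (by norm_num) hf ht).deriv

theorem contDiffAt_of_halfPlane {f : ℝ → ℝ → ℝ} {n : WithTop ℕ∞}
    (hf : ContDiffOn ℝ n (fun w : ℝ × ℝ => f w.1 w.2) (Set.univ ×ˢ Set.Ici (0 : ℝ)))
    {x t : ℝ} (ht : 0 < t) : ContDiffAt ℝ n (fun w : ℝ × ℝ => f w.1 w.2) (x, t) :=
  hf.contDiffAt (prod_mem_nhds Filter.univ_mem (Ici_mem_nhds ht))

theorem HasFDerivAt.hasDerivAt_prodMk {E : Type*} [NormedAddCommGroup E] [NormedSpace ℝ E]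
    {F : ℝ × ℝ → E} {F' : ℝ × ℝ →L[ℝ] E} {ξ η : ℝ → ℝ} {p q t : ℝ}
    (hF : HasFDerivAt F F' (ξ t, η t)) (hξ : HasDerivAt ξ p t) (hη : HasDerivAt η q t) :
    HasDerivAt (fun τ => F (ξ τ, η τ)) (F' (p, q)) t :=
  HasFDerivAt.comp_hasDerivAt (f := fun τ => (ξ τ, η τ)) t hF (hξ.prodMk hη)

theorem HasFDerivAt.hasDerivAt_fst {E : Type*} [NormedAddCommGroup E] [NormedSpace ℝ E]
    {F : ℝ × ℝ → E} {F' : ℝ × ℝ →L[ℝ] E} {x t : ℝ} (hF : HasFDerivAt F F' (x, t)) :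
    HasDerivAt (fun x' => F (x', t)) (F' (1, 0)) x :=
  HasFDerivAt.hasDerivAt_prodMk (ξ := fun x' => x') (η := fun _ => t) hF (hasDerivAt_id' x)
    (hasDerivAt_const x t)

theorem HasFDerivAt.hasDerivAt_snd {E : Type*} [NormedAddCommGroup E] [NormedSpace ℝ E]
    {F : ℝ × ℝ → E} {F' : ℝ × ℝ →L[ℝ] E} {x t : ℝ} (hF : HasFDerivAt F F' (x, t)) :
    HasDerivAt (fun t' => F (x, t')) (F' (0, 1)) t :=
  HasFDerivAt.hasDerivAt_prodMk (ξ := fun _ => x) (η := fun t' => t') hF (hasDerivAt_const t x)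
    (hasDerivAt_id' t)

/-- Chain rule along a curve `t ↦ (ξ t, t)`. -/
theorem hasDerivAt_along {f : ℝ → ℝ → ℝ} {n : WithTop ℕ∞} (hn : 1 ≤ n)
    (hf : ContDiffOn ℝ n (fun w : ℝ × ℝ => f w.1 w.2) (Set.univ ×ˢ Set.Ici (0 : ℝ)))
    {ξ : ℝ → ℝ} {c t : ℝ} (ht : 0 < t) (hξ : HasDerivAt ξ c t) :
    HasDerivAt (fun τ => f (ξ τ) τ) (pdt f (ξ t) t + c * pdx f (ξ t) t) t := by
  have hF := ((contDiffAt_of_halfPlane hf (x := ξ t) ht).differentiableAt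
    (by positivity)).hasFDerivAt
  set F' := fderiv ℝ (fun w : ℝ × ℝ => f w.1 w.2) (ξ t, t)
  have h1 : pdx f (ξ t) t = F' (1, 0) := by
    have h := hF.hasDerivAt_fst
    exact h.deriv
  have h2 : pdt f (ξ t) t = F' (0, 1) := by
    have h := hF.hasDerivAt_snd
    exact h.deriv
  have h3 := HasFDerivAt.hasDerivAt_prodMk (η := fun t' => t') hF hξ (hasDerivAt_id' t)
  have h4 : F' (c, 1) = F' (0, 1) + c * F' (1, 0) := by
    rw [← smul_eq_mul, ← map_smul, ← map_add]
    congr 1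
    ext <;> simp
  rw [h1, h2, ← h4]
  exact h3

/-- Mixed partial derivatives commute in the open half-plane. -/
theorem pdt_pdx_comm {f : ℝ → ℝ → ℝ}
    (hf : ContDiffOn ℝ 2 (fun w : ℝ × ℝ => f w.1 w.2) (Set.univ ×ˢ Set.Ici (0 : ℝ)))
    {x t : ℝ} (ht : 0 < t) : pdt (pdx f) x t = pdx (pdt f) x t := by
  set F : ℝ × ℝ → ℝ := fun w => f w.1 w.2
  have hF1 : ∀ w : ℝ × ℝ, 0 < w.2 → HasFDerivAt F (fderiv ℝ F w) w := fun w hw =>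
    ((contDiffAt_of_halfPlane hf (x := w.1) hw).differentiableAt (by norm_num)).hasFDerivAt
  have hx : ∀ y τ, 0 < τ → pdx f y τ = fderiv ℝ F (y, τ) (1, 0) := fun y τ hτ => by
    have h := (hF1 (y, τ) hτ).hasDerivAt_fst
    exact h.deriv
  have hxt : ∀ y τ, 0 < τ → pdt f y τ = fderiv ℝ F (y, τ) (0, 1) := fun y τ hτ => by
    have h := (hF1 (y, τ) hτ).hasDerivAt_snd
    exact h.deriv
  have hC := contDiffAt_of_halfPlane hf (x := x) ht
  have hF2 : HasFDerivAt (fderiv ℝ F) (fderiv ℝ (fderiv ℝ F) (x, t)) (x, t) :=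
    ((hC.fderiv_right (m := 1) (by norm_num)).differentiableAt (by norm_num)).hasFDerivAt
  have hsymm := hC.isSymmSndFDerivAt (by simp)
  have e1 : pdt (pdx f) x t = fderiv ℝ (fderiv ℝ F) (x, t) (0, 1) (1, 0) := by
    have h : HasDerivAt (fun τ => fderiv ℝ F (x, τ) (1, 0))
        (fderiv ℝ (fderiv ℝ F) (x, t) (0, 1) (1, 0)) t :=
      ((ContinuousLinearMap.apply ℝ ℝ ((1 : ℝ), (0 : ℝ))).hasFDerivAt.comp_hasDerivAt t
        hF2.hasDerivAt_snd :)
    refine (h.congr_of_eventuallyEq ?_).deriv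
    filter_upwards [Ioi_mem_nhds ht] with τ hτ using hx x τ hτ
  have e2 : pdx (pdt f) x t = fderiv ℝ (fderiv ℝ F) (x, t) (1, 0) (0, 1) := by
    have h : HasDerivAt (fun y => fderiv ℝ F (y, t) (0, 1))
        (fderiv ℝ (fderiv ℝ F) (x, t) (1, 0) (0, 1)) x :=
      ((ContinuousLinearMap.apply ℝ ℝ ((0 : ℝ), (1 : ℝ))).hasFDerivAt.comp_hasDerivAt x
        hF2.hasDerivAt_fst :)
    refine (h.congr_of_eventuallyEq ?_).deriv
    filter_upwards with y using hxt y t ht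
  rw [e1, e2]
  exact hsymm _ _

/-- Integral curves of a bounded `C¹` field exist for all positive times. -/
theorem exists_characteristic {c : ℝ → ℝ → ℝ}
    (hc : ContDiffOn ℝ 1 (fun w : ℝ × ℝ => c w.1 w.2) (Set.univ ×ˢ Set.Ici (0 : ℝ)))
    {C : ℝ} (hC : ∀ x t, 0 < t → |c x t| ≤ C) (x₀ : ℝ) {t₀ T : ℝ} (ht₀ : 0 < t₀) (hT : 0 < T) :
    ∃ ξ : ℝ → ℝ, ξ t₀ = x₀ ∧ ∀ t ∈ Set.Icc t₀ (t₀ + T), HasDerivAt ξ (c (ξ t) t) t := by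
  have hC0 : 0 ≤ C := (abs_nonneg _).trans (hC 0 1 one_pos)
  lift C to NNReal using hC0
  obtain ⟨L, hL⟩ : ∃ L : NNReal, (L : ℝ) = t₀ + T + 1 := ⟨⟨t₀ + T + 1, by linarith⟩, rfl⟩
  set R : NNReal := C * L with hR
  have hfd := hc.fderivWithin (m := 0) (uniqueDiffOn_univ.prod (uniqueDiffOn_Ici 0))
    (by norm_num)
  have hcont : ContinuousOn (fun w : ℝ × ℝ => pdx c w.1 w.2) (Set.univ ×ˢ Set.Ici (0 : ℝ)) := by
    refine (hfd.continuousOn.clm_apply (continuousOn_const (c := ((1 : ℝ), (0 : ℝ))))).congr ?_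
    rintro ⟨x, t⟩ ⟨-, ht⟩
    exact (hasDerivAt_slice_of_contDiffOn le_rfl hc ht).deriv
  have hcomp : IsCompact (Metric.closedBall x₀ (R : ℝ) ×ˢ Set.Icc (t₀ / 2) (t₀ + T + 1)) :=
    (isCompact_closedBall _ _).prod isCompact_Icc
  obtain ⟨D, hD⟩ := hcomp.exists_bound_of_continuousOn
    (hcont.mono (Set.prod_mono (Set.subset_univ _) fun t ht => Set.mem_Ici.2 (by linarith [ht.1])))
  have hmem : t₀ ∈ Set.Icc (t₀ / 2) (t₀ + T + 1) := ⟨by linarith, by linarith⟩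
  have hPL : IsPicardLindelof (fun t x => c x t) (⟨t₀, hmem⟩ : Set.Icc (t₀ / 2) (t₀ + T + 1))
      x₀ R 0 C D.toNNReal := by
    refine ⟨fun t ht => ?_, fun x _ => ?_, fun t ht x _ => ?_, ?_⟩
    · have ht' : 0 < t := by linarith [ht.1]
      refine (convex_closedBall _ _).lipschitzOnWith_of_nnnorm_hasDerivWithin_le
        (f' := fun x => pdx c x t)
        (fun x hx => (hasDerivAt_pdx_s3 le_rfl hc ht'.le).hasDerivWithinAt) (fun x hx => ?_)
      exact NNReal.le_toNNReal_of_coe_le (by simpa using hD (x, t) ⟨hx, ht⟩)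
    · exact hc.continuousOn.comp (f := fun t => (x, t)) (Continuous.continuousOn (by fun_prop))
        (fun t ht => ⟨trivial, Set.mem_Ici.2 (by linarith [Set.mem_Icc.1 ht |>.1])⟩)
    · exact hC x t (by linarith [ht.1])
    · have : (C : ℝ) * max (t₀ + T + 1 - t₀) (t₀ - t₀ / 2) ≤ C * (t₀ + T + 1) :=
        mul_le_mul_of_nonneg_left (max_le (by linarith) (by linarith)) C.2
      rw [NNReal.coe_zero, sub_zero, hR, NNReal.coe_mul, hL]
      exact this
  obtain ⟨ξ, h0, h1⟩ := hPL.exists_eq_forall_mem_Icc_hasDerivWithinAt₀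
  exact ⟨ξ, h0, fun t ht => (h1 t ⟨by linarith [ht.1], by linarith [ht.2]⟩).hasDerivAt
    (Icc_mem_nhds (by linarith [ht.1]) (by linarith [ht.2]))⟩

/-- The shift that decouples the gradient variables, divided by the specific volume. -/
noncomputable def riccatiShift (e₁ e₂ e₃ u w k n : ℝ) : ℝ := e₁ * u * w + e₂ * n - e₃ * k * w

/-- Coefficient of the linear term in the Riccati equation, before the shift. -/
noncomputable def riccatiLin (s G u w k n : ℝ) : ℝ :=
  n * (-1 / 2 + 2 * (s + 1) * G - s * G) + 3 / 2 * s * k * w - s * u * w / 2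

/-- Coefficient of the linear term in the Riccati equation. -/
noncomputable def riccatiOne (s G e₁ e₂ e₃ u w k n : ℝ) : ℝ :=
  (s + 1) * riccatiShift e₁ e₂ e₃ u w k n + riccatiLin s G u w k n - (s + 1) * G * n

/-- Coefficient of the constant term in the Riccati equation, divided by the specific volume. -/
noncomputable def riccatiZero (s G e₁ e₂ e₃ u w J k c n q : ℝ) : ℝ :=
  -(s + 1) / 2 * riccatiShift e₁ e₂ e₃ u w k n ^ 2
    - riccatiLin s G u w k n * riccatiShift e₁ e₂ e₃ u w k n
    + 2 * G * k * n * w + k ^ 2 * (J - 2 * s * w ^ 2)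
    + e₁ * (k ^ 2 * w ^ 2 + 2 * G * u * w * n + u * (u + k) * J)
    + e₂ * (q * c - s * n * (u + k) * w - 2 * s * G * n ^ 2)
    - e₃ * ((1 + 2 * (1 - s) * G) * k * n * w - s * k * w ^ 2 * (u + k) + k * (u + k) * J)

/-- The algebraic identity behind the decoupling: the total derivative of the gradient variable
along a characteristic is quadratic in that variable. -/
theorem gradient_riccati_identity {s G e₁ e₂ e₃ : ℝ} (h₁ : s / 2 + e₁ * (1 - s) / 2 = 0)
    (h₂ : G / 2 + e₂ * (-s - (s + 1) / 2) = 0)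
    (h₃ : -(3 / 2) * s + e₁ + e₃ * (3 * s - 1) / 2 = 0) (hG : G * (2 * s + 1) = 1)
    {v ux vx om X : ℝ} (hux : ux = v * om) (hvx : vx = v * X) (uxx vxx u w J c n q : ℝ) :
    let b := ux + c * vx
    let g := s * ((u + c * v) * w) + (s + 1) * (om + c * X)
    let c' := c * n - c * g
    let n' := c * q - n * g
    let w' := (u + c * v) * J
    let gx := s * (v * w) + (s + 1) * X
    let cx := n - c * gx
    let nx := q - n * gx
    let u' := c ^ 2 * vx + c ^ 2 * v ^ 2 * w - 2 * G * (c * n * v) + c * ux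
    let ux' := 2 * c * cx * vx + c ^ 2 * vxx + (2 * c * cx * v ^ 2 * w + 2 * c ^ 2 * v * vx * w
      + c ^ 2 * v ^ 2 * (v * J)) - 2 * G * (cx * n * v + c * nx * v + c * n * vx) + c * uxx
    let vx' := uxx + c * vxx
    let W := ux - c * vx + (2 * G + e₂) * (n * v) + e₁ * (u * w * v) - e₃ * (c * v ^ 2 * w)
    ux' - (c' * vx + c * vx') + (2 * G + e₂) * (n' * v + n * b)
      + e₁ * (u' * w * v + u * w' * v + u * w * b)
      - e₃ * (c' * v ^ 2 * w + 2 * c * v * b * w + c * v ^ 2 * w')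
    = (s + 1) / 2 * (om + c * X) * W + v * riccatiZero s G e₁ e₂ e₃ u w J (c * v) c n q
      + riccatiOne s G e₁ e₂ e₃ u w (c * v) n * W
      - (s + 1) / 2 * W * (om - c * X + 2 * G * n + riccatiShift e₁ e₂ e₃ u w (c * v) n) := by
  subst hux hvx
  intros
  simp only [riccatiZero, riccatiOne, riccatiLin, riccatiShift]
  linear_combination u * w * (v * om + c * v * X - 2 * G * n * v) * h₁
    + n * (v * om + c * v * X - 2 * G * n * v) * h₂
    + c * v * w * (v * om + c * v * X - 2 * G * n * v) * h₃
    - (n * (v * om + c * v * X - 2 * G * n * v) / 2 + 2 * c * v * n * v * w) * hG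

theorem exists_bound_riccatiZero (s G e₁ e₂ e₃ M : ℝ) : ∃ D : ℝ, 0 ≤ D ∧ ∀ u w J k c n q : ℝ,
    |u| ≤ M → |w| ≤ M → |J| ≤ M → |k| ≤ M → |c| ≤ M → |n| ≤ M → |q| ≤ M →
      |riccatiZero s G e₁ e₂ e₃ u w J k c n q| ≤ D := by
  have hcont : Continuous fun z : Fin 7 → ℝ =>
      riccatiZero s G e₁ e₂ e₃ (z 0) (z 1) (z 2) (z 3) (z 4) (z 5) (z 6) := by
    unfold riccatiZero riccatiLin riccatiShift
    fun_prop
  obtain ⟨D, hD⟩ := (isCompact_univ_pi fun _ : Fin 7 =>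
    (isCompact_Icc : IsCompact (Set.Icc (-M) M))).exists_bound_of_continuousOn hcont.continuousOn
  refine ⟨max D 0, le_max_right _ _, fun u w J k c n q hu hw hJ hk hc hn hq => ?_⟩
  refine (hD ![u, w, J, k, c, n, q] fun i _ => ?_).trans (le_max_left _ _)
  rw [Set.mem_Icc, ← abs_le]
  fin_cases i <;> assumption

theorem exists_bound_riccatiOne (s G e₁ e₂ e₃ M : ℝ) : ∃ D : ℝ, 0 ≤ D ∧ ∀ u w k n : ℝ,
    |u| ≤ M → |w| ≤ M → |k| ≤ M → |n| ≤ M → |riccatiOne s G e₁ e₂ e₃ u w k n| ≤ D := by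
  have hcont : Continuous fun z : Fin 4 → ℝ =>
      riccatiOne s G e₁ e₂ e₃ (z 0) (z 1) (z 2) (z 3) := by
    unfold riccatiOne riccatiLin riccatiShift
    fun_prop
  obtain ⟨D, hD⟩ := (isCompact_univ_pi fun _ : Fin 4 =>
    (isCompact_Icc : IsCompact (Set.Icc (-M) M))).exists_bound_of_continuousOn hcont.continuousOn
  refine ⟨max D 0, le_max_right _ _, fun u w k n hu hw hk hn => ?_⟩
  refine (hD ![u, w, k, n] fun i _ => ?_).trans (le_max_left _ _)
  rw [Set.mem_Icc, ← abs_le]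
  fin_cases i <;> assumption

theorem hasDerivAt_rpow_mul_rpow {f g : ℝ → ℝ} {f' g' t : ℝ} (κ s r : ℝ) (hf0 : 0 < f t)
    (hg0 : 0 < g t) (hf : HasDerivAt f f' t) (hg : HasDerivAt g g' t) :
    HasDerivAt (fun τ => κ * f τ ^ (-s) * g τ ^ (-r))
      (-(κ * f t ^ (-s) * g t ^ (-r)) * (s * (f' / f t) + r * (g' / g t))) t := by
  have h := ((hf.rpow_const (p := -s) (Or.inl hf0.ne')).const_mul κ).mul
    (hg.rpow_const (p := -r) (Or.inl hg0.ne'))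
  refine h.congr_deriv ?_
  rw [Real.rpow_sub_one hf0.ne', Real.rpow_sub_one hg0.ne']
  field_simp
  ring

/-- The gradient variable of one characteristic family without its weight; `R` is the
ratio of the characteristic speed to `m`. -/
noncomputable def unweightedGrad (G e₁ e₂ e₃ : ℝ) (v u a ad m R : ℝ → ℝ → ℝ) (x t : ℝ) : ℝ :=
  pdx u x t - m x t * R x t * pdx v x t + (2 * G + e₂) * (pdx m x t * R x t * v x t)
    + e₁ * (u x t * (ad x t / a x t) * v x t)
    - e₃ * (m x t * R x t * v x t ^ 2 * (ad x t / a x t))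

theorem riccati_le_neg_mul_sq {s B D₀ D₁ r F D y H : ℝ} (hs : 0 < s) (hB : 0 < B)
    (hD₀ : 0 ≤ D₀) (hD₁ : 0 ≤ D₁) (hr : 0 < r) (hrB : r ≤ B) (hF : |F| ≤ D₀) (hD : |D| ≤ D₁)
    (hyH : y = r * H) (hy : y ≤ -(1 + (B * D₀ + D₁) / ((s + 1) / (4 * B)))) :
    r * F + D * y - (s + 1) / 2 * y * H ≤ -((s + 1) / (4 * B)) * y ^ 2 := by
  set ε := (s + 1) / (4 * B) with hε
  have hε0 : 0 < ε := by positivity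
  have hq : 0 ≤ (B * D₀ + D₁) / ε := by positivity
  have hyneg : 1 ≤ -y := by linarith
  have h1 : r * F ≤ B * D₀ :=
    (mul_le_mul_of_nonneg_left ((le_abs_self F).trans hF) hr.le).trans
      (mul_le_mul_of_nonneg_right hrB hD₀)
  have h2 : D * y ≤ D₁ * (-y) := by
    have := mul_le_mul_of_nonneg_right ((neg_le_abs D).trans hD) (show 0 ≤ -y by linarith)
    linarith
  have h3 : B * D₀ + D₁ ≤ ε * (-y) := by
    rw [← div_le_iff₀' hε0]
    linarith
  have h4 : y ^ 2 ≤ B * (y * H) := by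
    have h5 : y ^ 2 = r * (y * H) := by rw [sq]; nth_rewrite 2 [hyH]; ring
    have h6 : 0 ≤ y * H := by
      rw [hyH, mul_assoc]
      exact mul_nonneg hr.le (mul_self_nonneg H)
    rw [h5]
    exact mul_le_mul_of_nonneg_right hrB h6
  have h5 : 2 * ε * y ^ 2 ≤ (s + 1) / 2 * y * H := by
    have h6 := mul_le_mul_of_nonneg_left h4 (show 0 ≤ 2 * ε by positivity)
    have h7 : 2 * ε * (B * (y * H)) = (s + 1) / 2 * y * H := by
      rw [hε]
      field_simp
      ring
    linarith
  nlinarith [mul_le_mul_of_nonneg_right h3 (show 0 ≤ -y by linarith),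
    mul_nonneg (mul_nonneg hB.le hD₀) (show 0 ≤ -y - 1 by linarith)]

/-- Blow-up along a characteristic: a global solution with bounded coefficients cannot have a
very negative weighted gradient variable at a positive time. The sign of `m` selects the
characteristic family. -/
theorem exists_forall_neg_le_weightedGrad {s G e₁ e₂ e₃ κ B : ℝ} (hs : 0 < s) (hB : 0 < B)
    (h₁ : s / 2 + e₁ * (1 - s) / 2 = 0) (h₂ : G / 2 + e₂ * (-s - (s + 1) / 2) = 0)
    (h₃ : -(3 / 2) * s + e₁ + e₃ * (3 * s - 1) / 2 = 0) (hG : G * (2 * s + 1) = 1) :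
    ∃ N > (0 : ℝ), ∀ (v u a ad add m p R : ℝ → ℝ → ℝ)
      (_ : ContDiffOn ℝ 2 (fun w : ℝ × ℝ => v w.1 w.2) (Set.univ ×ˢ Set.Ici (0 : ℝ)))
      (_ : ContDiffOn ℝ 2 (fun w : ℝ × ℝ => u w.1 w.2) (Set.univ ×ˢ Set.Ici (0 : ℝ)))
      (_ : ContDiffOn ℝ 2 (fun w : ℝ × ℝ => a w.1 w.2) (Set.univ ×ˢ Set.Ici (0 : ℝ)))
      (_ : ContDiffOn ℝ 2 (fun w : ℝ × ℝ => ad w.1 w.2) (Set.univ ×ˢ Set.Ici (0 : ℝ)))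
      (_ : ContDiffOn ℝ 2 (fun w : ℝ × ℝ => m w.1 w.2) (Set.univ ×ˢ Set.Ici (0 : ℝ)))
      (_ : ∀ x t, 0 ≤ t → 0 < v x t) (_ : ∀ x t, 0 ≤ t → 0 < a x t)
      (_ : ∀ x t, 0 < t → pdt a x t = u x t * ad x t)
      (_ : ∀ x t, 0 < t → pdx a x t = v x t * ad x t)
      (_ : ∀ x t, 0 < t → pdt ad x t = u x t * add x t)
      (_ : ∀ x t, 0 < t → pdx ad x t = v x t * add x t)
      (_ : ∀ x t, 0 < t → pdt v x t = pdx u x t)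
      (_ : ∀ x t, 0 < t → pdt u x t + a x t * pdx p x t = 0)
      (_ : ∀ x t, 0 < t → pdt m x t = 0)
      (_ : ∀ x t, R x t = κ * a x t ^ (-s) * v x t ^ (-(s + 1)))
      (_ : ∀ x t, 0 < t → p x t = G * (m x t * R x t) ^ 2 * v x t / a x t)
      (_ : ∀ x t, 0 < t → |u x t| ≤ B) (_ : ∀ x t, 0 < t → |ad x t / a x t| ≤ B)
      (_ : ∀ x t, 0 < t → |add x t / a x t| ≤ B) (_ : ∀ x t, 0 < t → |m x t * R x t| ≤ B)
      (_ : ∀ x t, 0 < t → |m x t * R x t * v x t| ≤ B)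
      (_ : ∀ x t, 0 < t → |pdx m x t * R x t| ≤ B)
      (_ : ∀ x t, 0 < t → |pdx (pdx m) x t * R x t| ≤ B)
      (_ : ∀ x t, 0 < t → v x t ^ ((1 - s) / 2) ≤ B) (x t : ℝ), 0 < t →
        -N ≤ v x t ^ (-((s + 1) / 2)) * unweightedGrad G e₁ e₂ e₃ v u a ad m R x t := by
  set M := B + B ^ 2 with hM
  have hBM : B ≤ M := by nlinarith
  obtain ⟨D₀, hD₀, hF⟩ := exists_bound_riccatiZero s G e₁ e₂ e₃ M
  obtain ⟨D₁, hD₁, hL⟩ := exists_bound_riccatiOne s G e₁ e₂ e₃ M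
  set ε := (s + 1) / (4 * B) with hε
  have hε0 : 0 < ε := by positivity
  set N := 1 + (B * D₀ + D₁) / ε with hN
  have hN0 : 0 < N := by positivity
  refine ⟨N, hN0, ?_⟩
  intro v u a ad add m p R hv2 hu2 ha2 had2 hm2 hv0 ha0 hat hax hadt hadx hmass hmom hmt hR hp
    hub hwb hjb hcb hkb hnb hqb hvb x₀ t₀ ht₀
  by_contra! hlt
  -- regularity of the speed
  have hR2 : ContDiffOn ℝ 2 (fun w : ℝ × ℝ => R w.1 w.2) (Set.univ ×ˢ Set.Ici (0 : ℝ)) := by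
    simp only [hR]
    exact (contDiffOn_const.mul (ha2.rpow_const_of_ne fun w hw => (ha0 w.1 w.2 hw.2).ne')).mul
      (hv2.rpow_const_of_ne fun w hw => (hv0 w.1 w.2 hw.2).ne')
  obtain ⟨ξ, hξ0, hξ⟩ := exists_characteristic (c := fun x t => m x t * R x t)
    ((hm2.mul hR2).of_le (by norm_num)) hcb x₀ ht₀ (T := 1 / (ε * N)) (by positivity)
  have h12 : (1 : WithTop ℕ∞) ≤ 2 := by norm_num
  -- first-order space derivatives
  have hwx : ∀ x t, 0 < t → HasDerivAt (fun x' => ad x' t / a x' t)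
      (v x t * (add x t / a x t - (ad x t / a x t) ^ 2)) x := fun x t ht => by
    have ha := (ha0 x t ht.le).ne'
    refine ((hasDerivAt_pdx_s3 h12 had2 ht.le).fun_div (hasDerivAt_pdx_s3 h12 ha2 ht.le) ha).congr_deriv ?_
    rw [hadx x t ht, hax x t ht]
    field_simp
  have hRx : ∀ x t, 0 < t → HasDerivAt (fun x' => R x' t)
      (-R x t * (s * (v x t * (ad x t / a x t)) + (s + 1) * (pdx v x t / v x t))) x :=
    fun x t ht => by
    simp only [hR]
    refine (hasDerivAt_rpow_mul_rpow (f := fun x' => a x' t) (g := fun x' => v x' t) κ s (s + 1)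
      (ha0 x t ht.le) (hv0 x t ht.le) (hasDerivAt_pdx_s3 h12 ha2 ht.le)
      (hasDerivAt_pdx_s3 h12 hv2 ht.le)).congr_deriv ?_
    rw [hax x t ht, mul_div_assoc]
  have hcx : ∀ x t, 0 < t → HasDerivAt (fun x' => m x' t * R x' t)
      (pdx m x t * R x t - m x t * R x t *
        (s * (v x t * (ad x t / a x t)) + (s + 1) * (pdx v x t / v x t))) x := fun x t ht =>
    ((hasDerivAt_pdx_s3 h12 hm2 ht.le).fun_mul (hRx x t ht)).congr_deriv (by ring)
  have hnx : ∀ x t, 0 < t → HasDerivAt (fun x' => pdx m x' t * R x' t)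
      (pdx (pdx m) x t * R x t - pdx m x t * R x t *
        (s * (v x t * (ad x t / a x t)) + (s + 1) * (pdx v x t / v x t))) x := fun x t ht =>
    ((hasDerivAt_pdx_s3 le_rfl (contDiffOn_pdx hm2) ht.le).fun_mul (hRx x t ht)).congr_deriv (by ring)
  have hut : ∀ x t, 0 < t → pdt u x t = (m x t * R x t) ^ 2 * pdx v x t
      + (m x t * R x t) ^ 2 * v x t ^ 2 * (ad x t / a x t)
      - 2 * G * ((m x t * R x t) * (pdx m x t * R x t) * v x t) := fun x t ht => by
    have ha := (ha0 x t ht.le).ne'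
    have hv := (hv0 x t ht.le).ne'
    have h := ((((hcx x t ht).fun_pow 2).const_mul G).fun_mul
      (hasDerivAt_pdx_s3 h12 hv2 ht.le)).fun_div (hasDerivAt_pdx_s3 h12 ha2 ht.le) ha
    have hpe : (fun x' => p x' t) = fun x' => G * (m x' t * R x' t) ^ 2 * v x' t / a x' t :=
      funext fun x' => hp x' t ht
    have h' := hmom x t ht
    rw [pdx, hpe, h.deriv, hax x t ht] at h'
    field_simp at h' ⊢
    linear_combination h' + m x t ^ 2 * R x t ^ 2 *
      (pdx v x t * a x t + v x t ^ 2 * ad x t) * hG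
  have hvxt : ∀ x t, 0 < t → pdt (pdx v) x t = pdx (pdx u) x t := fun x t ht => by
    rw [pdt_pdx_comm hv2 ht]
    simp only [pdx, hmass _ t ht]
  have hmxt : ∀ x t, 0 < t → pdt (pdx m) x t = 0 := fun x t ht => by
    rw [pdt_pdx_comm hm2 ht]
    simp only [pdx, hmt _ t ht, deriv_const]
  set y : ℝ → ℝ := fun τ => v (ξ τ) τ ^ (-((s + 1) / 2)) *
    unweightedGrad G e₁ e₂ e₃ v u a ad m R (ξ τ) τ with hy
  have hderiv : ∀ t ∈ Set.Icc t₀ (t₀ + 1 / (ε * N)), ∃ y', HasDerivAt y y' t ∧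
      (y t ≤ -N → y' ≤ -ε * y t ^ 2) := by
    intro t ht
    have ht0 : 0 < t := ht₀.trans_le ht.1
    have ha := ha0 (ξ t) t ht0.le
    have hv := hv0 (ξ t) t ht0.le
    have dv := hasDerivAt_along h12 hv2 ht0 (hξ t ht)
    have du := hasDerivAt_along h12 hu2 ht0 (hξ t ht)
    have da := hasDerivAt_along h12 ha2 ht0 (hξ t ht)
    have dad := hasDerivAt_along h12 had2 ht0 (hξ t ht)
    have dm := hasDerivAt_along h12 hm2 ht0 (hξ t ht)
    have dux := hasDerivAt_along le_rfl (contDiffOn_pdx hu2) ht0 (hξ t ht)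
    have dvx := hasDerivAt_along le_rfl (contDiffOn_pdx hv2) ht0 (hξ t ht)
    have dmx := hasDerivAt_along le_rfl (contDiffOn_pdx hm2) ht0 (hξ t ht)
    rw [hmass _ t ht0] at dv
    rw [hut _ t ht0] at du
    rw [hat _ t ht0, hax _ t ht0] at da
    rw [hadt _ t ht0, hadx _ t ht0] at dad
    rw [hmt _ t ht0, zero_add] at dm
    rw [hmxt _ t ht0, zero_add] at dmx
    rw [hvxt _ t ht0] at dvx
    have hvx := hasDerivAt_pdx_s3 h12 hv2 (x := ξ t) ht0.le
    have hute : (fun x' => pdt u x' t) = fun x' => (m x' t * R x' t) ^ 2 * pdx v x' t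
        + (m x' t * R x' t) ^ 2 * v x' t ^ 2 * (ad x' t / a x' t)
        - 2 * G * ((m x' t * R x' t) * (pdx m x' t * R x' t) * v x' t) :=
      funext fun x' => hut x' t ht0
    have hux := (((((hcx (ξ t) t ht0).fun_pow 2).fun_mul
      (hasDerivAt_pdx_s3 le_rfl (contDiffOn_pdx hv2) ht0.le)).fun_add
      ((((hcx (ξ t) t ht0).fun_pow 2).fun_mul (hvx.fun_pow 2)).fun_mul (hwx (ξ t) t ht0))).fun_sub
      ((((hcx (ξ t) t ht0).fun_mul (hnx (ξ t) t ht0)).fun_mul hvx).const_mul (2 * G)))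
    rw [pdt_pdx_comm hu2 ht0, pdx, hute, hux.deriv] at dux
    have dR := hasDerivAt_rpow_mul_rpow (f := fun τ => a (ξ τ) τ) (g := fun τ => v (ξ τ) τ)
      κ s (s + 1) ha hv da dv
    simp only [← hR] at dR
    have dw := (dad.fun_div da ha.ne').congr_deriv
      (show _ = (u (ξ t) t + m (ξ t) t * R (ξ t) t * v (ξ t) t) *
        (add (ξ t) t / a (ξ t) t - (ad (ξ t) t / a (ξ t) t) ^ 2) by field_simp)
    have dc := dm.fun_mul dR
    have dn := dmx.fun_mul dR
    have dr := dv.rpow_const (p := -((s + 1) / 2)) (Or.inl hv.ne')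
    rw [Real.rpow_sub_one hv.ne'] at dr
    have dy := dr.fun_mul ((((dux.fun_sub (dc.fun_mul dvx)).fun_add
      ((dn.fun_mul dv).const_mul (2 * G + e₂))).fun_add
      (((du.fun_mul dw).fun_mul dv).const_mul e₁)).fun_sub
      (((dc.fun_mul (dv.fun_pow 2)).fun_mul dw).const_mul e₃))
    have hid := gradient_riccati_identity h₁ h₂ h₃ hG
      (mul_div_cancel₀ (pdx u (ξ t) t) hv.ne').symm (mul_div_cancel₀ (pdx v (ξ t) t) hv.ne').symm
      (pdx (pdx u) (ξ t) t) (pdx (pdx v) (ξ t) t) (u (ξ t) t) (ad (ξ t) t / a (ξ t) t)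
      (add (ξ t) t / a (ξ t) t - (ad (ξ t) t / a (ξ t) t) ^ 2) (m (ξ t) t * R (ξ t) t)
      (pdx m (ξ t) t * R (ξ t) t) (pdx (pdx m) (ξ t) t * R (ξ t) t)
    set r := v (ξ t) t ^ (-((s + 1) / 2)) with hr
    have hr0 : 0 < r := Real.rpow_pos_of_pos hv _
    have hrv : r * v (ξ t) t = v (ξ t) t ^ ((1 - s) / 2) := by
      rw [hr, ← Real.rpow_add_one hv.ne']
      congr 1
      ring
    set F := riccatiZero s G e₁ e₂ e₃ (u (ξ t) t) (ad (ξ t) t / a (ξ t) t)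
      (add (ξ t) t / a (ξ t) t - (ad (ξ t) t / a (ξ t) t) ^ 2) (m (ξ t) t * R (ξ t) t * v (ξ t) t)
      (m (ξ t) t * R (ξ t) t) (pdx m (ξ t) t * R (ξ t) t) (pdx (pdx m) (ξ t) t * R (ξ t) t) with hFdef
    set D := riccatiOne s G e₁ e₂ e₃ (u (ξ t) t) (ad (ξ t) t / a (ξ t) t)
      (m (ξ t) t * R (ξ t) t * v (ξ t) t) (pdx m (ξ t) t * R (ξ t) t) with hDdef
    set H := pdx u (ξ t) t / v (ξ t) t - m (ξ t) t * R (ξ t) t * (pdx v (ξ t) t / v (ξ t) t)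
      + 2 * G * (pdx m (ξ t) t * R (ξ t) t) + riccatiShift e₁ e₂ e₃ (u (ξ t) t)
        (ad (ξ t) t / a (ξ t) t) (m (ξ t) t * R (ξ t) t * v (ξ t) t) (pdx m (ξ t) t * R (ξ t) t) with hH
    have hyH : y t = r * v (ξ t) t * H := by
      simp only [hy, hH, unweightedGrad, riccatiShift]
      field_simp
      ring
    refine ⟨r * v (ξ t) t * F + D * y t - (s + 1) / 2 * y t * H, dy.congr_deriv ?_, fun hyN => ?_⟩
    · simp only [hy, unweightedGrad]
      simp only at hid
      linear_combination r * hid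
    · refine riccati_le_neg_mul_sq hs hB hD₀ hD₁ (mul_pos hr0 hv) (hrv ▸ hvb _ t ht0)
        (hF _ _ _ _ _ _ _ ?_ ?_ ?_ ?_ ?_ ?_ ?_) (hL _ _ _ _ ?_ ?_ ?_ ?_) hyH hyN
      · exact (hub _ t ht0).trans hBM
      · exact (hwb _ t ht0).trans hBM
      · refine (abs_sub _ _).trans (add_le_add (hjb _ t ht0) ?_)
        rw [abs_pow]
        exact pow_le_pow_left₀ (abs_nonneg _) (hwb _ t ht0) 2
      · exact (hkb _ t ht0).trans hBM
      · exact (hcb _ t ht0).trans hBM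
      · exact (hnb _ t ht0).trans hBM
      · exact (hqb _ t ht0).trans hBM
      · exact (hub _ t ht0).trans hBM
      · exact (hwb _ t ht0).trans hBM
      · exact (hkb _ t ht0).trans hBM
      · exact (hnb _ t ht0).trans hBM
  choose! y' hy' hle using hderiv
  refine false_of_riccati_le hε0 hN0 (by positivity) (le_of_eq ?_) hy' hle ?_
  · field_simp
  · rw [← hξ0] at hlt
    exact hlt

theorem eq_initial_of_pdt_eq_zero_s3 {f : ℝ → ℝ → ℝ}
    (hf : ContDiffOn ℝ 2 (fun w : ℝ × ℝ => f w.1 w.2) (Set.univ ×ˢ Set.Ici (0 : ℝ)))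
    (h : ∀ x t, 0 < t → pdt f x t = 0) (x : ℝ) {t : ℝ} (ht : 0 ≤ t) : f x t = f x 0 := by
  rcases ht.eq_or_lt with rfl | ht
  · rfl
  obtain ⟨τ, hτ, h'⟩ := exists_hasDerivAt_eq_slope (fun τ => f x τ) (fun τ => pdt f x τ) ht
    (hf.continuousOn.comp (f := fun τ => (x, τ)) (Continuous.continuousOn (by fun_prop))
      fun τ hτ => ⟨trivial, hτ.1⟩)
    fun τ hτ => by simpa using hasDerivAt_along (by norm_num) hf hτ.1 (hasDerivAt_const τ x)
  rw [h x τ hτ.1, eq_comm, div_eq_zero_iff] at h'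
  rcases h' with h' | h' <;> linarith

theorem continuousOn_slice {F : ℝ × ℝ → ℝ} (hF : ContinuousOn F (Set.univ ×ˢ Set.Ici (0 : ℝ)))
    (x : ℝ) : ContinuousOn (fun t => F (x, t)) (Set.Ici 0) :=
  hF.comp (f := fun t => (x, t)) (Continuous.continuousOn (by fun_prop)) fun _ ht => ⟨trivial, ht⟩

theorem continuousOn_unweightedGrad {v u a ad m R : ℝ → ℝ → ℝ} (G e₁ e₂ e₃ : ℝ)
    (hv : ContDiffOn ℝ 2 (fun w : ℝ × ℝ => v w.1 w.2) (Set.univ ×ˢ Set.Ici (0 : ℝ)))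
    (hu : ContDiffOn ℝ 2 (fun w : ℝ × ℝ => u w.1 w.2) (Set.univ ×ˢ Set.Ici (0 : ℝ)))
    (ha : ContDiffOn ℝ 2 (fun w : ℝ × ℝ => a w.1 w.2) (Set.univ ×ˢ Set.Ici (0 : ℝ)))
    (had : ContDiffOn ℝ 2 (fun w : ℝ × ℝ => ad w.1 w.2) (Set.univ ×ˢ Set.Ici (0 : ℝ)))
    (hm : ContDiffOn ℝ 2 (fun w : ℝ × ℝ => m w.1 w.2) (Set.univ ×ˢ Set.Ici (0 : ℝ)))
    (hR : ContinuousOn (fun w : ℝ × ℝ => R w.1 w.2) (Set.univ ×ˢ Set.Ici (0 : ℝ)))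
    (ha0 : ∀ x t, 0 ≤ t → 0 < a x t) :
    ContinuousOn (fun w : ℝ × ℝ => unweightedGrad G e₁ e₂ e₃ v u a ad m R w.1 w.2)
      (Set.univ ×ˢ Set.Ici (0 : ℝ)) := by
  have hw := had.continuousOn.div ha.continuousOn fun w hw => (ha0 w.1 w.2 hw.2).ne'
  have hux := (contDiffOn_pdx hu).continuousOn
  have hvx := (contDiffOn_pdx hv).continuousOn
  have hmx := (contDiffOn_pdx hm).continuousOn
  have hv' := hv.continuousOn
  have hc := hm.continuousOn.mul hR
  exact (((hux.sub (hc.mul hvx)).add (continuousOn_const.mul ((hmx.mul hR).mul hv'))).add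
    (continuousOn_const.mul ((hu.continuousOn.mul hw).mul hv'))).sub
    (continuousOn_const.mul ((hc.mul (hv'.pow 2)).mul hw))

/-- The weighted gradient variables of a global solution are bounded below initially, by a constant
depending only on the a priori bounds. -/
theorem exists_forall_neg_le_initial {K s M1 M2 M3 M4 M6 M7 M8 M9 M10 M11 : ℝ} (hK : 0 < K)
    (hs : 0 < s) (hs1 : s - 1 ≠ 0) (hs3 : 3 * s - 1 ≠ 0) (hM1 : 0 < M1) (hM2 : 0 < M2)
    (hM3 : 0 < M3) (hM4 : 0 < M4) (hM6 : 0 < M6) (hM7 : 0 < M7) (hM8 : 0 < M8) (hM9 : 0 < M9)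
    (hM10 : 0 < M10) (hM11 : 0 < M11) :
    ∃ N > (0 : ℝ), ∀ (v u a ad add m p R : ℝ → ℝ → ℝ)
      (_ : ContDiffOn ℝ 2 (fun w : ℝ × ℝ => v w.1 w.2) (Set.univ ×ˢ Set.Ici (0 : ℝ)))
      (_ : ContDiffOn ℝ 2 (fun w : ℝ × ℝ => u w.1 w.2) (Set.univ ×ˢ Set.Ici (0 : ℝ)))
      (_ : ContDiffOn ℝ 2 (fun w : ℝ × ℝ => a w.1 w.2) (Set.univ ×ˢ Set.Ici (0 : ℝ)))
      (_ : ContDiffOn ℝ 2 (fun w : ℝ × ℝ => ad w.1 w.2) (Set.univ ×ˢ Set.Ici (0 : ℝ)))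
      (_ : ContDiffOn ℝ 2 (fun w : ℝ × ℝ => m w.1 w.2) (Set.univ ×ˢ Set.Ici (0 : ℝ)))
      (_ : ∀ x t, 0 ≤ t → 0 < v x t)
      (_ : ∀ x t, 0 < t → pdt a x t = u x t * ad x t)
      (_ : ∀ x t, 0 < t → pdx a x t = v x t * ad x t)
      (_ : ∀ x t, 0 < t → pdt ad x t = u x t * add x t)
      (_ : ∀ x t, 0 < t → pdx ad x t = v x t * add x t)
      (_ : ∀ x t, 0 < t → pdt v x t = pdx u x t)
      (_ : ∀ x t, 0 < t → pdt u x t + a x t * pdx p x t = 0)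
      (_ : ∀ x t, 0 < t → pdt m x t = 0)
      (_ : ∀ x t, R x t = √(K * (2 * s + 1)) * a x t ^ (-s) * v x t ^ (-(s + 1)))
      (_ : ∀ x t, p x t = K * m x t ^ 2 * a x t ^ (-(2 * s + 1)) * v x t ^ (-(2 * s + 1)))
      (_ : ∀ x t, 0 ≤ t → M1 < a x t ∧ a x t < M2) (_ : ∀ x t, 0 ≤ t → |ad x t| < M3)
      (_ : ∀ x t, 0 ≤ t → |add x t| < M4) (_ : ∀ x, |m x 0| < M6) (_ : ∀ x, |pdx m x 0| < M7)
      (_ : ∀ x, |pdx (pdx m) x 0| < M8) (_ : ∀ x t, 0 ≤ t → |u x t| < M9)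
      (_ : ∀ x t, 0 ≤ t → 1 / (a x t * v x t) < M10)
      (_ : s ≤ 1 → ∀ x t, 0 ≤ t → M11 < 1 / (a x t * v x t)) (x : ℝ),
        -N ≤ v x 0 ^ (-((s + 1) / 2)) * unweightedGrad (1 / (2 * s + 1)) (s / (s - 1))
          (1 / ((2 * s + 1) * (3 * s + 1))) (s * (3 * s - 5) / ((3 * s - 1) * (s - 1)))
          v u a ad m R x 0 := by
  have h2 : 0 < 2 * s + 1 := by positivity
  have h3 : 0 < 3 * s + 1 := by positivity
  set κ := √(K * (2 * s + 1)) with hκ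
  have hκ0 : 0 < κ := Real.sqrt_pos.2 (by positivity)
  have hκ2 : κ ^ 2 = K * (2 * s + 1) := Real.sq_sqrt (by positivity)
  set V := M2 * M10 with hV
  have hV0 : 0 < V := by positivity
  set P := κ * M1 ^ (-s) * V ^ s with hP
  have hP0 : 0 < P := by positivity
  set Z := (1 / (M1 * M11)) ^ ((1 - s) / 2) + V ^ ((s - 1) / 2) with hZ
  have hZ0 : 0 < Z := by positivity
  set B := M9 + M3 / M1 + M4 / M1 + M6 * (P * V) + M6 * P + M7 * (P * V) + M8 * (P * V) + Z with hB
  have hB1 : 0 < M3 / M1 := by positivity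
  have hB2 : 0 < M4 / M1 := by positivity
  have hB3 : 0 < M6 * (P * V) := by positivity
  have hB4 : 0 < M6 * P := by positivity
  have hB5 : 0 < M7 * (P * V) := by positivity
  have hB6 : 0 < M8 * (P * V) := by positivity
  obtain ⟨N, hN, h⟩ := exists_forall_neg_le_weightedGrad (s := s) (G := 1 / (2 * s + 1))
    (e₁ := s / (s - 1)) (e₂ := 1 / ((2 * s + 1) * (3 * s + 1)))
    (e₃ := s * (3 * s - 5) / ((3 * s - 1) * (s - 1))) (κ := κ) (B := B) hs (by positivity)
    (by field_simp; ring) (by field_simp; ring) (by field_simp; ring) (by field_simp)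
  refine ⟨N, hN, ?_⟩
  intro v u a ad add m p R hv2 hu2 ha2 had2 hm2 hv0 hat hax hadt hadx hmass hmom hmt hR hp
    hab hadb haddb hmb hmxb hmxxb hub hρ hρ' x
  have ha0 : ∀ x t, 0 ≤ t → 0 < a x t := fun x t ht => hM1.trans (hab x t ht).1
  have hm0 : ∀ x t, 0 ≤ t → m x t = m x 0 := fun x t ht => eq_initial_of_pdt_eq_zero_s3 hm2 hmt x ht
  have hmx0 : ∀ x t, 0 ≤ t → pdx m x t = pdx m x 0 := fun x t ht => by
    simp only [pdx, hm0 _ t ht]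
  have hmxx0 : ∀ x t, 0 ≤ t → pdx (pdx m) x t = pdx (pdx m) x 0 := fun x t ht => by
    unfold pdx at hmx0 ⊢
    simp only [hmx0 _ t ht]
  have hvV : ∀ x t, 0 ≤ t → (v x t)⁻¹ ≤ V := fun x t ht => by
    have hv := hv0 x t ht
    have ha := ha0 x t ht
    have : (v x t)⁻¹ = a x t * (1 / (a x t * v x t)) := by field_simp
    rw [this]
    exact mul_le_mul (hab x t ht).2.le (hρ x t ht).le (by positivity) hM2.le
  have hRv : ∀ x t, 0 ≤ t → 0 < R x t * v x t ∧ R x t * v x t ≤ P := fun x t ht => by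
    have hv := hv0 x t ht
    have ha := ha0 x t ht
    have : R x t * v x t = κ * a x t ^ (-s) * (v x t)⁻¹ ^ s := by
      rw [hR, Real.inv_rpow hv.le, ← Real.rpow_neg hv.le, neg_add, ← sub_eq_add_neg,
        Real.rpow_sub_one hv.ne']
      field_simp
    rw [this]
    refine ⟨by positivity, ?_⟩
    refine mul_le_mul (mul_le_mul_of_nonneg_left ?_ hκ0.le)
      (Real.rpow_le_rpow (by positivity) (hvV x t ht) hs.le) (by positivity) (by positivity)
    exact Real.rpow_le_rpow_of_nonpos hM1 (hab x t ht).1.le (by linarith)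
  have hRb : ∀ x t, 0 ≤ t → 0 < R x t ∧ R x t ≤ P * V := fun x t ht => by
    have hv := hv0 x t ht
    obtain ⟨h1, h2⟩ := hRv x t ht
    have : R x t = R x t * v x t * (v x t)⁻¹ := by field_simp
    refine ⟨pos_of_mul_pos_left h1 hv.le, ?_⟩
    rw [this]
    exact mul_le_mul h2 (hvV x t ht) (by positivity) hP0.le
  have hvZ : ∀ x t, 0 ≤ t → v x t ^ ((1 - s) / 2) ≤ Z := fun x t ht => by
    have hv := hv0 x t ht
    have ha := ha0 x t ht
    rcases le_total s 1 with h1 | h1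
    · have hvu : v x t ≤ 1 / (M1 * M11) := by
        have h4 := hρ' h1 x t ht
        rw [lt_div_iff₀ (by positivity)] at h4
        rw [le_div_iff₀ (by positivity)]
        have := mul_le_mul_of_nonneg_right (hab x t ht).1.le (show 0 ≤ M11 * v x t by positivity)
        linarith
      exact (Real.rpow_le_rpow hv.le hvu (by linarith)).trans
        (le_add_of_nonneg_right (by positivity))
    · have h5 : v x t ^ ((1 - s) / 2) = (v x t)⁻¹ ^ ((s - 1) / 2) := by
        rw [Real.inv_rpow hv.le, ← Real.rpow_neg hv.le]
        congr 1
        ring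
      rw [h5]
      exact (Real.rpow_le_rpow (by positivity) (hvV x t ht) (by linarith)).trans
        (le_add_of_nonneg_left (by positivity))
  have hmul : ∀ {b r X Y : ℝ}, |b| ≤ X → 0 < r → r ≤ Y → 0 < X → |b * r| ≤ X * Y :=
    fun hb hr hrY hX => by
    rw [abs_mul, abs_of_pos hr]
    exact mul_le_mul hb hrY hr.le hX.le
  have hdiv : ∀ {b X : ℝ} (x t : ℝ), 0 ≤ t → |b| < X → |b / a x t| ≤ X / M1 :=
    fun x t ht hb => by
    rw [abs_div, abs_of_pos (ha0 x t ht)]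
    exact div_le_div₀ ((abs_nonneg _).trans hb.le) hb.le hM1 (hab x t ht).1.le
  have hp' : ∀ x t, 0 < t →
      p x t = 1 / (2 * s + 1) * (m x t * R x t) ^ 2 * v x t / a x t := fun x t ht => by
    have hv := hv0 x t ht.le
    have ha := ha0 x t ht.le
    have e1 : a x t ^ (-(2 * s + 1)) = (a x t ^ (-s)) ^ 2 / a x t := by
      rw [← Real.rpow_mul_natCast ha.le, ← Real.rpow_sub_one ha.ne']
      congr 1
      push_cast
      ring
    have e2 : v x t ^ (-(2 * s + 1)) = (v x t ^ (-(s + 1))) ^ 2 * v x t := by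
      rw [← Real.rpow_mul_natCast hv.le, ← Real.rpow_add_one hv.ne']
      congr 1
      push_cast
      ring
    rw [hp, hR, e1, e2]
    field_simp
    rw [hκ2]
    ring
  have hpos := h v u a ad add m p R hv2 hu2 ha2 had2 hm2 hv0 ha0 hat hax hadt hadx hmass hmom hmt
    hR hp' (fun x t ht => by have := hub x t ht.le; linarith)
    (fun x t ht => by have := hdiv x t ht.le (hadb x t ht.le); linarith)
    (fun x t ht => by have := hdiv x t ht.le (haddb x t ht.le); linarith)
    (fun x t ht => by
      have := hmul (hmb x).le (hRb x t ht.le).1 (hRb x t ht.le).2 hM6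
      rw [hm0 x t ht.le]; linarith)
    (fun x t ht => by
      have := hmul (hmb x).le (hRv x t ht.le).1 (hRv x t ht.le).2 hM6
      rw [hm0 x t ht.le, mul_assoc]; linarith)
    (fun x t ht => by
      have := hmul (hmxb x).le (hRb x t ht.le).1 (hRb x t ht.le).2 hM7
      rw [hmx0 x t ht.le]; linarith)
    (fun x t ht => by
      have := hmul (hmxxb x).le (hRb x t ht.le).1 (hRb x t ht.le).2 hM8
      rw [hmxx0 x t ht.le]; linarith)
    (fun x t ht => by have := hvZ x t ht.le; linarith) x
  have hR2 : ContinuousOn (fun w : ℝ × ℝ => R w.1 w.2) (Set.univ ×ˢ Set.Ici (0 : ℝ)) := by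
    simp only [hR]
    exact (continuousOn_const.mul
      (ha2.continuousOn.rpow_const fun w hw => Or.inl (ha0 w.1 w.2 hw.2).ne')).mul
      (hv2.continuousOn.rpow_const fun w hw => Or.inl (hv0 w.1 w.2 hw.2).ne')
  have hcont := continuousOn_slice ((hv2.continuousOn.rpow_const (p := -((s + 1) / 2))
    fun w hw => Or.inl (hv0 w.1 w.2 hw.2).ne').mul
    (continuousOn_unweightedGrad (1 / (2 * s + 1)) (s / (s - 1))
      (1 / ((2 * s + 1) * (3 * s + 1))) (s * (3 * s - 5) / ((3 * s - 1) * (s - 1)))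
      hv2 hu2 ha2 had2 hm2 hR2 ha0)) x
  refine ge_of_tendsto (((hcont 0 Set.self_mem_Ici).mono Set.Ioi_subset_Ici_self).tendsto) ?_
  filter_upwards [self_mem_nhdsWithin] with t ht using hpos t ht

/-- The gradient variable written in terms of `z` is its weight times `unweightedGrad`, at the
level of values at one point. -/
theorem weighted_gradient_eq {s T v u a ad m mx ux vx z h g : ℝ} (hs1 : s - 1 ≠ 0)
    (hs3 : 3 * s - 1 ≠ 0) (hs4 : 2 * s + 1 ≠ 0) (hs5 : 3 * s + 1 ≠ 0) (hT : T ≠ 0) (hv : v ≠ 0)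
    (ha : a ≠ 0) :
    g * (ux + h * (m * (-s * z * vx / v) + (2 * s + 1 - 1) / (2 * s + 1) * mx * z))
        + (2 * s + 1 - 1) ^ 2 / (2 * (s / T) * (2 * s + 1 - 3)) * u * ad * a⁻¹ * (g * v / T)
        + (2 * s + 1 - 1) / ((2 * s + 1) * (3 * (2 * s + 1) - 1)) * mx * h * (g * z)
        - (3 * (2 * s + 1) - 13) * (2 * s + 1 - 1) ^ 3
            / (4 * (s / T) * (2 * s + 1 - 3) * (3 * (2 * s + 1) - 5)) * m * ad * (h / a)
            * (g * z * v / T)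
      = g * (ux - m * (s * h * z / v) * vx
          + (2 * (1 / (2 * s + 1)) + 1 / ((2 * s + 1) * (3 * s + 1))) * (mx * (s * h * z / v) * v)
          + s / (s - 1) * (u * (ad / a) * v)
          - s * (3 * s - 5) / ((3 * s - 1) * (s - 1))
            * (m * (s * h * z / v) * v ^ 2 * (ad / a))) := by
  have e1 : 2 * s + 1 - 1 = 2 * s := by ring
  have e2 : 2 * s + 1 - 3 = 2 * (s - 1) := by ring
  have e3 : 3 * (2 * s + 1) - 1 = 2 * (3 * s + 1) := by ring
  have e4 : 3 * (2 * s + 1) - 5 = 2 * (3 * s - 1) := by ring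
  have e5 : 3 * (2 * s + 1) - 13 = 2 * (3 * s - 5) := by ring
  rw [e1, e2, e3, e4, e5]
  generalize 2 * s + 1 = q₁ at *
  generalize 3 * s + 1 = q₂ at *
  generalize 3 * s - 1 = q₃ at *
  generalize s - 1 = q₄ at *
  field_simp
  ring

set_option maxHeartbeats 1000000 in
/-- singularity formation for compressible flow of a polytropic
ideal gas in a variable area duct.  Under uniform bounds on the duct, the
entropy, the velocity and the density, there is a threshold `N̄ > 0` depending
only on `γ` and the constants `M₁, …, M₁₁` such that if `Y(·,0)` or `Q(·,0)`
drops below `-N̄` somewhere, then no global C² solution exists (a singularity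
forms in finite time). -/
theorem stmt3
    (K ctau γ M1 M2 M3 M4 M5 M6 M7 M8 M9 M10 M11 : ℝ)
    (hK : 0 < K) (hctau : 0 < ctau) (hγ : 1 < γ) (h53 : γ ≠ 5 / 3) (h3 : γ ≠ 3)
    (hM1 : 0 < M1) (hM2 : 0 < M2) (hM3 : 0 < M3) (hM4 : 0 < M4) (hM5 : 0 < M5)
    (hM6 : 0 < M6) (hM7 : 0 < M7) (hM8 : 0 < M8) (hM9 : 0 < M9) (hM10 : 0 < M10)
    (hM11 : 0 < M11) :
    ∃ Nbar > (0:ℝ),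
      ∀ (Ktau Kc : ℝ)
        (hKtau : Ktau = (2 * Real.sqrt (K * γ) / (γ - 1)) ^ ((2:ℝ) / (γ - 1)))
        (hKc : Kc = Real.sqrt (K * γ) * Ktau ^ (-((γ + 1) / 2)))
        (v u S a ad add : ℝ → ℝ → ℝ)
        (hvreg : ContDiffOn ℝ 2 (fun w : ℝ × ℝ => v w.1 w.2)
          (Set.univ ×ˢ Set.Ici (0:ℝ)))
        (hureg : ContDiffOn ℝ 2 (fun w : ℝ × ℝ => u w.1 w.2)
          (Set.univ ×ˢ Set.Ici (0:ℝ)))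
        (hSreg : ContDiffOn ℝ 2 (fun w : ℝ × ℝ => S w.1 w.2)
          (Set.univ ×ˢ Set.Ici (0:ℝ)))
        (hareg : ContDiffOn ℝ 2 (fun w : ℝ × ℝ => a w.1 w.2)
          (Set.univ ×ˢ Set.Ici (0:ℝ)))
        (hadreg : ContDiffOn ℝ 2 (fun w : ℝ × ℝ => ad w.1 w.2)
          (Set.univ ×ˢ Set.Ici (0:ℝ)))
        (haddreg : ContDiffOn ℝ 2 (fun w : ℝ × ℝ => add w.1 w.2)
          (Set.univ ×ˢ Set.Ici (0:ℝ)))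
        (hvpos : ∀ x t, 0 ≤ t → 0 < v x t)
        (hat : ∀ x : ℝ, ∀ t > (0:ℝ), pdt a x t = u x t * ad x t)
        (hax : ∀ x : ℝ, ∀ t > (0:ℝ), pdx a x t = v x t * ad x t)
        (hadt : ∀ x : ℝ, ∀ t > (0:ℝ), pdt ad x t = u x t * add x t)
        (hadx : ∀ x : ℝ, ∀ t > (0:ℝ), pdx ad x t = v x t * add x t)
        (p : ℝ → ℝ → ℝ)
        (hp : ∀ x t, p x t = K * Real.exp (S x t / ctau) * a x t ^ (-γ) * v x t ^ (-γ))
        (hmass : ∀ x : ℝ, ∀ t > (0:ℝ), pdt v x t - pdx u x t = 0)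
        (hmom : ∀ x : ℝ, ∀ t > (0:ℝ), pdt u x t + a x t * pdx p x t = 0)
        (hent : ∀ x : ℝ, ∀ t > (0:ℝ), pdt S x t = 0)
        (m z α β ρ : ℝ → ℝ → ℝ)
        (hm : ∀ x t, m x t = Real.exp (S x t / (2 * ctau)))
        (hz : ∀ x t, z x t = 2 * Real.sqrt (K * γ) / (γ - 1) * v x t ^ (-((γ - 1) / 2)))
        (hα : ∀ x t, α x t = pdx u x t + a x t ^ (-((γ - 1) / 2))
            * (m x t * pdx z x t + (γ - 1) / γ * pdx m x t * z x t))
        (hβ : ∀ x t, β x t = pdx u x t - a x t ^ (-((γ - 1) / 2))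
            * (m x t * pdx z x t + (γ - 1) / γ * pdx m x t * z x t))
        (hρ : ∀ x t, ρ x t = 1 / (a x t * v x t))
        (hducta : ∀ x t, 0 ≤ t → M1 < a x t ∧ a x t < M2)
        (hductad : ∀ x t, 0 ≤ t → |ad x t| < M3)
        (hductadd : ∀ x t, 0 ≤ t → |add x t| < M4)
        (hmbd : ∀ x, M5 < m x 0 ∧ m x 0 < M6)
        (hmxbd : ∀ x, |pdx m x 0| < M7)
        (hmxxbd : ∀ x, |pdx (pdx m) x 0| < M8)
        (hubd : ∀ x t, 0 ≤ t → |u x t| < M9)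
        (hρbd : ∀ x t, 0 ≤ t → ρ x t < M10)
        (hρlow : 1 < γ ∧ γ ≤ 3 → ∀ x t, 0 ≤ t → M11 < ρ x t)
        (Y Q : ℝ → ℝ → ℝ)
        (hY : ∀ x t, Y x t =
          z x t ^ ((γ + 1) / (2 * (γ - 1))) * α x t
            + (γ - 1) ^ 2 / (2 * Kc * (γ - 3)) * u x t * ad x t * (a x t)⁻¹
              * z x t ^ ((γ - 3) / (2 * (γ - 1)))
            + (γ - 1) / (γ * (3 * γ - 1)) * pdx m x t * a x t ^ (-((γ - 1) / 2))
              * z x t ^ ((3 * γ - 1) / (2 * (γ - 1)))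
            - (3 * γ - 13) * (γ - 1) ^ 3 / (4 * Kc * (γ - 3) * (3 * γ - 5))
              * m x t * ad x t * a x t ^ (-((γ + 1) / 2))
              * z x t ^ ((3 * γ - 5) / (2 * (γ - 1))))
        (hQ : ∀ x t, Q x t =
          z x t ^ ((γ + 1) / (2 * (γ - 1))) * β x t
            + (γ - 1) ^ 2 / (2 * Kc * (γ - 3)) * u x t * ad x t * (a x t)⁻¹
              * z x t ^ ((γ - 3) / (2 * (γ - 1)))
            - (γ - 1) / (γ * (3 * γ - 1)) * pdx m x t * a x t ^ (-((γ - 1) / 2))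
              * z x t ^ ((3 * γ - 1) / (2 * (γ - 1)))
            + (3 * γ - 13) * (γ - 1) ^ 3 / (4 * Kc * (γ - 3) * (3 * γ - 5))
              * m x t * ad x t * a x t ^ (-((γ + 1) / 2))
              * z x t ^ ((3 * γ - 5) / (2 * (γ - 1)))),
        (∃ x, Y x 0 < -Nbar ∨ Q x 0 < -Nbar) → False := by
  obtain ⟨s, rfl⟩ : ∃ s, γ = 2 * s + 1 := ⟨(γ - 1) / 2, by ring⟩
  have hs : 0 < s := by linarith
  have hs1 : s - 1 ≠ 0 := fun h => h3 (by linarith)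
  have hs3 : 3 * s - 1 ≠ 0 := fun h => h53 (by linarith)
  set κ := √(K * (2 * s + 1)) with hκ
  set A := 2 * κ / (2 * s + 1 - 1) with hA
  have hκ0 : 0 < κ := Real.sqrt_pos.2 (by positivity)
  have hκA : κ = s * A := by
    rw [hA, add_sub_cancel_right]
    field_simp
  have hA0 : 0 < A := by
    rw [hκA] at hκ0
    exact pos_of_mul_pos_right hκ0 hs.le
  obtain ⟨N, hN, hmain⟩ := exists_forall_neg_le_initial (K := K) (s := s) hK hs hs1 hs3 hM1 hM2 hM3
    hM4 hM6 hM7 hM8 hM9 hM10 hM11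
  set C := A ^ ((s + 1) / (2 * s)) with hC
  have hC0 : 0 < C := by positivity
  refine ⟨C * N, by positivity, ?_⟩
  intro T Kc hT hKc v u S a ad add hv2 hu2 hS2 ha2 had2 _ hv0 hat hax hadt hadx p hp hmass hmom
    hent m z α β ρ hm hz hα hβ hρ hab hadb haddb hmb hmxb hmxxb hub hρb hρl Y Q hY hQ
  have hm' : m = fun x t => Real.exp (S x t / (2 * ctau)) := funext₂ hm
  have hm2 : ContDiffOn ℝ 2 (fun w : ℝ × ℝ => m w.1 w.2) (Set.univ ×ˢ Set.Ici (0 : ℝ)) := by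
    simp only [hm']
    exact (hS2.div_const _).exp
  have hmt : ∀ x t, 0 < t → pdt m x t = 0 := fun x t ht => by
    have h : HasDerivAt (fun τ => S x τ) 0 t := by
      simpa [hent x t ht] using hasDerivAt_along (by norm_num) hS2 ht (hasDerivAt_const t x)
    have h' := (h.div_const (2 * ctau)).exp
    rw [zero_div, mul_zero] at h'
    rw [hm']
    exact h'.deriv
  have hp' : ∀ x t, p x t = K * m x t ^ 2 * a x t ^ (-(2 * s + 1)) * v x t ^ (-(2 * s + 1)) :=
    fun x t => by
      rw [hp, hm, ← Real.exp_nat_mul]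
      congr 4
      push_cast
      field_simp
  have hm0 : ∀ x, 0 < m x 0 := fun x => hM5.trans (hmb x).1
  have hneg : ∀ f : ℝ → ℝ → ℝ, pdx (fun x t => -f x t) = fun x t => -pdx f x t := fun f => by
    funext x t
    exact deriv.fun_neg
  have hnegt : ∀ x t, 0 < t → pdt (fun x t => -m x t) x t = 0 := fun x t ht => by
    have h : pdt (fun x t => -m x t) x t = -pdt m x t := deriv.fun_neg
    rw [h, hmt x t ht, neg_zero]
  have hs1' : s ≤ 1 → ∀ x t, 0 ≤ t → M11 < 1 / (a x t * v x t) := fun h x t ht => by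
    rw [← hρ]
    exact hρl ⟨by linarith, by linarith⟩ x t ht
  have hρ' : ∀ x t, 0 ≤ t → 1 / (a x t * v x t) < M10 := fun x t ht => by
    rw [← hρ]
    exact hρb x t ht
  set R : ℝ → ℝ → ℝ := fun x t => κ * a x t ^ (-s) * v x t ^ (-(s + 1)) with hR
  have hlow₁ := hmain v u a ad add m p R hv2 hu2 ha2 had2 hm2 hv0 hat hax hadt hadx
    (fun x t ht => sub_eq_zero.1 (hmass x t ht)) hmom hmt (fun _ _ => rfl) hp' hab hadb haddb
    (fun x => by rw [abs_of_pos (hm0 x)]; exact (hmb x).2) hmxb hmxxb hub hρ' hs1'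
  have hlow₂ := hmain v u a ad add (fun x t => -m x t) p R hv2 hu2 ha2 had2 hm2.neg hv0 hat hax
    hadt hadx (fun x t ht => sub_eq_zero.1 (hmass x t ht)) hmom hnegt (fun _ _ => rfl)
    (fun x t => by rw [neg_sq]; exact hp' x t) hab hadb haddb
    (fun x => by rw [abs_neg, abs_of_pos (hm0 x)]; exact (hmb x).2)
    (fun x => by rw [hneg, abs_neg]; exact hmxb x)
    (fun x => by rw [hneg, hneg, abs_neg]; exact hmxxb x) hub hρ' hs1'
  have hT' : T = A ^ (1 / s) := by
    rw [hT, add_sub_cancel_right]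
    congr 1
    field_simp
  have hT0 : 0 < T := hT' ▸ by positivity
  have hKc' : Kc = s / T := by
    have hTs : T ^ s = A := by
      rw [hT', ← Real.rpow_mul hA0.le, one_div_mul_cancel hs.ne', Real.rpow_one]
    rw [hKc, show -((2 * s + 1 + 1) / 2) = -s - 1 by ring, Real.rpow_sub_one hT0.ne',
      Real.rpow_neg hT0.le, hTs, hκA]
    field_simp
  have hzx : ∀ x, pdx z x 0 = -s * z x 0 * pdx v x 0 / v x 0 := fun x => by
    have hvx := hv0 x 0 le_rfl
    have h := ((hasDerivAt_pdx_s3 (by norm_num) hv2 (x := x) le_rfl).rpow_const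
      (p := -((2 * s + 1 - 1) / 2)) (Or.inl hvx.ne')).const_mul A
    rw [show (fun y => A * v y 0 ^ (-((2 * s + 1 - 1) / 2))) = fun y => z y 0 from
      funext fun y => (hz y 0).symm] at h
    rw [pdx, h.deriv, hz, Real.rpow_sub_one hvx.ne']
    ring
  have hpow : ∀ x, 0 < z x 0 ∧
      z x 0 ^ ((2 * s + 1 + 1) / (2 * (2 * s + 1 - 1))) = C * v x 0 ^ (-((s + 1) / 2)) ∧
      z x 0 ^ ((2 * s + 1 - 3) / (2 * (2 * s + 1 - 1))) =
        C * v x 0 ^ (-((s + 1) / 2)) * v x 0 / T ∧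
      z x 0 ^ ((3 * (2 * s + 1) - 1) / (2 * (2 * s + 1 - 1))) =
        C * v x 0 ^ (-((s + 1) / 2)) * z x 0 ∧
      z x 0 ^ ((3 * (2 * s + 1) - 5) / (2 * (2 * s + 1 - 1))) =
        C * v x 0 ^ (-((s + 1) / 2)) * z x 0 * v x 0 / T := fun x => by
    have hvx := hv0 x 0 le_rfl
    have hz' : z x 0 = A * v x 0 ^ (-s) := by
      rw [hz]
      congr 3
      ring
    have hz0 : 0 < z x 0 := hz' ▸ by positivity
    have hg : z x 0 ^ ((s + 1) / (2 * s)) = C * v x 0 ^ (-((s + 1) / 2)) := by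
      rw [hz', Real.mul_rpow hA0.le (by positivity), ← Real.rpow_mul hvx.le]
      congr 2
      field_simp
    have hi : z x 0 ^ (-(1 / s)) = v x 0 / T := by
      rw [hz', Real.mul_rpow hA0.le (by positivity), ← Real.rpow_mul hvx.le, neg_mul_neg,
        mul_one_div_cancel hs.ne', Real.rpow_one, Real.rpow_neg hA0.le, ← hT']
      ring
    refine ⟨hz0, ?_, ?_, ?_, ?_⟩
    · rw [← hg]
      congr 1
      field_simp
      ring
    · rw [mul_div_assoc, ← hg, ← hi, ← Real.rpow_add hz0]
      congr 1
      field_simp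
      ring
    · rw [← hg, ← Real.rpow_add_one hz0.ne']
      congr 1
      field_simp
      ring
    · rw [mul_div_assoc, ← hg, ← hi, ← Real.rpow_add_one hz0.ne', ← Real.rpow_add hz0]
      congr 1
      field_simp
      ring
  have hRz : ∀ x, R x 0 = s * a x 0 ^ (-s) * z x 0 / v x 0 := fun x => by
    have hvx := hv0 x 0 le_rfl
    simp only [hR]
    rw [neg_add, ← sub_eq_add_neg, Real.rpow_sub_one hvx.ne', hκA, hz,
      show (2 * s + 1 - 1) / 2 = s by ring]
    ring
  have hidn : ∀ x (m' mx : ℝ), _ := fun x m' mx =>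
    weighted_gradient_eq (u := u x 0) (ad := ad x 0) (m := m') (mx := mx) (ux := pdx u x 0)
      (vx := pdx v x 0) (z := z x 0) (h := a x 0 ^ (-s)) (g := C * v x 0 ^ (-((s + 1) / 2)))
      hs1 hs3 (by positivity) (by positivity) hT0.ne' (hv0 x 0 le_rfl).ne'
      (hM1.trans (hab x 0 le_rfl).1).ne'
  have hh : ∀ x, a x 0 ^ (-((2 * s + 1 - 1) / 2)) = a x 0 ^ (-s) ∧
      a x 0 ^ (-((2 * s + 1 + 1) / 2)) = a x 0 ^ (-s) / a x 0 := fun x => by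
    rw [← Real.rpow_sub_one (hM1.trans (hab x 0 le_rfl).1).ne']
    constructor <;> congr 1 <;> ring
  rintro ⟨x, h | h⟩
  · obtain ⟨-, h1, h2, h3, h4⟩ := hpow x
    have hYx := hY x 0
    rw [hα, h1, h2, h3, h4, hKc', (hh x).1, (hh x).2, hzx, hidn x, ← hRz] at hYx
    have := mul_le_mul_of_nonneg_left (hlow₁ x) hC0.le
    rw [unweightedGrad, ← mul_assoc] at this
    linarith
  · obtain ⟨-, h1, h2, h3, h4⟩ := hpow x
    have hQx := hQ x 0
    have hi := hidn x (-m x 0) (-pdx m x 0)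
    rw [hβ, h1, h2, h3, h4, hKc', (hh x).1, (hh x).2, hzx] at hQx
    rw [← hRz] at hi
    have := mul_le_mul_of_nonneg_left (hlow₂ x) hC0.le
    rw [unweightedGrad, ← mul_assoc, hneg] at this
    linarith
end
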